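/- Let Λ = {1,…,L}² and β ≥ 1, and set H = ⌊log L/(4β)⌋. There exists an absolute integer constant K such that for every integer k ≥ K, π_Λ^0( #{v ∈ Λ : η_v ≤ H − k} > e^{−2βk}·L² ) ≤ exp( −e^{βk}·L ), where π_Λ^0 is the SOS Gibbs measure with zero boundary conditions, floor at 0 and ceiling at n⁺ with log L ≤ n⁺ ≤ L. -/

import Mathlib

open scoped Classical
open Filter

noncomputable section

namespace SOSPaper

/-- Sites of the lattice `ℤ²`. -/
abbrev Site : Type := ℤ × ℤ

/-- Height configurations on `ℤ²`. -/
abbrev Config : Type := Site → ℤ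

/-- Nearest-neighbour adjacency on `ℤ²`. -/
def SiteAdj (x y : Site) : Prop := (x.1 - y.1).natAbs + (x.2 - y.2).natAbs = 1

/-- The four nearest neighbours of a site. -/
def nbrs (x : Site) : Finset Site :=
  {(x.1 + 1, x.2), (x.1 - 1, x.2), (x.1, x.2 + 1), (x.1, x.2 - 1)}

/-- The SOS Hamiltonian on `Λ` with boundary condition `ξ`:
`H_Λ^ξ(η) = (1/2) Σ_{x,y∈Λ adjacent} |η_x-η_y| + Σ_{x∈Λ, y∉Λ adjacent} |η_x-ξ_y|`. -/
def sosH (Λ : Finset Site) (ξ : Config) (η : Config) : ℝ :=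
  (1 / 2) * ∑ x ∈ Λ, ∑ y ∈ (nbrs x).filter (fun y => y ∈ Λ), ((|η x - η y| : ℤ) : ℝ)
    + ∑ x ∈ Λ, ∑ y ∈ (nbrs x).filter (fun y => y ∉ Λ), ((|η x - ξ y| : ℤ) : ℝ)

/-- Extension of `g : Λ → ℤ` by the boundary condition `ξ` off `Λ`. -/
def extendC (Λ : Finset Site) (ξ : Config) (g : {x // x ∈ Λ} → ℤ) : Config :=
  fun x => if h : x ∈ Λ then g ⟨x, h⟩ else ξ x

/-- Gibbs weight `exp(-β·H_Λ^ξ(η) + F(η))`, subject to the single-site constraint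
`η_x ∈ K` for all `x ∈ Λ` (floor/ceiling constraints); `F` is an extra external field
(`F = 0` for the plain SOS model). -/
def gWeight (β : ℝ) (Λ : Finset Site) (ξ : Config) (K : Set ℤ) (F : Config → ℝ)
    (η : Config) : ℝ :=
  if ∀ x ∈ Λ, η x ∈ K then Real.exp (-β * sosH Λ ξ η + F η) else 0

/-- The Gibbs probability of a set `A` of configurations: normalized sum of Gibbs
weights over all configurations agreeing with `ξ` off `Λ`. -/
def gProb (β : ℝ) (Λ : Finset Site) (ξ : Config) (K : Set ℤ) (F : Config → ℝ)
    (A : Set Config) : ℝ :=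
  (∑' g : {x // x ∈ Λ} → ℤ, Set.indicator A (gWeight β Λ ξ K F) (extendC Λ ξ g))
    / ∑' g : {x // x ∈ Λ} → ℤ, gWeight β Λ ξ K F (extendC Λ ξ g)

/-- The box `Λ_L = {1,…,L}²`. -/
def box (L : ℕ) : Finset Site := Finset.Icc ((1 : ℤ), (1 : ℤ)) ((L : ℤ), (L : ℤ))

/-- The equilibrium height `H(L) = ⌊log L / (4β)⌋`. -/
def eqHt (β : ℝ) (L : ℕ) : ℤ := ⌊Real.log L / (4 * β)⌋

set_option linter.all false

inductive Turn | S | L | R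

inductive Tr
  | l (v : ℕ)
  | n (a b c : Tr)

def Tr.mir : Tr → Tr
  | .l v => .l v
  | .n a b c => .n a.mir c.mir b.mir

def sy (a b : Tr) : Tr := .n a b b.mir

def Turn.pick : Turn → Tr → Tr → Tr → Tr
  | .S, a, _, _ => a
  | .L, _, b, _ => b
  | .R, _, _, c => c

def Tr.desc : Tr → List Turn → Tr
  | .l v, _ => .l v
  | .n a b c, [] => .n a b c
  | .n a _ _, .S :: p => a.desc p
  | .n _ b _, .L :: p => b.desc p
  | .n _ _ c, .R :: p => c.desc p

def Tr.mx : Tr → ℕ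
  | .l v => v
  | .n a b c => max a.mx (max b.mx c.mx)

/-- undo a turn on a direction -/
def un : Turn → ℤ × ℤ → ℤ × ℤ
  | .S, d => d
  | .L, d => (d.2, -d.1)
  | .R, d => (-d.2, d.1)

def rt : Turn → ℤ × ℤ → ℤ × ℤ
  | .S, d => d
  | .L, d => (-d.2, d.1)
  | .R, d => (d.2, -d.1)

/-- positions, most recent first -/
def bk : List Turn → ℤ × ℤ → ℤ × ℤ → List (ℤ × ℤ)
  | [], p, d => [p, (p.1 - d.1, p.2 - d.2)]
  | t :: T, p, d => p :: bk T (p.1 - d.1, p.2 - d.2) (un t d)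

def memb (x : ℤ × ℤ) : List (ℤ × ℤ) → Bool
  | [] => false
  | y :: l => (decide (x.1 = y.1) && decide (x.2 = y.2)) || memb x l

def dup : List (ℤ × ℤ) → Bool
  | [] => false
  | x :: l => memb x l || dup l

def term (root : Tr) (t : Turn) (q : List Turn) : ℕ :=
  if memb (0, 0) (bk q (-1, 0) (un t (1, 0))) then 0 else (root.desc (t :: q)).mx

def chk (root : Tr) : Tr → List Turn → Bool
  | .l 0, q => dup (bk q (0, 0) (1, 0))
  | .l (v + 1), q =>
      Nat.ble (1000 * (term root .S q + (term root .L q + term root .R q))) (2718 * (v + 1))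
  | .n a b c, q => chk root a (q ++ [.S]) && (chk root b (q ++ [.L]) && chk root c (q ++ [.R]))

def sawTree : Tr :=
  sy (sy (sy (sy (sy (.l 3000) (.n (.l 2995) (.n (.n (.n (.n (.l 2053) (.l 0) (.l 2802)) (.l 0)
  (.l 2927)) (.l 0) (.l 2971)) (.l 0) (.l 2988)) (.l 2995))) (.n (.n (.l 2954) (.n (.n (.n (.n
  (.l 2435) (.l 2053) (.l 2435)) (.n (.l 0) (.l 2708) (.l 2053)) (.l 2712)) (.n (.l 0) (.l 2853)
  (.n (.l 2053) (.l 0) (.l 2764))) (.l 2854)) (.n (.l 0) (.l 0) (.n (.n (.l 2053) (.l 0) (.l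
  2784)) (.l 0) (.l 2923))) (.l 2923)) (.l 2954)) (.n (.n (.n (.n (.n (.l 1706) (.l 949) (.l
  1706)) (.l 0) (.l 1982)) (.l 0) (.n (.l 2762) (.n (.l 2406) (.l 2028) (.l 2406)) (.l 2762)))
  (.l 0) (.n (.l 2868) (.n (.n (.l 2427) (.l 2044) (.l 2427)) (.l 2700) (.l 2704)) (.l 2868)))
  (.l 0) (.n (.l 2927) (.n (.n (.n (.l 2433) (.l 2051) (.l 2433)) (.n (.l 0) (.l 2706) (.l
  2051)) (.l 2710)) (.n (.l 0) (.l 0) (.n (.l 2051) (.l 0) (.l 2848))) (.l 2850)) (.l 2927)))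
  (.l 2974))) (.n (.n (.n (.l 2858) (.n (.n (.n (.l 2610) (.n (.l 2049) (.l 2473) (.l 2473)) (.l
  2610)) (.n (.n (.l 0) (.l 2661) (.l 2049)) (.l 2672) (.n (.l 2436) (.l 2049) (.l 2436))) (.l
  2713)) (.n (.n (.l 0) (.l 0) (.n (.l 2049) (.l 0) (.l 2790))) (.l 0) (.n (.n (.l 2428) (.l
  2049) (.l 2428)) (.n (.l 0) (.l 2682) (.l 2049)) (.l 2686))) (.l 2802)) (.l 2858)) (.n (.n (.n
  (.n (.l 2106) (.n (.l 971) (.l 1717) (.l 1728)) (.l 2106)) (.n (.l 0) (.l 1959) (.n (.l 1717)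
  (.l 960) (.l 1717))) (.l 2311)) (.n (.l 0) (.l 2644) (.n (.n (.l 1717) (.l 960) (.l 1717)) (.l 0) (.l 1980))) (.n (.l 2618) (.n (.l 2516) (.n (.l 2013) (.l 0) (.l 2382)) (.l 2516)) (.l
  2618))) (.n (.l 0) (.l 0) (.n (.n (.n (.l 1717) (.l 960) (.l 1717)) (.l 0) (.l 1987)) (.l 0)
  (.n (.l 2724) (.n (.l 2410) (.l 2038) (.l 2410)) (.l 0)))) (.n (.l 2774) (.n (.n (.l 2584) (.n
  (.l 2038) (.l 2449) (.l 2449)) (.l 2584)) (.n (.n (.l 0) (.l 2647) (.l 2038)) (.l 0) (.n (.l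
  2415) (.l 2038) (.l 2415))) (.l 2687)) (.l 2774))) (.l 2889)) (.n (.n (.n (.n (.n (.l 1542)
  (.n (.l 1263) (.l 914) (.l 1263)) (.l 1542)) (.n (.n (.l 583) (.l 30) (.l 583)) (.l 0) (.l
  862)) (.l 1644)) (.l 0) (.n (.l 1969) (.n (.l 1838) (.n (.l 951) (.l 0) (.l 1698)) (.l 1838))
  (.l 1969))) (.l 0) (.n (.n (.l 2627) (.n (.l 2524) (.n (.l 2014) (.l 0) (.l 2390)) (.l 2524))
  (.l 2627)) (.n (.n (.l 2096) (.n (.l 968) (.l 1711) (.l 1722)) (.l 2096)) (.n (.l 0) (.l 0)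
  (.n (.l 1953) (.l 957) (.l 1953))) (.l 2301)) (.l 2664))) (.l 0) (.n (.n (.l 2772) (.n (.n (.l
  2582) (.n (.l 2039) (.l 2447) (.l 2447)) (.l 2582)) (.n (.l 2647) (.l 0) (.n (.l 2414) (.l
  2039) (.l 2414))) (.l 2685)) (.l 2772)) (.n (.n (.n (.l 2105) (.n (.l 971) (.l 1716) (.l
  1727)) (.l 2105)) (.n (.l 0) (.l 1957) (.n (.l 1716) (.l 959) (.l 1716))) (.l 2310)) (.n (.l 0) (.l 0) (.n (.n (.l 1716) (.l 959) (.l 1716)) (.l 0) (.l 2010))) (.n (.l 2616) (.n (.l 2513)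
  (.n (.l 2010) (.l 0) (.l 2379)) (.l 2513)) (.l 2616))) (.l 2813))) (.n (.l 2948) (.n (.l 2931)
  (.n (.n (.n (.n (.l 2435) (.l 2055) (.l 2435)) (.n (.l 0) (.l 2705) (.l 2055)) (.l 2710)) (.n
  (.l 0) (.l 0) (.n (.l 2055) (.l 0) (.l 2845))) (.l 2846)) (.l 0) (.l 2911)) (.l 2931)) (.n (.n
  (.l 2931) (.l 2931) (.n (.n (.n (.l 1990) (.l 2741) (.l 0)) (.l 2867) (.l 0)) (.l 2914) (.l 0))) (.l 2945) (.l 0))))) (.n (.n (.n (.n (.l 2726) (.n (.n (.l 2643) (.n (.n (.l 2038) (.l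
  2449) (.l 2449)) (.l 2594) (.l 2594)) (.l 2643)) (.n (.n (.l 2616) (.l 0) (.n (.l 2403) (.l
  2038) (.l 2403))) (.l 0) (.n (.l 2566) (.n (.l 2038) (.l 2434) (.l 2434)) (.l 2566))) (.l
  2681)) (.l 2726)) (.n (.n (.n (.l 2344) (.n (.n (.l 1007) (.l 1740) (.l 1762)) (.n (.l 2158)
  (.l 0) (.l 1896)) (.l 2162)) (.l 2344)) (.n (.n (.l 0) (.l 1966) (.n (.l 1740) (.l 985) (.l
  1740))) (.l 2306) (.n (.l 2130) (.n (.l 996) (.l 1740) (.l 1751)) (.l 2130))) (.l 2458)) (.n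
  (.n (.l 0) (.l 0) (.n (.n (.l 1740) (.l 985) (.l 1740)) (.l 0) (.l 2013))) (.l 0) (.n (.n (.l
  2127) (.n (.l 996) (.l 1740) (.l 1751)) (.l 2127)) (.n (.l 0) (.l 1973) (.n (.l 1740) (.l 985)
  (.l 1740))) (.l 2318))) (.n (.l 2617) (.n (.l 2579) (.n (.n (.l 2018) (.l 2402) (.l 2402)) (.l 0) (.l 2531)) (.l 2579)) (.l 2617))) (.l 2747)) (.n (.n (.n (.n (.l 1936) (.n (.n (.l 1421)
  (.l 1063) (.l 1421)) (.n (.l 1593) (.l 0) (.l 971)) (.l 1700)) (.l 1936)) (.n (.n (.n (.l 622)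
  (.l 30) (.l 622)) (.l 0) (.l 902)) (.l 1664) (.n (.l 1586) (.n (.l 1307) (.l 953) (.l 1307))
  (.l 1586))) (.l 2050)) (.n (.l 0) (.l 1949) (.n (.n (.l 1575) (.n (.l 1296) (.l 942) (.l
  1296)) (.l 1575)) (.n (.n (.l 611) (.l 30) (.l 611)) (.l 0) (.l 891)) (.l 1672))) (.n (.l
  2283) (.n (.l 2196) (.n (.n (.l 985) (.l 1716) (.l 1727)) (.l 0) (.l 2096)) (.l 2196)) (.l
  2283))) (.n (.l 0) (.l 0) (.n (.n (.n (.l 1575) (.n (.l 1296) (.l 942) (.l 1296)) (.l 1575))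
  (.n (.n (.l 611) (.l 30) (.l 611)) (.l 0) (.l 891)) (.l 1674)) (.l 0) (.n (.l 1985) (.n (.l
  1870) (.n (.l 981) (.l 0) (.l 1733)) (.l 1870)) (.l 0)))) (.n (.n (.l 2572) (.n (.l 2534) (.n
  (.n (.l 2004) (.l 0) (.l 2358)) (.l 0) (.l 2486)) (.l 2534)) (.l 2572)) (.n (.n (.l 2315) (.n
  (.n (.l 992) (.l 1733) (.l 1744)) (.l 2131) (.l 2135)) (.l 2315)) (.n (.n (.l 0) (.l 1957) (.n
  (.l 1733) (.l 981) (.l 1733))) (.l 0) (.n (.l 2206) (.n (.l 992) (.l 1733) (.l 1744)) (.l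
  2206))) (.l 2429)) (.l 2585))) (.n (.l 2810) (.n (.l 2791) (.n (.n (.n (.l 2585) (.n (.l 2048)
  (.l 2451) (.l 2451)) (.l 2585)) (.n (.l 2648) (.l 0) (.n (.l 2419) (.l 2048) (.l 2419))) (.l
  2686)) (.l 0) (.l 2771)) (.l 2791)) (.n (.n (.n (.l 2763) (.l 2763) (.n (.n (.l 1827) (.l
  2583) (.l 0)) (.l 2715) (.l 0))) (.l 2801) (.l 0)) (.l 2808) (.l 0)))) (.n (.n (.n (.n (.n (.l
  1465) (.n (.l 1362) (.n (.l 896) (.l 0) (.l 1233)) (.l 1362)) (.l 1465)) (.n (.n (.l 957) (.n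
  (.l 30) (.l 606) (.l 617)) (.l 957)) (.n (.l 0) (.l 0) (.n (.l 844) (.l 30) (.l 844))) (.l
  1163)) (.l 1502)) (.n (.n (.n (.l 478) (.n (.l 230) (.l 30) (.l 230)) (.l 478)) (.l 30) (.l
  581)) (.l 0) (.n (.l 869) (.n (.l 734) (.n (.l 30) (.l 0) (.l 599)) (.l 734)) (.l 869))) (.n
  (.l 1649) (.n (.l 1601) (.n (.n (.l 1274) (.l 924) (.l 1274)) (.l 0) (.l 1550)) (.l 1601)) (.l
  1649))) (.l 0) (.n (.n (.l 1942) (.n (.l 1904) (.n (.n (.l 974) (.l 0) (.l 1717)) (.l 0) (.l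
  1855)) (.l 1904)) (.l 1942)) (.n (.n (.l 1728) (.n (.n (.l 1313) (.l 956) (.l 1313)) (.l 1587)
  (.l 1591)) (.l 1728)) (.n (.n (.n (.l 611) (.l 30) (.l 611)) (.l 0) (.l 888)) (.l 0) (.n (.l
  1657) (.n (.l 1291) (.l 938) (.l 1291)) (.l 1657))) (.l 1804)) (.l 1956))) (.l 0) (.n (.n (.n
  (.l 2571) (.n (.l 2533) (.n (.n (.l 2004) (.l 0) (.l 2357)) (.l 0) (.l 2485)) (.l 2533)) (.l
  2571)) (.n (.n (.l 2312) (.n (.n (.l 993) (.l 1734) (.l 1745)) (.l 2128) (.l 2132)) (.l 2312))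
  (.n (.n (.l 0) (.l 0) (.n (.l 1958) (.l 982) (.l 1958))) (.l 0) (.n (.l 2205) (.n (.l 993) (.l
  1734) (.l 1745)) (.l 2205))) (.l 2426)) (.l 2584)) (.n (.n (.n (.l 1931) (.n (.n (.l 1416) (.l
  1058) (.l 1416)) (.n (.l 1592) (.l 0) (.l 971)) (.l 1695)) (.l 1931)) (.n (.n (.n (.l 623) (.l
  30) (.l 623)) (.l 0) (.l 902)) (.l 1663) (.n (.l 1585) (.n (.l 1306) (.l 952) (.l 1306)) (.l
  1585))) (.l 2045)) (.n (.l 0) (.l 0) (.n (.n (.l 1606) (.n (.l 1327) (.l 973) (.l 1327)) (.l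
  1606)) (.n (.n (.l 612) (.l 30) (.l 612)) (.l 0) (.l 891)) (.l 1714))) (.n (.l 2279) (.n (.l
  2191) (.n (.n (.l 985) (.l 1715) (.l 1726)) (.l 0) (.l 2091)) (.l 2191)) (.l 2279))) (.n (.l
  2653) (.n (.l 2637) (.n (.n (.l 2516) (.n (.l 2019) (.l 0) (.l 2383)) (.l 2516)) (.l 0) (.l
  2618)) (.l 2637)) (.l 0)))) (.n (.n (.l 2901) (.n (.l 2890) (.n (.n (.n (.n (.l 2437) (.l
  2059) (.l 2437)) (.l 2706) (.l 2710)) (.l 0) (.l 2841)) (.l 0) (.l 2877)) (.l 2890)) (.n (.n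
  (.l 2880) (.l 2880) (.n (.n (.n (.l 1929) (.l 2684) (.l 0)) (.l 2814) (.l 0)) (.l 2862) (.l
  2862))) (.l 2894) (.n (.l 0) (.n (.l 2893) (.l 2893) (.n (.n (.l 1929) (.l 2684) (.l 0)) (.l
  2814) (.l 0))) (.l 0)))) (.n (.n (.l 2834) (.n (.n (.n (.l 2601) (.n (.l 2056) (.l 2466) (.l
  2466)) (.l 2601)) (.n (.l 2664) (.l 2668) (.n (.l 2433) (.l 2056) (.l 2433))) (.l 2703)) (.n
  (.l 0) (.l 0) (.n (.n (.l 2501) (.l 2056) (.l 2501)) (.l 2718) (.l 2791))) (.l 2792)) (.l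
  2834)) (.n (.n (.n (.n (.l 2122) (.n (.l 987) (.l 1733) (.l 1744)) (.l 2122)) (.n (.l 0) (.l
  1973) (.n (.l 1733) (.l 976) (.l 1733))) (.l 2325)) (.n (.l 0) (.l 0) (.n (.n (.l 1733) (.l
  976) (.l 1733)) (.l 0) (.l 2025))) (.n (.l 2628) (.n (.l 2526) (.n (.l 2025) (.l 0) (.l 2393))
  (.l 2526)) (.l 2628))) (.l 0) (.n (.l 2803) (.n (.n (.l 2591) (.n (.l 2049) (.l 2456) (.l
  2456)) (.l 2591)) (.n (.l 2655) (.l 0) (.n (.l 2423) (.l 2049) (.l 2423))) (.l 2693)) (.l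
  2803))) (.l 2860)) (.n (.n (.n (.l 2792) (.l 2792) (.n (.n (.n (.l 2306) (.l 2306) (.l 1926))
  (.l 2584) (.n (.l 0) (.l 1926) (.l 2580))) (.l 2726) (.n (.l 0) (.n (.l 1926) (.l 2724) (.l 0)) (.l 0)))) (.l 2833) (.n (.n (.n (.n (.l 1579) (.l 1579) (.l 846)) (.l 1856) (.l 0)) (.n
  (.l 2638) (.l 2638) (.n (.l 2278) (.l 2278) (.l 1903))) (.l 0)) (.n (.l 2746) (.l 2746) (.n
  (.n (.l 2300) (.l 2300) (.l 1920)) (.l 2578) (.l 2574))) (.l 0))) (.n (.l 2895) (.l 2895) (.n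
  (.l 2877) (.l 2877) (.n (.n (.n (.l 1932) (.l 2684) (.l 0)) (.l 2812) (.l 0)) (.l 2859) (.l 0)))) (.l 0))))) (.n (.n (.n (.n (.n (.l 2568) (.n (.l 2554) (.n (.n (.n (.l 2031) (.l 0) (.l
  2369)) (.l 0) (.l 2491)) (.l 0) (.l 2537)) (.l 2554)) (.l 2568)) (.n (.n (.l 2443) (.n (.n (.n
  (.l 1037) (.l 1777) (.l 1788)) (.n (.l 0) (.l 2169) (.l 1929)) (.l 2173)) (.n (.l 0) (.l 0)
  (.n (.l 1982) (.l 0) (.l 2359))) (.l 2360)) (.l 2443)) (.n (.n (.n (.l 0) (.l 0) (.n (.l 1990)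
  (.l 1026) (.l 1990))) (.l 0) (.n (.l 2233) (.n (.l 1037) (.l 1777) (.l 1788)) (.l 2233))) (.l 0) (.n (.l 2376) (.n (.n (.l 1037) (.l 1777) (.l 1788)) (.l 2163) (.l 2167)) (.l 2376))) (.l
  2499)) (.l 2573)) (.n (.n (.n (.l 2193) (.n (.n (.n (.l 1520) (.l 1149) (.l 1520)) (.n (.l
  1658) (.l 1689) (.l 1048)) (.l 1799)) (.n (.l 2008) (.l 0) (.n (.l 1027) (.l 1715) (.l 1727)))
  (.l 2043)) (.l 2193)) (.n (.n (.n (.n (.l 673) (.l 30) (.l 673)) (.l 0) (.l 952)) (.l 1715)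
  (.n (.l 1643) (.n (.l 1364) (.l 1001) (.l 1364)) (.l 1643))) (.n (.l 0) (.l 0) (.n (.l 0) (.l 0) (.n (.l 1860) (.l 1010) (.l 0)))) (.n (.l 1995) (.n (.n (.l 1481) (.l 1114) (.l 1481)) (.n
  (.l 1651) (.l 0) (.l 1021)) (.l 1759)) (.l 1995))) (.l 2277)) (.n (.n (.l 0) (.l 0) (.n (.n
  (.l 1661) (.n (.l 1383) (.l 1019) (.l 1383)) (.l 1661)) (.n (.n (.l 662) (.l 30) (.l 662)) (.l 0) (.l 941)) (.l 1762))) (.l 0) (.n (.n (.l 1989) (.n (.n (.l 1475) (.l 1108) (.l 1475)) (.n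
  (.l 1650) (.l 0) (.l 1019)) (.l 1754)) (.l 1989)) (.n (.n (.n (.l 673) (.l 30) (.l 673)) (.l 0) (.l 952)) (.l 1718) (.n (.l 1643) (.n (.l 1364) (.l 1001) (.l 1364)) (.l 1643))) (.l
  2099))) (.n (.l 2422) (.n (.l 2376) (.n (.n (.n (.l 1032) (.l 1765) (.l 1776)) (.l 2143) (.l
  2147)) (.l 0) (.l 2322)) (.l 2376)) (.l 2422))) (.n (.l 2605) (.n (.l 2598) (.n (.n (.l 2554)
  (.n (.n (.l 2037) (.l 0) (.l 2381)) (.l 0) (.l 2506)) (.l 2554)) (.l 0) (.l 2591)) (.l 2598))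
  (.n (.n (.n (.n (.l 2478) (.l 2478) (.n (.l 1581) (.l 2339) (.l 0))) (.l 2578) (.l 0)) (.l
  2596) (.l 0)) (.l 2602) (.l 0)))) (.n (.n (.n (.n (.l 1865) (.n (.n (.l 1639) (.n (.l 1115)
  (.l 1507) (.l 1507)) (.l 1639)) (.n (.n (.l 1566) (.l 0) (.l 990)) (.l 0) (.n (.l 1430) (.l
  1072) (.l 1430))) (.l 1742)) (.l 1865)) (.n (.n (.n (.l 1077) (.n (.l 60) (.l 709) (.l 720))
  (.l 1077)) (.n (.l 0) (.l 911) (.n (.l 671) (.l 30) (.l 671))) (.l 1283)) (.n (.l 1567) (.l 0)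
  (.n (.n (.l 671) (.l 30) (.l 671)) (.l 0) (.l 931))) (.n (.l 1626) (.n (.l 1523) (.n (.l 1041)
  (.l 0) (.l 1392)) (.l 1523)) (.l 1626))) (.l 1921)) (.n (.n (.n (.n (.l 541) (.n (.l 279) (.l
  30) (.l 279)) (.l 541)) (.l 30) (.l 644)) (.l 0) (.n (.l 932) (.n (.l 799) (.n (.l 30) (.l 0)
  (.l 662)) (.l 799)) (.l 932))) (.l 1692) (.n (.n (.l 1541) (.n (.l 1438) (.n (.l 960) (.l 0)
  (.l 1308)) (.l 1438)) (.l 1541)) (.n (.n (.l 1032) (.n (.l 30) (.l 668) (.l 679)) (.l 1032))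
  (.n (.l 0) (.l 0) (.n (.l 908) (.l 30) (.l 908))) (.l 1238)) (.l 1577))) (.n (.l 2067) (.n (.l
  2017) (.n (.n (.n (.l 1456) (.l 1093) (.l 1456)) (.n (.l 1627) (.l 0) (.l 1005)) (.l 1730))
  (.l 0) (.l 1961)) (.l 2017)) (.l 2067))) (.n (.l 0) (.l 0) (.n (.n (.n (.l 1538) (.n (.l 1435)
  (.n (.l 957) (.l 0) (.l 1304)) (.l 1435)) (.l 1538)) (.n (.n (.l 1025) (.n (.l 30) (.l 662)
  (.l 673)) (.l 1025)) (.n (.l 0) (.l 0) (.n (.l 902) (.l 30) (.l 902))) (.l 1232)) (.l 1574))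
  (.n (.n (.n (.l 530) (.n (.l 268) (.l 30) (.l 268)) (.l 530)) (.l 30) (.l 633)) (.l 0) (.n (.l
  924) (.n (.l 788) (.n (.l 30) (.l 0) (.l 651)) (.l 788)) (.l 924))) (.n (.l 1718) (.n (.l
  1676) (.n (.n (.l 1348) (.l 986) (.l 1348)) (.l 0) (.l 1625)) (.l 1676)) (.l 0)))) (.n (.n (.l
  2283) (.n (.l 2255) (.n (.n (.n (.l 1027) (.l 1755) (.l 1766)) (.l 0) (.l 2122)) (.l 0) (.l
  2220)) (.l 2255)) (.l 2283)) (.n (.n (.l 2111) (.n (.n (.n (.l 1478) (.l 1112) (.l 1478)) (.n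
  (.l 1649) (.l 1661) (.l 1022)) (.l 1755)) (.n (.l 0) (.l 0) (.n (.l 1206) (.l 1796) (.l
  1992))) (.l 1995)) (.l 2111)) (.n (.n (.n (.n (.l 673) (.l 30) (.l 673)) (.l 0) (.l 950)) (.l
  1708) (.n (.l 1636) (.n (.l 1359) (.l 998) (.l 1359)) (.l 1636))) (.l 0) (.n (.l 2046) (.n (.n
  (.l 1470) (.l 1104) (.l 1470)) (.n (.l 1643) (.l 0) (.l 1015)) (.l 1747)) (.l 2046))) (.l
  2181)) (.l 2294))) (.n (.n (.l 2671) (.n (.l 2665) (.n (.n (.n (.l 2539) (.n (.l 2049) (.l 0)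
  (.l 2407)) (.l 2539)) (.l 0) (.l 2640)) (.l 0) (.l 2659)) (.l 2665)) (.n (.n (.n (.l 2604) (.l
  2604) (.n (.n (.l 1658) (.l 2417) (.l 0)) (.l 2555) (.l 2555))) (.l 2642) (.n (.l 0) (.n (.l
  2555) (.l 2555) (.n (.l 1658) (.l 2417) (.l 0))) (.l 2642))) (.l 2662) (.n (.l 0) (.n (.n (.l
  2555) (.l 2555) (.n (.l 1658) (.l 2417) (.l 0))) (.l 2661) (.l 0)) (.l 0)))) (.n (.n (.l 2636)
  (.n (.n (.l 2579) (.n (.n (.l 2048) (.l 0) (.l 2401)) (.l 2531) (.l 2531)) (.l 2579)) (.n (.l 0) (.l 0) (.n (.l 2617) (.n (.l 2048) (.l 0) (.l 2401)) (.l 2617))) (.l 2617)) (.l 2636)) (.n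
  (.n (.n (.l 2347) (.n (.n (.l 1030) (.l 1774) (.l 1785)) (.l 2164) (.l 2168)) (.l 2347)) (.n
  (.n (.l 0) (.l 0) (.n (.l 1995) (.l 1018) (.l 1995))) (.l 0) (.n (.l 2240) (.n (.l 1030) (.l
  1774) (.l 1785)) (.l 2240))) (.l 2459)) (.l 0) (.n (.l 2614) (.n (.l 2564) (.n (.n (.l 2040)
  (.l 0) (.l 2388)) (.l 0) (.l 2516)) (.l 2564)) (.l 2614))) (.l 2646)) (.n (.n (.n (.n (.l
  2430) (.l 2430) (.n (.n (.l 2013) (.l 2013) (.l 1642)) (.l 2292) (.l 2288))) (.l 2505) (.n (.n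
  (.n (.l 1297) (.l 1297) (.l 624)) (.l 1576) (.l 0)) (.n (.l 2358) (.l 2358) (.n (.l 1990) (.l
  1990) (.l 1624))) (.l 0))) (.n (.l 2641) (.l 2641) (.n (.l 2592) (.l 2592) (.n (.n (.l 1656)
  (.l 2408) (.l 0)) (.l 2543) (.l 0)))) (.l 0)) (.n (.l 2663) (.l 2663) (.n (.n (.l 2603) (.l
  2603) (.n (.n (.l 1659) (.l 2416) (.l 0)) (.l 2553) (.l 2553))) (.l 2640) (.n (.l 0) (.n (.l
  2640) (.l 2640) (.n (.l 1659) (.l 2416) (.l 0))) (.l 0)))) (.l 0)))) (.n (.n (.n (.n (.n (.l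
  1458) (.n (.l 1420) (.n (.n (.l 918) (.l 0) (.l 1248)) (.l 0) (.l 1372)) (.l 1420)) (.l 1458))
  (.n (.n (.l 1200) (.n (.n (.l 30) (.l 651) (.l 662)) (.l 1021) (.l 1026)) (.l 1200)) (.n (.n
  (.l 0) (.l 0) (.n (.l 871) (.l 30) (.l 871))) (.l 0) (.n (.l 1097) (.n (.l 30) (.l 651) (.l
  662)) (.l 1097))) (.l 1314)) (.l 1472)) (.n (.n (.n (.l 849) (.n (.n (.l 360) (.l 85) (.l
  360)) (.n (.l 533) (.l 0) (.l 30)) (.l 622)) (.l 849)) (.n (.l 30) (.l 622) (.n (.l 544) (.n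
  (.l 282) (.l 30) (.l 282)) (.l 544))) (.l 963)) (.n (.l 0) (.l 0) (.n (.n (.l 533) (.n (.l
  271) (.l 30) (.l 271)) (.l 533)) (.l 30) (.l 641))) (.n (.l 1182) (.n (.l 1094) (.n (.n (.l
  30) (.l 642) (.l 653)) (.l 0) (.l 995)) (.l 1094)) (.l 1182))) (.n (.l 1541) (.n (.l 1523) (.n
  (.n (.l 1403) (.n (.l 933) (.l 0) (.l 1274)) (.l 1403)) (.l 0) (.l 1504)) (.l 1523)) (.l
  1541))) (.n (.n (.n (.n (.l 469) (.n (.l 369) (.n (.l 30) (.l 0) (.l 254)) (.l 369)) (.l 469))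
  (.n (.n (.l 133) (.l 30) (.l 133)) (.l 30) (.l 235)) (.l 506)) (.l 30) (.n (.l 626) (.n (.l
  577) (.n (.n (.l 268) (.l 30) (.l 268)) (.l 0) (.l 526)) (.l 577)) (.l 626))) (.l 0) (.n (.n
  (.l 866) (.n (.l 828) (.n (.n (.l 30) (.l 0) (.l 643)) (.l 0) (.l 779)) (.l 828)) (.l 866))
  (.n (.n (.l 669) (.n (.n (.l 274) (.l 30) (.l 274)) (.l 531) (.l 535)) (.l 669)) (.n (.l 30)
  (.l 0) (.n (.l 620) (.n (.l 270) (.l 30) (.l 270)) (.l 620))) (.l 745)) (.l 881))) (.n (.n (.l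
  1686) (.n (.l 1672) (.n (.n (.n (.l 1329) (.l 970) (.l 1329)) (.l 0) (.l 1603)) (.l 0) (.l
  1654)) (.l 1672)) (.l 1686)) (.n (.n (.l 1596) (.n (.n (.l 1442) (.n (.l 958) (.l 1311) (.l
  1311)) (.l 1442)) (.n (.l 0) (.l 0) (.n (.l 1543) (.l 958) (.l 1543))) (.l 1545)) (.l 1596))
  (.n (.n (.n (.l 1019) (.n (.l 30) (.l 656) (.l 667)) (.l 1019)) (.n (.l 0) (.l 0) (.n (.l 894)
  (.l 30) (.l 894))) (.l 1223)) (.l 0) (.n (.l 1556) (.n (.l 1421) (.n (.l 945) (.l 0) (.l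
  1290)) (.l 1421)) (.l 1556))) (.l 1623)) (.l 1691))) (.l 0) (.n (.n (.n (.l 1968) (.n (.l
  1954) (.n (.n (.n (.l 1020) (.l 0) (.l 1759)) (.l 0) (.l 1889)) (.l 0) (.l 1936)) (.l 1954))
  (.l 1968)) (.n (.n (.l 1867) (.n (.n (.n (.l 1381) (.l 1015) (.l 1381)) (.n (.l 0) (.l 1654)
  (.l 1015)) (.l 1658)) (.n (.l 0) (.l 0) (.n (.l 1015) (.l 0) (.l 1799))) (.l 1801)) (.l 1867))
  (.n (.n (.n (.n (.l 665) (.l 30) (.l 665)) (.l 0) (.l 942)) (.l 0) (.n (.l 1712) (.n (.l 1352)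
  (.l 990) (.l 1352)) (.l 1712))) (.l 0) (.n (.l 1821) (.n (.n (.l 1374) (.l 1008) (.l 1374))
  (.l 1647) (.l 1651)) (.l 1821))) (.l 1909)) (.l 1973)) (.n (.n (.n (.l 1692) (.n (.n (.l 1502)
  (.n (.l 980) (.l 1370) (.l 1370)) (.l 1502)) (.n (.l 1567) (.l 0) (.n (.l 1338) (.l 980) (.l
  1338))) (.l 1605)) (.l 1692)) (.n (.n (.n (.l 1030) (.n (.l 30) (.l 662) (.l 673)) (.l 1030))
  (.n (.l 0) (.l 902) (.n (.l 662) (.l 30) (.l 662))) (.l 1236)) (.n (.l 0) (.l 0) (.n (.n (.l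
  662) (.l 30) (.l 662)) (.l 0) (.l 955))) (.n (.l 1540) (.n (.l 1437) (.n (.l 956) (.l 0) (.l
  1307)) (.l 1437)) (.l 1540))) (.l 1734)) (.n (.n (.n (.n (.l 534) (.n (.l 271) (.l 30) (.l
  271)) (.l 534)) (.l 30) (.l 636)) (.l 0) (.n (.l 923) (.n (.l 790) (.n (.l 30) (.l 0) (.l
  653)) (.l 790)) (.l 923))) (.l 0) (.n (.n (.l 1555) (.n (.l 1452) (.n (.l 963) (.l 0) (.l
  1322)) (.l 1452)) (.l 1555)) (.n (.n (.l 1023) (.n (.l 30) (.l 660) (.l 671)) (.l 1023)) (.n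
  (.l 0) (.l 0) (.n (.l 899) (.l 30) (.l 899))) (.l 1229)) (.l 1595))) (.n (.l 1836) (.n (.l
  1803) (.n (.n (.n (.l 1358) (.l 995) (.l 1358)) (.l 1628) (.l 1632)) (.l 0) (.l 1766)) (.l
  1803)) (.l 1836))) (.n (.n (.l 1994) (.l 1994) (.n (.n (.n (.l 1868) (.l 1868) (.n (.l 978)
  (.l 1729) (.l 0))) (.l 1969) (.l 0)) (.l 1987) (.l 0))) (.n (.l 1993) (.n (.n (.l 1949) (.n
  (.n (.l 1021) (.l 0) (.l 1765)) (.l 0) (.l 1899)) (.l 1949)) (.l 0) (.l 1986)) (.l 1993)) (.l 0)))) (.n (.n (.n (.l 2782) (.n (.l 2777) (.n (.n (.n (.n (.l 2433) (.l 2057) (.l 2433)) (.l 0) (.l 2705)) (.l 0) (.l 2753)) (.l 0) (.l 2770)) (.l 2777)) (.n (.n (.l 2756) (.l 2756) (.n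
  (.n (.n (.l 1795) (.l 2552) (.l 0)) (.l 2685) (.l 2685)) (.l 2738) (.l 2738))) (.l 2770) (.n
  (.n (.l 0) (.n (.l 2765) (.l 2765) (.n (.l 1795) (.l 2552) (.l 0))) (.l 0)) (.n (.l 2734) (.l
  2734) (.n (.n (.l 1795) (.l 2552) (.l 0)) (.l 2685) (.l 2685))) (.l 0)))) (.n (.n (.l 2747)
  (.n (.n (.n (.l 2568) (.n (.l 2059) (.l 2433) (.l 2433)) (.l 2568)) (.n (.l 0) (.l 2668) (.n
  (.l 2433) (.l 2059) (.l 2433))) (.l 2670)) (.n (.l 0) (.l 0) (.n (.n (.l 2433) (.l 2059) (.l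
  2433)) (.l 0) (.l 2722))) (.l 2722)) (.l 2747)) (.n (.n (.n (.n (.l 2136) (.n (.l 1004) (.l
  1752) (.l 1763)) (.l 2136)) (.n (.l 0) (.l 0) (.n (.l 1990) (.l 993) (.l 1990))) (.l 2339))
  (.l 0) (.n (.l 2672) (.n (.l 2539) (.n (.l 2040) (.l 0) (.l 2405)) (.l 2539)) (.l 2672))) (.l 0) (.n (.l 2725) (.n (.n (.l 2560) (.n (.l 2054) (.l 2425) (.l 2425)) (.l 2560)) (.n (.l 0)
  (.l 0) (.n (.l 2661) (.l 2054) (.l 2661))) (.l 2662)) (.l 2725))) (.l 2762)) (.n (.n (.n (.l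
  2655) (.l 2655) (.n (.n (.n (.l 2165) (.l 2165) (.l 1789)) (.l 2445) (.n (.l 0) (.l 1789) (.l
  2440))) (.l 2588) (.n (.l 2586) (.n (.l 1789) (.l 2496) (.l 0)) (.l 0)))) (.l 2696) (.n (.n
  (.n (.n (.l 1438) (.l 1438) (.l 727)) (.l 1717) (.l 0)) (.n (.l 2499) (.l 2499) (.n (.l 2137)
  (.l 2137) (.l 1765))) (.l 0)) (.n (.l 2575) (.l 2575) (.n (.n (.l 2158) (.l 2158) (.l 1782))
  (.l 2438) (.l 2434))) (.l 2640))) (.n (.l 2755) (.l 2755) (.n (.l 2741) (.l 2741) (.n (.n (.n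
  (.l 1794) (.l 2546) (.l 0)) (.l 2675) (.l 2675)) (.l 2723) (.l 0)))) (.n (.l 0) (.n (.n (.l
  2596) (.l 2596) (.n (.n (.l 2170) (.l 2170) (.l 1794)) (.l 2450) (.l 2446))) (.l 2675) (.n (.n
  (.n (.l 1438) (.l 1438) (.l 727)) (.l 1717) (.l 0)) (.n (.l 2506) (.l 2506) (.n (.l 2137) (.l
  2137) (.l 1765))) (.l 0))) (.l 0)))) (.n (.n (.n (.l 2677) (.n (.n (.l 2607) (.n (.n (.l 2054)
  (.l 2415) (.l 2415)) (.l 2559) (.l 2559)) (.l 2607)) (.n (.n (.l 0) (.l 0) (.n (.l 2631) (.l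
  2054) (.l 2631))) (.l 0) (.n (.l 2547) (.n (.l 2054) (.l 2415) (.l 2415)) (.l 2547))) (.l
  2645)) (.l 2677)) (.n (.n (.n (.l 2347) (.n (.n (.l 1020) (.l 1767) (.l 1778)) (.n (.l 2162)
  (.l 0) (.l 1918)) (.l 2166)) (.l 2347)) (.n (.n (.l 0) (.l 0) (.n (.l 1991) (.l 1009) (.l
  1991))) (.l 2325) (.n (.l 2150) (.n (.l 1020) (.l 1767) (.l 1778)) (.l 2150))) (.l 2461)) (.n
  (.l 0) (.l 0) (.n (.n (.l 2175) (.n (.l 1020) (.l 1767) (.l 1778)) (.l 2175)) (.n (.l 0) (.l 0) (.n (.l 2011) (.l 1009) (.l 2011))) (.l 2390))) (.n (.l 2606) (.n (.l 2568) (.n (.n (.l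
  2038) (.l 2390) (.l 2390)) (.l 0) (.l 2520)) (.l 2568)) (.l 2606))) (.l 2693)) (.n (.n (.n (.n
  (.l 1965) (.n (.n (.l 1450) (.l 1086) (.l 1450)) (.n (.l 1625) (.l 0) (.l 997)) (.l 1729)) (.l
  1965)) (.n (.n (.n (.l 649) (.l 30) (.l 649)) (.l 0) (.l 929)) (.l 1696) (.n (.l 1618) (.n (.l
  1339) (.l 979) (.l 1339)) (.l 1618))) (.l 2078)) (.n (.l 0) (.l 0) (.n (.n (.l 1639) (.n (.l
  1360) (.l 1000) (.l 1360)) (.l 1639)) (.n (.n (.l 638) (.l 30) (.l 638)) (.l 0) (.l 918)) (.l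
  1746))) (.n (.l 2309) (.n (.l 2223) (.n (.n (.l 1011) (.l 1747) (.l 1758)) (.l 0) (.l 2123))
  (.l 2223)) (.l 2309))) (.l 0) (.n (.n (.l 2614) (.n (.l 2576) (.n (.n (.l 2040) (.l 0) (.l
  2395)) (.l 0) (.l 2528)) (.l 2576)) (.l 2614)) (.n (.n (.l 2339) (.n (.n (.l 1018) (.l 1762)
  (.l 1773)) (.l 2155) (.l 2159)) (.l 2339)) (.n (.n (.l 0) (.l 0) (.n (.l 1985) (.l 1007) (.l
  1985))) (.l 0) (.n (.l 2232) (.n (.l 1018) (.l 1762) (.l 1773)) (.l 2232))) (.l 2453)) (.l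
  2628))) (.n (.l 2735) (.n (.l 2724) (.n (.n (.n (.l 2560) (.n (.l 2059) (.l 2426) (.l 2426))
  (.l 2560)) (.n (.l 0) (.l 0) (.n (.l 2659) (.l 2059) (.l 2659))) (.l 2660)) (.l 0) (.l 2710))
  (.l 2724)) (.n (.n (.n (.l 2675) (.l 2675) (.n (.n (.l 1731) (.l 2490) (.l 0)) (.l 2626) (.l
  2626))) (.l 2712) (.n (.l 0) (.n (.l 2712) (.l 2712) (.n (.l 1731) (.l 2490) (.l 0))) (.l 0)))
  (.l 2730) (.l 0)))) (.n (.n (.n (.n (.l 2489) (.l 2489) (.n (.n (.l 2299) (.l 2299) (.n (.l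
  1764) (.l 2165) (.l 2165))) (.l 2402) (.n (.l 2364) (.n (.l 2132) (.l 2132) (.l 1764)) (.l 0)))) (.l 2531) (.n (.n (.n (.l 1825) (.l 1825) (.n (.l 746) (.l 1456) (.l 1445))) (.l 2031)
  (.n (.l 0) (.n (.l 1445) (.l 1445) (.l 735)) (.l 1686))) (.n (.l 2337) (.l 2337) (.n (.l 2234)
  (.l 2234) (.n (.l 1740) (.l 2101) (.l 0)))) (.n (.l 0) (.n (.n (.l 1445) (.l 1445) (.l 735))
  (.l 1740) (.l 0)) (.l 0)))) (.n (.l 2631) (.l 2631) (.n (.l 2599) (.l 2599) (.n (.n (.n (.l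
  2152) (.l 2152) (.l 1780)) (.l 2428) (.l 2424)) (.l 2562) (.l 0)))) (.n (.n (.n (.n (.l 1271)
  (.l 1271) (.n (.l 1000) (.l 1000) (.l 689))) (.l 1373) (.n (.n (.l 361) (.l 361) (.l 30)) (.l
  637) (.l 0))) (.n (.l 1699) (.l 1699) (.n (.l 1566) (.l 1566) (.n (.l 726) (.l 1427) (.l 0))))
  (.l 0)) (.n (.n (.l 2349) (.l 2349) (.n (.l 2246) (.l 2246) (.n (.l 1745) (.l 2114) (.l 0))))
  (.l 2389) (.n (.n (.l 1816) (.l 1816) (.n (.l 744) (.l 1452) (.l 1441))) (.l 2022) (.n (.l 0)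
  (.n (.l 1682) (.l 1682) (.l 733)) (.l 0)))) (.l 0))) (.n (.n (.l 2766) (.l 2766) (.n (.l 2752)
  (.l 2752) (.n (.n (.n (.l 1802) (.l 2555) (.l 0)) (.l 2685) (.l 0)) (.l 2734) (.l 0)))) (.n
  (.n (.l 2755) (.n (.n (.n (.l 2413) (.l 2037) (.l 2413)) (.l 0) (.l 2687)) (.l 0) (.l 2737))
  (.l 2755)) (.l 0) (.l 2769)) (.n (.n (.l 2658) (.l 2658) (.n (.n (.n (.l 2171) (.l 2171) (.l
  1796)) (.l 2449) (.n (.l 0) (.l 1796) (.l 2445))) (.l 2592) (.n (.l 0) (.n (.l 1796) (.l 2590)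
  (.l 0)) (.l 0)))) (.l 2700) (.n (.n (.n (.n (.l 1447) (.l 1447) (.l 735)) (.l 1724) (.l 0))
  (.n (.l 2504) (.l 2504) (.n (.l 2143) (.l 2143) (.l 1772))) (.l 0)) (.n (.l 2612) (.l 2612)
  (.n (.n (.l 2164) (.l 2164) (.l 1789)) (.l 2443) (.l 2439))) (.l 0)))) (.l 0))))

theorem sawTree_chk : chk sawTree sawTree [] = true := by decide +kernel

theorem memb_iff (x : ℤ × ℤ) (l : List (ℤ × ℤ)) : memb x l = true ↔ x ∈ l := by
  induction l with
  | nil => simp [memb]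
  | cons y l ih => simp [memb, ih, Prod.ext_iff]

theorem dup_iff (l : List (ℤ × ℤ)) : dup l = true ↔ ¬ l.Nodup := by
  induction l with
  | nil => simp [dup]
  | cons y l ih =>
    rw [dup, Bool.or_eq_true, memb_iff, ih, List.nodup_cons]; tauto

theorem bk_map (T : List Turn) (p d : ℤ × ℤ) :
    bk T p d = (bk T (0, 0) (1, 0)).map
      (fun z => (p.1 + d.1 * z.1 - d.2 * z.2, p.2 + d.1 * z.2 + d.2 * z.1)) := by
  induction T generalizing p d with
  | nil => simp [bk, sub_eq_add_neg]
  | cons t T ih =>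
    rw [bk, bk, ih, ih (_, _) (un t (1, 0)), List.map_cons, List.map_map]
    simp only [mul_zero, add_zero, sub_zero]
    congr 1
    apply List.map_congr_left
    intro z _
    cases t <;> simp [un] <;> constructor <;> ring

def Val (T : List Turn) : Prop := (bk T (0, 0) (1, 0)).Nodup

theorem Val.of_bk {T : List Turn} {p d : ℤ × ℤ} (h : (bk T p d).Nodup) : Val T := by
  rw [bk_map] at h
  exact List.Nodup.of_map _ h

theorem Val.tail {t : Turn} {T : List Turn} (h : Val (t :: T)) : Val T := by
  unfold Val at h
  rw [bk, List.nodup_cons] at h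
  exact Val.of_bk h.2

theorem bk_prefix (q T : List Turn) (p d : ℤ × ℤ) : bk q p d <+: bk (q ++ T) p d := by
  induction q generalizing p d with
  | nil =>
    cases T with
    | nil => exact List.prefix_rfl
    | cons t T =>
      cases T <;> simp [bk]
  | cons t q ih =>
    simp only [List.cons_append, bk]
    exact (List.prefix_cons_inj _).2 (ih _ _)

theorem desc_append (tr : Tr) (p T : List Turn) : tr.desc (p ++ T) = (tr.desc p).desc T := by
  induction tr generalizing p with
  | l v => simp [Tr.desc]
  | n a b c iha ihb ihc =>
    cases p with
    | nil => simp [Tr.desc]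
    | cons t p => cases t <;> simp [Tr.desc, iha, ihb, ihc]

theorem mx_desc (tr : Tr) (T : List Turn) : (tr.desc T).mx ≤ tr.mx := by
  induction tr generalizing T with
  | l v => simp [Tr.desc]
  | n a b c iha ihb ihc =>
    cases T with
    | nil => simp [Tr.desc]
    | cons t p =>
      have := iha p
      have := ihb p
      have := ihc p
      cases t <;> simp [Tr.desc, Tr.mx] <;> omega

def Tr.depth : Tr → ℕ
  | .l _ => 0
  | .n a b c => max a.depth (max b.depth c.depth) + 1

def vterm (root : Tr) (T : List Turn) : ℕ := if Val T then (root.desc T).mx else 0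

theorem vterm_le (root : Tr) (t : Turn) (q T : List Turn) :
    vterm root (t :: (q ++ T)) ≤ term root t q := by
  unfold vterm term
  split_ifs with h1 h2
  · exfalso
    rw [memb_iff] at h2
    unfold Val at h1
    rw [bk, List.nodup_cons] at h1
    exact h1.1 ((bk_prefix q T _ _).subset h2)
  · rw [← List.cons_append, desc_append]; exact mx_desc _ _
  · exact Nat.zero_le _
  · exact Nat.zero_le _

theorem chk_sound (root tr : Tr) (q T : List Turn) (hc : chk root tr q = true)
    (hd : tr.depth ≤ T.length) (hv : Val (q ++ T)) :
    1 ≤ (tr.desc T).mx ∧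
    1000 * (vterm root (.S :: (q ++ T)) + (vterm root (.L :: (q ++ T)) + vterm root (.R :: (q ++ T))))
      ≤ 2718 * (tr.desc T).mx := by
  induction tr generalizing q T with
  | l v =>
    cases v with
    | zero =>
      exfalso
      rw [chk, dup_iff] at hc
      exact hc (List.Nodup.sublist (bk_prefix q T _ _).sublist hv)
    | succ v =>
      rw [chk] at hc
      have := Nat.le_of_ble_eq_true hc
      have h1 := vterm_le root .S q T
      have h2 := vterm_le root .L q T
      have h3 := vterm_le root .R q T
      simp only [Tr.desc, Tr.mx]
      omega
  | n a b c iha ihb ihc =>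
    rw [chk, Bool.and_eq_true, Bool.and_eq_true] at hc
    simp only [Tr.depth] at hd
    cases T with
    | nil => simp at hd
    | cons t T =>
      simp only [List.length_cons] at hd
      have e : q ++ t :: T = (q ++ [t]) ++ T := by simp
      rw [e] at hv ⊢
      cases t
      · exact iha _ _ hc.1 (by omega) hv
      · exact ihb _ _ hc.2.1 (by omega) hv
      · exact ihc _ _ hc.2.2 (by omega) hv

theorem sawTree_depth : sawTree.depth ≤ 10 := by decide +kernel

theorem saw_step (T : List Turn) (h : 10 ≤ T.length) (hv : Val T) :
    1 ≤ (sawTree.desc T).mx ∧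
    1000 * (vterm sawTree (.S :: T) + (vterm sawTree (.L :: T) + vterm sawTree (.R :: T)))
      ≤ 2718 * (sawTree.desc T).mx :=
  chk_sound sawTree sawTree [] T sawTree_chk (sawTree_depth.trans h) hv

/-- valid turn words of length n -/
def Wd : ℕ → Finset (List Turn)
  | 0 => {[]}
  | n + 1 => ((Wd n).image (List.cons .S) ∪ ((Wd n).image (List.cons .L) ∪
      (Wd n).image (List.cons .R))).filter Val

theorem mem_Wd (T : List Turn) (h : Val T) : T ∈ Wd T.length := by
  induction T with
  | nil => simp [Wd]
  | cons t T ih =>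
    simp only [List.length_cons, Wd, Finset.mem_filter, Finset.mem_union, Finset.mem_image]
    refine ⟨?_, h⟩
    have := ih h.tail
    cases t
    · exact Or.inl ⟨T, this, rfl⟩
    · exact Or.inr (Or.inl ⟨T, this, rfl⟩)
    · exact Or.inr (Or.inr ⟨T, this, rfl⟩)

theorem Wd_len (n : ℕ) (T : List Turn) (h : T ∈ Wd n) : T.length = n ∧ Val T := by
  induction n generalizing T with
  | zero => simp [Wd] at h; subst h; simp [Val, bk]
  | succ n ih =>
    simp only [Wd, Finset.mem_filter, Finset.mem_union, Finset.mem_image] at h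
    refine ⟨?_, h.2⟩
    rcases h.1 with ⟨a, ha, rfl⟩ | ⟨a, ha, rfl⟩ | ⟨a, ha, rfl⟩ <;> simp [(ih a ha).1]

def Phi (n : ℕ) : ℕ := ∑ T ∈ Wd n, (sawTree.desc T).mx

theorem sum_union_le' (s t : Finset (List Turn)) (f : List Turn → ℕ) :
    ∑ x ∈ s ∪ t, f x ≤ ∑ x ∈ s, f x + ∑ x ∈ t, f x := by
  rw [← Finset.sum_union_inter]; omega

theorem Phi_step (n : ℕ) (hn : 10 ≤ n) : 1000 * Phi (n + 1) ≤ 2718 * Phi n := by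
  have key : ∀ t : Turn, ∑ T ∈ (Wd n).image (List.cons t), vterm sawTree T
      = ∑ T ∈ Wd n, vterm sawTree (t :: T) := by
    intro t
    rw [Finset.sum_image]
    intro a _ b _ h
    exact (List.cons.inj h).2
  have h1 : Phi (n + 1) ≤ ∑ T ∈ Wd n, (vterm sawTree (.S :: T) + (vterm sawTree (.L :: T)
      + vterm sawTree (.R :: T))) := by
    rw [Finset.sum_add_distrib, Finset.sum_add_distrib, ← key, ← key, ← key]
    unfold Phi
    rw [Wd, Finset.sum_filter]
    refine le_trans (sum_union_le' _ _ _) ?_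
    refine Nat.add_le_add_left (sum_union_le' _ _ _) _
  have h2 : ∑ T ∈ Wd n, 1000 * (vterm sawTree (.S :: T) + (vterm sawTree (.L :: T)
      + vterm sawTree (.R :: T))) ≤ ∑ T ∈ Wd n, 2718 * (sawTree.desc T).mx := by
    apply Finset.sum_le_sum
    intro T hT
    obtain ⟨h3, h4⟩ := Wd_len n T hT
    exact (saw_step T (by omega) h4).2
  rw [← Finset.mul_sum, ← Finset.mul_sum] at h2
  unfold Phi at h1 ⊢
  omega

theorem saw_bound : ∃ C : ℝ, 0 < C ∧ ∀ n, ((Wd n).card : ℝ) ≤ C * (2.718 : ℝ) ^ n := by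
  have hP : ∀ m : ℕ, (Phi (10 + m) : ℝ) ≤ Phi 10 * (2.718 : ℝ) ^ m := by
    intro m
    induction m with
    | zero => simp
    | succ m ih =>
      have := Phi_step (10 + m) (by omega)
      have h : (1000 : ℝ) * Phi (10 + (m + 1)) ≤ 2718 * Phi (10 + m) := by exact_mod_cast this
      rw [pow_succ]
      nlinarith
  have hc : ∀ n, 10 ≤ n → (Wd n).card ≤ Phi n := by
    intro n hn
    rw [Finset.card_eq_sum_ones]
    apply Finset.sum_le_sum
    intro T hT
    obtain ⟨h3, h4⟩ := Wd_len n T hT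
    exact (saw_step T (by omega) h4).1
  refine ⟨Phi 10 + ∑ m ∈ Finset.range 10, ((Wd m).card : ℝ) + 1, by positivity, ?_⟩
  intro n
  have hs : (0 : ℝ) ≤ ∑ m ∈ Finset.range 10, ((Wd m).card : ℝ) := by positivity
  have hp : (1 : ℝ) ≤ 2.718 ^ n := one_le_pow₀ (by norm_num)
  have h0 : (0 : ℝ) ≤ Phi 10 := by positivity
  by_cases hn : n < 10
  · have : ((Wd n).card : ℝ) ≤ ∑ m ∈ Finset.range 10, ((Wd m).card : ℝ) :=
      Finset.single_le_sum (f := fun m => ((Wd m).card : ℝ)) (fun _ _ => by positivity)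
        (Finset.mem_range.2 hn)
    nlinarith
  · obtain ⟨m, rfl⟩ := Nat.exists_eq_add_of_le (not_lt.1 hn)
    have h1 : ((Wd (10 + m)).card : ℝ) ≤ Phi (10 + m) := by exact_mod_cast hc _ (by omega)
    have h2 := hP m
    have h3 : (2.718 : ℝ) ^ m ≤ 2.718 ^ (10 + m) := pow_le_pow_right₀ (by norm_num) (by omega)
    have h4 : (Phi 10 : ℝ) * 2.718 ^ m ≤ Phi 10 * 2.718 ^ (10 + m) :=
      mul_le_mul_of_nonneg_left h3 h0
    nlinarith

def dl : Bool → ℤ × ℤ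
  | true => (1, 0)
  | false => (0, 1)

def EB (L : ℕ) : Finset (Site × Bool) :=
  Finset.Icc ((0 : ℤ), (0 : ℤ)) ((L : ℤ), (L : ℤ)) ×ˢ Finset.univ

def BdE (F : Finset Site) (e : Site × Bool) : Prop := ¬ (e.1 ∈ F ↔ e.1 + dl e.2 ∈ F)

def bd (L : ℕ) (F : Finset Site) : Finset (Site × Bool) := (EB L).filter (BdE F)

theorem mem_box (L : ℕ) (x : Site) : x ∈ box L ↔ 1 ≤ x.1 ∧ x.1 ≤ L ∧ 1 ≤ x.2 ∧ x.2 ≤ L := by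
  unfold box
  rw [Finset.mem_Icc, Prod.le_def, Prod.le_def]
  tauto

theorem mem_EB (L : ℕ) (e : Site × Bool) :
    e ∈ EB L ↔ 0 ≤ e.1.1 ∧ e.1.1 ≤ L ∧ 0 ≤ e.1.2 ∧ e.1.2 ≤ L := by
  unfold EB
  rw [Finset.mem_product, Finset.mem_Icc, Prod.le_def, Prod.le_def]
  simp
  tauto

theorem mem_bd {L : ℕ} {F : Finset Site} (hF : F ⊆ box L) (e : Site × Bool) :
    e ∈ bd L F ↔ BdE F e := by
  unfold bd
  rw [Finset.mem_filter, mem_EB]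
  refine ⟨fun h => h.2, fun h => ⟨?_, h⟩⟩
  obtain ⟨⟨a, b⟩, c⟩ := e
  unfold BdE at h
  have h1 : (a, b) ∈ F ∨ (a, b) + dl c ∈ F := by tauto
  rcases h1 with h1 | h1
  · have := (mem_box L _).1 (hF h1)
    simp at this ⊢; omega
  · have := (mem_box L _).1 (hF h1)
    cases c <;> simp [dl] at this ⊢ <;> omega

def IsDir (d : ℤ × ℤ) : Prop := d = (1, 0) ∨ d = (-1, 0) ∨ d = (0, 1) ∨ d = (0, -1)

def lab (p q : ℤ × ℤ) : Site × Bool := ((max p.1 q.1, max p.2 q.2), decide (p.1 = q.1))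

def Unit' (p q : ℤ × ℤ) : Prop := IsDir (q - p)

theorem lab_comm (p q : ℤ × ℤ) : lab p q = lab q p := by
  simp [lab, max_comm, eq_comm]

theorem unit_iff (p q : ℤ × ℤ) : Unit' p q ↔
    (q.1 = p.1 + 1 ∧ q.2 = p.2) ∨ (q.1 = p.1 - 1 ∧ q.2 = p.2) ∨
    (q.1 = p.1 ∧ q.2 = p.2 + 1) ∨ (q.1 = p.1 ∧ q.2 = p.2 - 1) := by
  unfold Unit' IsDir
  simp only [Prod.ext_iff, Prod.fst_sub, Prod.snd_sub]
  omega

theorem lab_inj {p q p' q' : ℤ × ℤ} (h : Unit' p q) (h' : Unit' p' q') (e : lab p q = lab p' q') :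
    (p = p' ∧ q = q') ∨ (p = q' ∧ q = p') := by
  rw [unit_iff] at h h'
  simp only [lab, Prod.ext_iff, decide_eq_decide] at e ⊢
  omega

theorem rt_dir {d : ℤ × ℤ} (h : IsDir d) (t : Turn) : IsDir (rt t d) := by
  unfold IsDir at *
  rcases h with rfl | rfl | rfl | rfl <;> cases t <;> simp [rt]

theorem un_rt (t : Turn) (d : ℤ × ℤ) : un t (rt t d) = d := by
  cases t <;> simp [un, rt]

theorem rt_ne {d : ℤ × ℤ} (h : IsDir d) (t : Turn) : rt t d ≠ -d := by
  unfold IsDir at *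
  rcases h with rfl | rfl | rfl | rfl <;> cases t <;> simp [rt]

theorem even_deg (F : Finset Site) (p d : ℤ × ℤ) (hd : IsDir d)
    (h : BdE F (lab p (p - d))) : ∃ t, BdE F (lab p (p + rt t d)) := by
  by_contra hc
  push Not at hc
  have h1 := hc .S
  have h2 := hc .L
  have h3 := hc .R
  obtain ⟨i, j⟩ := p
  unfold IsDir at hd
  rcases hd with rfl | rfl | rfl | rfl <;>
  simp [BdE, lab, rt, dl, show ¬ (i = i - 1) by omega] at h h1 h2 h3 <;> tauto

/-- consecutive pairs -/
def stp : List (ℤ × ℤ) → List ((ℤ × ℤ) × (ℤ × ℤ))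
  | a :: b :: l => (a, b) :: stp (b :: l)
  | _ => []

theorem stp_mem {l : List (ℤ × ℤ)} {s : (ℤ × ℤ) × (ℤ × ℤ)} (h : s ∈ stp l) : s.1 ∈ l ∧ s.2 ∈ l := by
  induction l with
  | nil => simp [stp] at h
  | cons a l ih =>
    cases l with
    | nil => simp [stp] at h
    | cons b l =>
      rw [stp, List.mem_cons] at h
      rcases h with rfl | h
      · simp
      · have := ih h
        exact ⟨List.mem_cons_of_mem _ this.1, List.mem_cons_of_mem _ this.2⟩

theorem stp_length (a : ℤ × ℤ) (l : List (ℤ × ℤ)) : (stp (a :: l)).length = l.length := by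
  induction l generalizing a with
  | nil => simp [stp]
  | cons b l ih => rw [stp, List.length_cons, ih, List.length_cons]

def AllU (l : List (ℤ × ℤ)) : Prop := ∀ s ∈ stp l, Unit' s.1 s.2

theorem nodup_labels {l : List (ℤ × ℤ)} (hn : l.Nodup) (hu : AllU l) :
    ((stp l).map (fun s => lab s.1 s.2)).Nodup := by
  induction l with
  | nil => simp [stp]
  | cons a l ih =>
    cases l with
    | nil => simp [stp]
    | cons b l =>
      rw [stp, List.map_cons, List.nodup_cons]
      rw [List.nodup_cons] at hn
      have hu' : AllU (b :: l) := fun s hs => hu s (by rw [stp]; exact List.mem_cons_of_mem _ hs)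
      refine ⟨?_, ih hn.2 hu'⟩
      intro h
      rw [List.mem_map] at h
      obtain ⟨s, hs, e⟩ := h
      have h1 := stp_mem hs
      have h2 := lab_inj (hu' s hs) (hu (a, b) (by simp [stp])) e
      rcases h2 with ⟨h2, h3⟩ | ⟨h2, h3⟩
      · exact hn.1 (show a ∈ _ by rw [← (show s.1 = a from h2)]; exact h1.1)
      · exact hn.1 (show a ∈ _ by rw [← (show s.2 = a from h3)]; exact h1.2)

def cr (x p q : ℤ × ℤ) : ZMod 2 := if p.1 = q.1 ∧ max p.2 q.2 = x.2 ∧ x.1 ≤ p.1 then 1 else 0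

def Gp (l : List (ℤ × ℤ)) (x : Site) : ZMod 2 := ((stp l).map (fun s => cr x s.1 s.2)).sum

def Ind (e : Site × Bool) (p : ℤ × ℤ) : ZMod 2 :=
  if e.2 = false ∧ p.2 = e.1.2 ∧ e.1.1 ≤ p.1 then 1 else 0

theorem cr_edge (e : Site × Bool) (p q : ℤ × ℤ) (h : Unit' p q) :
    cr e.1 p q + cr (e.1 + dl e.2) p q = (if lab p q = e then 1 else 0) + (Ind e p + Ind e q) := by
  obtain ⟨⟨a, b⟩, c⟩ := e
  obtain ⟨i, j⟩ := p
  obtain ⟨k, l⟩ := q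
  rw [unit_iff] at h
  have h2 : (1 : ZMod 2) + 1 = 0 := by decide
  simp only at h
  rcases h with ⟨rfl, rfl⟩ | ⟨rfl, rfl⟩ | ⟨rfl, rfl⟩ | ⟨rfl, rfl⟩ <;> cases c <;>
    simp [cr, dl, lab, Ind] <;> split_ifs <;> first | rfl | omega

def lsum (l : List (ℤ × ℤ)) (f : (ℤ × ℤ) → (ℤ × ℤ) → ZMod 2) : ZMod 2 :=
  ((stp l).map (fun s => f s.1 s.2)).sum

theorem tele (I : ℤ × ℤ → ZMod 2) (a : ℤ × ℤ) (l : List (ℤ × ℤ)) :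
    lsum (a :: l) (fun p q => I p + I q) = I a + I ((a :: l).getLast (by simp)) := by
  induction l generalizing a with
  | nil => simp [lsum, stp, CharTwo.add_self_eq_zero]
  | cons b l ih =>
    have := ih b
    unfold lsum at this ⊢
    rw [stp, List.map_cons, List.sum_cons, this,
      List.getLast_cons (a := a) (l := b :: l) (by simp)]
    have := CharTwo.add_self_eq_zero (I b)
    linear_combination this

theorem G_edge (a : ℤ × ℤ) (l : List (ℤ × ℤ)) (hu : AllU (a :: l))
    (hc : (a :: l).getLast (by simp) = a) (e : Site × Bool) :
    Gp (a :: l) e.1 + Gp (a :: l) (e.1 + dl e.2) =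
      ((stp (a :: l)).map (fun s => if lab s.1 s.2 = e then (1 : ZMod 2) else 0)).sum := by
  have h1 := tele (Ind e) a l
  rw [hc, CharTwo.add_self_eq_zero] at h1
  unfold Gp
  unfold lsum at h1
  rw [← List.sum_map_add]
  refine Eq.trans ?_ (add_zero _)
  refine Eq.trans ?_ (congrArg₂ (· + ·) rfl h1)
  rw [← List.sum_map_add]
  congr 1
  apply List.map_congr_left
  intro s hs
  exact cr_edge e s.1 s.2 (hu s hs)

/-- nothing -/
theorem sum_ind_zero {ls : List ((ℤ × ℤ) × (ℤ × ℤ))} (e : Site × Bool)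
    (h : ∀ s ∈ ls, lab s.1 s.2 ≠ e) :
    (ls.map (fun s => if lab s.1 s.2 = e then (1 : ZMod 2) else 0)).sum = 0 := by
  induction ls with
  | nil => simp
  | cons a l ih =>
    rw [List.map_cons, List.sum_cons, ih (fun s hs => h s (List.mem_cons_of_mem _ hs)),
      if_neg (h a (by simp)), add_zero]

theorem Gp_far (l : List (ℤ × ℤ)) : ∃ B : ℤ, ∀ x : Site, (B ≤ x.1 ∨ B ≤ x.2) → Gp l x = 0 := by
  have : ∃ B : ℤ, ∀ p ∈ l, p.1 < B ∧ p.2 < B := by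
    induction l with
    | nil => exact ⟨0, by simp⟩
    | cons a l ih =>
      obtain ⟨B, hB⟩ := ih
      refine ⟨max B (max (a.1 + 1) (a.2 + 1)), ?_⟩
      intro p hp
      rw [List.mem_cons] at hp
      rcases hp with rfl | hp
      · omega
      · have := hB p hp; omega
  obtain ⟨B, hB⟩ := this
  refine ⟨B, fun x hx => ?_⟩
  unfold Gp
  apply List.sum_eq_zero
  intro y hy
  rw [List.mem_map] at hy
  obtain ⟨s, hs, rfl⟩ := hy
  have h1 := hB _ (stp_mem hs).1
  have h2 := hB _ (stp_mem hs).2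
  unfold cr
  rw [if_neg]
  omega

def Ecst (F : Finset Site) (G : Site → ZMod 2) : Prop :=
  ∀ e : Site × Bool, ¬ BdE F e → G e.1 = G (e.1 + dl e.2)

theorem outside_zero {L : ℕ} {F : Finset Site} (hF : F ⊆ box L) (G : Site → ZMod 2)
    (hG : Ecst F G) (B : ℤ) (hB : ∀ x : Site, (B ≤ x.1 ∨ B ≤ x.2) → G x = 0) (o : Site)
    (ho : o ∉ box L) : G o = 0 := by
  rw [mem_box] at ho
  by_cases h2 : 1 ≤ o.2 ∧ o.2 ≤ L
  · have : ∀ n : ℕ, G o = G (o.1, o.2 + n) := by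
      intro n
      induction n with
      | zero => simp
      | succ n ih =>
        rw [ih, hG ((o.1, o.2 + n), false)]
        · simp [dl, add_assoc]
        · unfold BdE
          rw [not_not]
          have h3 : ((o.1, o.2 + n) : Site) ∉ F := fun h => ho (by
            have := (mem_box _ _).1 (hF h); simp at this; omega)
          have h4 : ((o.1, o.2 + n) : Site) + dl false ∉ F := fun h => ho (by
            have := (mem_box _ _).1 (hF h); simp [dl] at this; omega)
          simp [h3, h4]
    rw [this (B - o.2).toNat]
    apply hB
    right
    simp; omega
  · have : ∀ n : ℕ, G o = G (o.1 + n, o.2) := by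
      intro n
      induction n with
      | zero => simp
      | succ n ih =>
        rw [ih, hG ((o.1 + n, o.2), true)]
        · simp [dl, add_assoc]
        · unfold BdE
          rw [not_not]
          have h3 : ((o.1 + n, o.2) : Site) ∉ F := fun h => ho (by
            have := (mem_box _ _).1 (hF h); simp at this; omega)
          have h4 : ((o.1 + n, o.2) : Site) + dl true ∉ F := fun h => ho (by
            have := (mem_box _ _).1 (hF h); simp [dl] at this; omega)
          simp [h3, h4]
    rw [this (B - o.1).toNat]
    apply hB
    left
    simp; omega

def fin' (s : ℤ × ℤ) : List Turn → (ℤ × ℤ) × (ℤ × ℤ)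
  | [] => (s, (0, 1))
  | t :: T => ((fin' s T).1 + rt t (fin' s T).2, rt t (fin' s T).2)

def Pth (s : ℤ × ℤ) (T : List Turn) : List (ℤ × ℤ) := bk T (fin' s T).1 (fin' s T).2

theorem Pth_cons (s : ℤ × ℤ) (t : Turn) (T : List Turn) :
    Pth s (t :: T) = (fin' s (t :: T)).1 :: Pth s T := by
  unfold Pth
  rw [bk, fin']
  simp only [un_rt]
  congr 2
  ext <;> simp

theorem fin'_dir (s : ℤ × ℤ) (T : List Turn) : IsDir (fin' s T).2 := by
  induction T with
  | nil => simp [fin', IsDir]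
  | cons t T ih => exact rt_dir ih t

theorem Pth_head (s : ℤ × ℤ) (T : List Turn) : ∃ l, Pth s T = (fin' s T).1 ::
    ((fin' s T).1 - (fin' s T).2) :: l := by
  cases T with
  | nil => exact ⟨[], by simp [Pth, bk, fin']; ext <;> simp⟩
  | cons t T =>
    have : ∃ l, Pth s T = (fin' s T).1 :: l := by
      cases T with
      | nil => exact ⟨_, by simp [Pth, bk, fin']; rfl⟩
      | cons t T => exact ⟨_, Pth_cons s t T⟩
    obtain ⟨l, hl⟩ := this
    refine ⟨l, ?_⟩
    rw [Pth_cons, hl]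
    simp [fin']

theorem Pth_last (s : ℤ × ℤ) (T : List Turn) : ∃ l, Pth s T = l ++ [s, s - (0, 1)] := by
  induction T with
  | nil => exact ⟨[], by simp [Pth, bk, fin']; ext <;> simp⟩
  | cons t T ih =>
    obtain ⟨l, hl⟩ := ih
    exact ⟨_ :: l, by rw [Pth_cons, hl, List.cons_append]⟩

theorem Pth_length (s : ℤ × ℤ) (T : List Turn) : (Pth s T).length = T.length + 2 := by
  induction T with
  | nil => simp [Pth, bk]
  | cons t T ih => rw [Pth_cons, List.length_cons, ih, List.length_cons]

theorem stp_Pth_cons (s : ℤ × ℤ) (t : Turn) (T : List Turn) :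
    stp (Pth s (t :: T)) = ((fin' s (t :: T)).1, (fin' s T).1) :: stp (Pth s T) := by
  rw [Pth_cons]
  obtain ⟨l, hl⟩ := Pth_head s T
  rw [hl, stp]

theorem neg_dir {d : ℤ × ℤ} (h : IsDir d) : IsDir (-d) := by
  unfold IsDir at *
  rcases h with rfl | rfl | rfl | rfl <;> simp

theorem Pth_unit (s : ℤ × ℤ) (T : List Turn) : AllU (Pth s T) := by
  induction T with
  | nil =>
    intro x hx
    simp [Pth, bk, fin', stp] at hx
    subst hx
    rw [unit_iff]; simp
  | cons t T ih =>
    intro x hx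
    rw [stp_Pth_cons, List.mem_cons] at hx
    rcases hx with rfl | hx
    · unfold Unit'
      simp only [fin']
      have := neg_dir (rt_dir (fin'_dir s T) t)
      convert this using 1
      simp
    · exact ih x hx

theorem stp_fst_mem (A : List (ℤ × ℤ)) (q : ℤ × ℤ) (s : (ℤ × ℤ) × (ℤ × ℤ))
    (h : s ∈ stp (A ++ [q])) : s.1 ∈ A := by
  induction A with
  | nil => simp [stp] at h
  | cons a A ih =>
    cases A with
    | nil => simp [stp] at h; subst h; simp
    | cons b A =>
      simp only [List.cons_append, stp, List.mem_cons] at h ih ⊢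
      rcases h with rfl | h
      · simp
      · right; exact ih h

structure Simple (F : Finset Site) (q a b : ℤ × ℤ) (A : List (ℤ × ℤ)) : Prop where
  nd : (a :: b :: A ++ [q]).Nodup
  un : AllU (q :: (a :: b :: A ++ [q]))
  bd : ∀ s ∈ stp (q :: (a :: b :: A ++ [q])), BdE F (lab s.1 s.2)

theorem Simple.first {F : Finset Site} {q a b : ℤ × ℤ} {A : List (ℤ × ℤ)} (h : Simple F q a b A) :
    ∀ s ∈ stp (a :: b :: A ++ [q]), lab s.1 s.2 ≠ lab q a := by
  intro s hs e
  have hu : Unit' s.1 s.2 := h.un s (by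
    rw [List.cons_append, stp]; exact List.mem_cons_of_mem _ hs)
  have hu2 : Unit' q a := h.un (q, a) (by rw [List.cons_append, stp]; simp)
  have h1 := stp_fst_mem (a :: b :: A) q s hs
  have hn := h.nd
  rw [List.nodup_append] at hn
  have hq : q ∉ a :: b :: A := fun hq => hn.2.2 q hq q (by simp) rfl
  rcases lab_inj hu hu2 e with ⟨h2, h3⟩ | ⟨h2, h3⟩
  · rw [h2] at h1; exact hq h1
  · simp only [List.cons_append, stp, List.mem_cons] at hs
    rcases hs with rfl | hs
    · apply hq; rw [← h3]; simp
    · have h4 := stp_fst_mem (b :: A) q s (by rw [List.cons_append]; exact hs)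
      rw [h2] at h4
      exact (List.nodup_cons.1 hn.1).1 h4

theorem Simple.labels {F : Finset Site} {q a b : ℤ × ℤ} {A : List (ℤ × ℤ)} (h : Simple F q a b A) :
    ((stp (q :: (a :: b :: A ++ [q]))).map (fun s => lab s.1 s.2)).Nodup := by
  rw [List.cons_append, stp, List.map_cons, List.nodup_cons]
  constructor
  · intro h1
    rw [List.mem_map] at h1
    obtain ⟨s, hs, e⟩ := h1
    exact h.first s hs e
  · apply nodup_labels h.nd
    intro s hs
    apply h.un
    rw [List.cons_append, stp]; exact List.mem_cons_of_mem _ hs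

theorem zmod2 (z : ZMod 2) : z = 0 ∨ z = 1 := by
  revert z; decide

theorem Simple.main {L : ℕ} {F : Finset Site} {v : Site} (hF : F ⊆ box L)
    (hcF : ∀ G : Site → ZMod 2, Ecst F G → ∀ x ∈ F, G x = G v)
    (hcE : ∀ G : Site → ZMod 2, Ecst F G → ∀ x, x ∉ F → ∃ o, o ∉ box L ∧ G x = G o)
    {q a b : ℤ × ℤ} {A : List (ℤ × ℤ)} (h : Simple F q a b A) :
    (∀ x, x ∈ F ↔ Gp (q :: (a :: b :: A ++ [q])) x = 1) ∧
    (∀ e, BdE F e → e ∈ (stp (q :: (a :: b :: A ++ [q]))).map (fun s => lab s.1 s.2)) := by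
  set C := a :: b :: A ++ [q] with hC
  have hE := G_edge q C h.un (by rw [List.getLast_cons (by simp [hC])]; simp [hC])
  have hcst : Ecst F (Gp (q :: C)) := by
    intro e he
    have := hE e
    rw [sum_ind_zero] at this
    · exact CharTwo.add_eq_zero.1 this
    · intro s hs heq
      apply he
      rw [← heq]
      exact h.bd s hs
  obtain ⟨B, hB⟩ := Gp_far (q :: C)
  have hout : ∀ x, x ∉ F → Gp (q :: C) x = 0 := by
    intro x hx
    obtain ⟨o, ho, e⟩ := hcE _ hcst x hx
    rw [e]
    exact outside_zero hF _ hcst B hB o ho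
  have hone : Gp (q :: C) (lab q a).1 + Gp (q :: C) ((lab q a).1 + dl (lab q a).2) = 1 := by
    rw [hE (lab q a), hC, List.cons_append, stp, List.map_cons, List.sum_cons, sum_ind_zero]
    · simp
    · exact h.first
  have hbd : BdE F (lab q a) := h.bd (q, a) (by rw [List.cons_append, stp]; simp)
  have hv1 : Gp (q :: C) v = 1 := by
    unfold BdE at hbd
    by_cases h1 : (lab q a).1 ∈ F
    · have h2 : (lab q a).1 + dl (lab q a).2 ∉ F := by tauto
      rw [hout _ h2, hcF _ hcst _ h1, add_zero] at hone
      exact hone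
    · have h2 : (lab q a).1 + dl (lab q a).2 ∈ F := by tauto
      rw [hout _ h1, hcF _ hcst _ h2, zero_add] at hone
      exact hone
  have hiff : ∀ x, x ∈ F ↔ Gp (q :: C) x = 1 := by
    intro x
    constructor
    · intro hx
      rw [hcF _ hcst x hx, hv1]
    · intro hx
      by_contra hn
      rw [hout x hn] at hx
      exact absurd hx (by decide)
  refine ⟨hiff, ?_⟩
  intro e he
  by_contra hn
  have h1 := hE e
  rw [sum_ind_zero] at h1
  · have h2 := CharTwo.add_eq_zero.1 h1
    apply he
    rw [hiff, hiff, h2]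
  · intro s hs heq
    exact hn (List.mem_map.2 ⟨s, hs, heq⟩)

def dec (v : Site) (i : ℕ) (T : List Turn) : Set Site :=
  {x | Gp ((v.1 + i, v.2 - 1) :: Pth (v.1 + i, v.2) T) x = 1}

theorem cols_le {L : ℕ} {F : Finset Site} (hF : F ⊆ box L) : (F.image Prod.fst).card ≤ (bd L F).card := by
  refine le_trans (Finset.card_le_card ?_) (Finset.card_image_le (s := bd L F) (f := fun e => e.1.1))
  intro c hc
  rw [Finset.mem_image] at hc ⊢
  obtain ⟨x, hx, rfl⟩ := hc
  obtain ⟨y, hy, hm⟩ := Finset.exists_max_image (F.filter (fun y => y.1 = x.1)) (fun y => y.2)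
    ⟨x, by simp [hx]⟩
  rw [Finset.mem_filter] at hy
  refine ⟨(y, false), ?_, hy.2⟩
  rw [mem_bd hF]
  unfold BdE
  have : y + dl false ∉ F := fun h => by
    have := hm (y + dl false) (Finset.mem_filter.2 ⟨h, by simp [dl, hy.2]⟩)
    simp [dl] at this
  simp [hy.1, this]

theorem rows_le {L : ℕ} {F : Finset Site} (hF : F ⊆ box L) : (F.image Prod.snd).card ≤ (bd L F).card := by
  refine le_trans (Finset.card_le_card ?_) (Finset.card_image_le (s := bd L F) (f := fun e => e.1.2))
  intro c hc
  rw [Finset.mem_image] at hc ⊢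
  obtain ⟨x, hx, rfl⟩ := hc
  obtain ⟨y, hy, hm⟩ := Finset.exists_max_image (F.filter (fun y => y.2 = x.2)) (fun y => y.1)
    ⟨x, by simp [hx]⟩
  rw [Finset.mem_filter] at hy
  refine ⟨(y, true), ?_, hy.2⟩
  rw [mem_bd hF]
  unfold BdE
  have : y + dl true ∉ F := fun h => by
    have := hm (y + dl true) (Finset.mem_filter.2 ⟨h, by simp [dl, hy.2]⟩)
    simp [dl] at this
  simp [hy.1, this]

theorem contour {L : ℕ} {F : Finset Site} {v : Site} (hF : F ⊆ box L) (hv : v ∈ F)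
    (hcF : ∀ G : Site → ZMod 2, Ecst F G → ∀ x ∈ F, G x = G v)
    (hcE : ∀ G : Site → ZMod 2, Ecst F G → ∀ x, x ∉ F → ∃ o, o ∉ box L ∧ G x = G o) :
    ∃ (i : ℕ) (T : List Turn), Val T ∧ (bd L F).card = T.length + 2 ∧ i < (bd L F).card ∧
      (F : Set Site) = dec v i T := by
  -- the start edge
  have hex : ∃ i : ℕ, ((v.1 + i + 1, v.2) : Site) ∉ F := by
    refine ⟨L, fun h => ?_⟩
    have := (mem_box _ _).1 (hF h)
    have := (mem_box _ _).1 (hF hv)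
    simp at *; omega
  set i := Nat.find hex with hi
  have hi1 : ((v.1 + i + 1, v.2) : Site) ∉ F := Nat.find_spec hex
  have hi2 : ∀ j : ℕ, j ≤ i → ((v.1 + j, v.2) : Site) ∈ F := by
    intro j hj
    cases j with
    | zero => simpa using hv
    | succ j =>
      have := Nat.find_min hex (m := j) (by omega)
      rw [not_not] at this
      push_cast
      rw [← add_assoc]; exact this
  set s : ℤ × ℤ := (v.1 + i, v.2) with hs
  have hstart : BdE F (lab s (s - (0, 1))) := by
    have := hi2 i le_rfl
    have h2 : (s.1 + 1, s.2) ∉ F := hi1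
    simp [BdE, lab, dl]
    intro h
    exact absurd (h.1 this) (by simpa [Prod.add_def] using h2)
  let Q : List Turn → Prop := fun T => (Pth s T).Nodup ∧ ∀ x ∈ stp (Pth s T), BdE F (lab x.1 x.2)
  have hQ0 : Q [] := by
    refine ⟨by simp [Pth, bk, fin', Prod.ext_iff]; omega, ?_⟩
    intro x hx
    simp [Pth, bk, fin', stp] at hx
    subst hx
    convert hstart using 2
    ext <;> simp
  have hQb : ∀ T, Q T → T.length ≤ (bd L F).card := by
    intro T hT
    have h1 := nodup_labels hT.1 (Pth_unit s T)
    have h2 : ((stp (Pth s T)).map (fun s => lab s.1 s.2)).toFinset ⊆ bd L F := by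
      intro e he
      rw [List.mem_toFinset, List.mem_map] at he
      obtain ⟨x, hx, rfl⟩ := he
      rw [mem_bd hF]
      exact hT.2 x hx
    have h3 := Finset.card_le_card h2
    rw [List.toFinset_card_of_nodup h1, List.length_map] at h3
    obtain ⟨l, hl⟩ := Pth_head s T
    have h4 := Pth_length s T
    rw [hl] at h3 h4
    rw [stp_length] at h3
    simp at h3 h4
    omega
  obtain ⟨T, hT, hmax⟩ : ∃ T, Q T ∧ ∀ T', Q T' → T'.length ≤ T.length := by
    have hex2 : ∃ n, ∃ T, Q T ∧ T.length = n := ⟨0, [], hQ0, rfl⟩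
    have h1 : ∃ T, Q T ∧ T.length = Nat.findGreatest (fun n => ∃ T, Q T ∧ T.length = n) (bd L F).card :=
      Nat.findGreatest_spec (P := fun n => ∃ T, Q T ∧ T.length = n) (Nat.zero_le _) ⟨[], hQ0, rfl⟩
    obtain ⟨T, hT, hl⟩ := h1
    refine ⟨T, hT, fun T' hT' => ?_⟩
    rw [hl]
    exact Nat.le_findGreatest (hQb T' hT') ⟨T', hT', rfl⟩
  obtain ⟨l, hl⟩ := Pth_head s T
  have hdir := fin'_dir s T
  set p := (fin' s T).1 with hp
  set d := (fin' s T).2 with hd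
  have hlast : BdE F (lab p (p - d)) := hT.2 (p, p - d) (by rw [hl, stp]; simp)
  obtain ⟨t, ht⟩ := even_deg F p d hdir hlast
  set q := p + rt t d with hq
  have hPc : Pth s (t :: T) = q :: Pth s T := Pth_cons s t T
  have hqm : q ∈ Pth s T := by
    by_contra hn
    have : Q (t :: T) := by
      refine ⟨by rw [hPc, List.nodup_cons]; exact ⟨hn, hT.1⟩, ?_⟩
      intro x hx
      rw [stp_Pth_cons, List.mem_cons] at hx
      rcases hx with rfl | hx
      · rw [lab_comm]; exact ht
      · exact hT.2 x hx
    have := hmax _ this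
    simp at this
  obtain ⟨A, Bt, hAB⟩ := List.append_of_mem hqm
  have hrt := rt_dir hdir t
  have hqp : q ≠ p := by
    intro h
    have : rt t d = 0 := by rw [hq] at h; simpa using h
    rw [this] at hrt
    simp [IsDir, Prod.ext_iff] at hrt
  have hqp2 : q ≠ p - d := by
    intro h
    apply rt_ne hdir t
    rw [hq, sub_eq_add_neg] at h
    exact add_left_cancel h
  obtain ⟨a, b, A', rfl⟩ : ∃ a b A', A = a :: b :: A' := by
    rw [hl] at hAB
    match A, hAB with
    | [], h => simp at h; exact absurd h.1.symm hqp
    | [a], h => simp at h; exact absurd h.2.1.symm hqp2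
    | a :: b :: A', _ => exact ⟨a, b, A', rfl⟩
  have hap : a = p := by
    rw [hl] at hAB; simp at hAB; exact hAB.1.symm
  have hsub : ∀ x ∈ stp (a :: b :: A' ++ [q]), x ∈ stp (Pth s T) := by
    rw [hAB]
    generalize a :: b :: A' = A
    clear hAB
    induction A with
    | nil => simp [stp]
    | cons c A ih =>
      cases A with
      | nil => simp [stp]
      | cons c' A =>
        simp only [List.cons_append, stp, List.mem_cons] at ih ⊢
        rintro x (hx | hx)
        · exact Or.inl hx
        · exact Or.inr (ih x hx)
  have hsimp : Simple F q a b A' := by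
    refine ⟨?_, ?_, ?_⟩
    · have := hT.1
      rw [hAB] at this
      refine List.Nodup.sublist ?_ this
      apply List.Sublist.append_left
      simp
    · intro x hx
      rw [List.cons_append, stp, List.mem_cons] at hx
      rcases hx with rfl | hx
      · unfold Unit'
        have := neg_dir hrt
        rw [hap]
        convert this using 1
        rw [hq]; simp
      · exact Pth_unit s T x (hsub x hx)
    · intro x hx
      rw [List.cons_append, stp, List.mem_cons] at hx
      rcases hx with rfl | hx
      · rw [lab_comm, hap]; exact ht
      · exact hT.2 x (hsub x hx)
  obtain ⟨hm1, hm2⟩ := hsimp.main hF hcF hcE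
  -- the closed walk is everything
  obtain ⟨l', hl'⟩ := Pth_last s T
  have hp0 : s - (0, 1) ∈ a :: b :: A' ++ [q] := by
    have h1 := hm2 _ hstart
    rw [List.mem_map] at h1
    obtain ⟨x, hx, e⟩ := h1
    have h2 := stp_mem hx
    have h3 : Unit' s (s - (0, 1)) := by rw [unit_iff]; simp
    have h4 : s - (0, 1) ∈ q :: (a :: b :: A' ++ [q]) := by
      rcases lab_inj (hsimp.un x hx) h3 e with ⟨_, h⟩ | ⟨h, _⟩
      · rw [← h]; exact h2.2
      · rw [← h]; exact h2.1
    rcases List.mem_cons.1 h4 with h | h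
    · rw [h]; simp
    · exact h
  have hB : Bt = [] := by
    by_contra hne
    have h1 : (Pth s T).getLast? = some (s - (0, 1)) := by rw [hl']; simp
    rw [hAB] at h1
    have h2 : s - (0, 1) ∈ Bt := by
      rw [List.getLast?_append, List.getLast?_cons_of_ne_nil hne] at h1
      rw [List.getLast?_eq_some_getLast hne] at h1
      simp at h1
      rw [← h1]; exact List.getLast_mem hne
    have h3 := hT.1
    rw [hAB, ← List.singleton_append (l := Bt), ← List.append_assoc, List.nodup_append] at h3
    exact h3.2.2 _ hp0 _ h2 rfl
  subst hB
  have hq0 : q = s - (0, 1) := by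
    have h1 : (Pth s T).getLast? = some (s - (0, 1)) := by rw [hl']; simp
    rw [hAB, List.getLast?_append] at h1
    simpa using h1
  have hcard : (bd L F).card = T.length + 2 := by
    have h1 : bd L F = ((stp (q :: (a :: b :: A' ++ [q]))).map (fun s => lab s.1 s.2)).toFinset := by
      ext e
      rw [mem_bd hF, List.mem_toFinset]
      refine ⟨hm2 e, fun h => ?_⟩
      rw [List.mem_map] at h
      obtain ⟨x, hx, rfl⟩ := h
      exact hsimp.bd x hx
    rw [h1, List.toFinset_card_of_nodup hsimp.labels, List.length_map, stp_length, ← hAB, Pth_length]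
  refine ⟨i, T, Val.of_bk hT.1, hcard, ?_, ?_⟩
  · refine lt_of_lt_of_le ?_ (cols_le hF)
    have : (Finset.range (i + 1)).image (fun j : ℕ => v.1 + (j : ℤ)) ⊆ F.image Prod.fst := by
      intro c hc
      rw [Finset.mem_image] at hc ⊢
      obtain ⟨j, hj, rfl⟩ := hc
      exact ⟨_, hi2 j (by simpa [Nat.lt_succ_iff] using hj), rfl⟩
    have h2 := Finset.card_le_card this
    rw [Finset.card_image_of_injective, Finset.card_range] at h2
    · omega
    · intro x y h; simpa using h
  · ext x
    rw [Finset.mem_coe, hm1 x]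
    unfold dec
    rw [Set.mem_ofPred_eq, ← hs, hAB]
    have : q = (v.1 + (i : ℤ), v.2 - 1) := by rw [hq0, hs]; ext <;> simp
    rw [← this]

theorem adj_iff (x y : Site) : SiteAdj x y ↔ ∃ b, y = x + dl b ∨ x = y + dl b := by
  unfold SiteAdj
  simp only [Bool.exists_bool, dl, Prod.ext_iff, Prod.fst_add, Prod.snd_add]
  omega

theorem adj_symm {x y : Site} (h : SiteAdj x y) : SiteAdj y x := by
  rw [adj_iff] at *
  obtain ⟨b, h⟩ := h
  exact ⟨b, h.symm⟩

theorem Ecst.adj {F : Finset Site} {G : Site → ZMod 2} (hG : Ecst F G) {x y : Site}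
    (h : SiteAdj x y) (hxy : x ∈ F ↔ y ∈ F) : G x = G y := by
  rw [adj_iff] at h
  obtain ⟨b, rfl | rfl⟩ := h
  · exact hG (x, b) (by unfold BdE; simpa using hxy)
  · exact (hG (y, b) (by unfold BdE; simpa using hxy.symm)).symm

def Rch (C : Site → Prop) (v x : Site) : Prop :=
  C v ∧ Relation.ReflTransGen (fun a b => SiteAdj a b ∧ C b) v x

theorem Rch.mem {C : Site → Prop} {v x : Site} (h : Rch C v x) : C x := by
  obtain ⟨h1, h2⟩ := h
  induction h2 with
  | refl => exact h1
  | tail _ h _ => exact h.2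

theorem Rch.step {C : Site → Prop} {v x y : Site} (h : Rch C v x) (ha : SiteAdj x y) (hy : C y) :
    Rch C v y := ⟨h.1, h.2.tail ⟨ha, hy⟩⟩

theorem Rch.ind {C : Site → Prop} {v x : Site} (h : Rch C v x) {P : Site → Prop} (h0 : P v)
    (hs : ∀ a b, Rch C v a → Rch C v b → SiteAdj a b → P a → P b) : P x := by
  obtain ⟨h1, h2⟩ := h
  induction h2 with
  | refl => exact h0
  | tail h3 h ih => exact hs _ _ ⟨h1, h3⟩ ⟨h1, h3.tail h⟩ h.1 ih

theorem Rch.mono {C C' : Site → Prop} {v x : Site} (h : Rch C v x)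
    (hC : ∀ y, Rch C v y → C' y) : Rch C' v x :=
  h.ind (P := Rch C' v) ⟨hC v ⟨h.1, .refl⟩, .refl⟩ (fun a b _ hb hab ih => ih.step hab (hC b hb))

def Ext (L : ℕ) (C : Site → Prop) (v x : Site) : Prop :=
  ∃ o, o ∉ box L ∧ Relation.ReflTransGen (fun a b => SiteAdj a b ∧ ¬ Rch C v b) o x

def fill (L : ℕ) (C : Site → Prop) (v : Site) : Finset Site := (box L).filter (fun x => ¬ Ext L C v x)

section
variable {L : ℕ} {C : Site → Prop} {v : Site}

theorem fill_sub : fill L C v ⊆ box L := Finset.filter_subset _ _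

theorem not_fill {x : Site} : x ∉ fill L C v ↔ Ext L C v x := by
  unfold fill
  rw [Finset.mem_filter]
  constructor
  · intro h
    by_cases hx : x ∈ box L
    · by_contra hc; exact h ⟨hx, hc⟩
    · exact ⟨x, hx, .refl⟩
  · intro h h2; exact h2.2 h

theorem Ext.step {x y : Site} (h : Ext L C v x) (ha : SiteAdj x y) (hy : ¬ Rch C v y) :
    Ext L C v y := by
  obtain ⟨o, ho, h⟩ := h
  exact ⟨o, ho, h.tail ⟨ha, hy⟩⟩

theorem Rch.fill (hC : ∀ x, C x → x ∈ box L) {x : Site} (h : Rch C v x) : x ∈ fill L C v := by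
  by_contra hn
  rw [not_fill] at hn
  obtain ⟨o, ho, h2⟩ := hn
  cases h2 with
  | refl => exact ho (hC _ h.mem)
  | tail _ h3 => exact h3.2 h

theorem fill_bdry (hC : ∀ x, C x → x ∈ box L) {x y : Site} (ha : SiteAdj x y)
    (hx : x ∈ fill L C v) (hy : y ∉ fill L C v) : C x ∧ ¬ C y := by
  have hyE := not_fill.1 hy
  have hxR : Rch C v x := by
    by_contra hn
    exact not_fill.2 (hyE.step (adj_symm ha) hn) hx
  refine ⟨hxR.mem, fun h => ?_⟩
  exact hy ((hxR.step ha h).fill hC)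

theorem fill_cF (hC : ∀ x, C x → x ∈ box L) (G : Site → ZMod 2) (hG : Ecst (fill L C v) G) :
    ∀ x ∈ fill L C v, G x = G v := by
  have key : ∀ n : ℕ, ∀ x ∈ fill L C v, (L - x.1).toNat ≤ n → G x = G v := by
    have hR : ∀ x, Rch C v x → G x = G v := by
      intro x hx
      refine hx.ind (P := fun x => G x = G v) rfl ?_
      intro a b ha hb hab h
      rw [← h]
      exact (hG.adj hab (by simp [ha.fill hC, hb.fill hC])).symm
    intro n
    induction n with
    | zero =>
      intro x hx hn
      by_cases h : Rch C v x
      · exact hR x h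
      · exfalso
        have hb := (mem_box _ _).1 (fill_sub hx)
        refine not_fill.2 ((?_ : Ext L C v (x + dl true)).step ?_ h) hx
        · refine ⟨_, ?_, .refl⟩
          rw [mem_box]; simp [dl]; omega
        · rw [adj_iff]; exact ⟨true, Or.inr rfl⟩
    | succ n ih =>
      intro x hx hn
      by_cases h : Rch C v x
      · exact hR x h
      · have ha : SiteAdj (x + dl true) x := by rw [adj_iff]; exact ⟨true, Or.inr rfl⟩
        have hy : x + dl true ∈ fill L C v := by
          by_contra hn
          exact not_fill.2 ((not_fill.1 hn).step ha h) hx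
        rw [← ih _ hy (by simp [dl]; omega)]
        exact (hG.adj ha (by simp [hx, hy])).symm
  intro x hx
  exact key _ x hx le_rfl

theorem fill_cE (hC : ∀ x, C x → x ∈ box L) (G : Site → ZMod 2) (hG : Ecst (fill L C v) G) :
    ∀ x, x ∉ fill L C v → ∃ o, o ∉ box L ∧ G x = G o := by
  intro x hx
  rw [not_fill] at hx
  obtain ⟨o, ho, h⟩ := hx
  refine ⟨o, ho, ?_⟩
  induction h with
  | refl => rfl
  | tail h1 h2 ih =>
    rw [← ih]
    have ha := not_fill.2 (⟨o, ho, h1⟩ : Ext L C v _)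
    have hb := not_fill.2 (⟨o, ho, h1.tail h2⟩ : Ext L C v _)
    exact (hG.adj h2.1 (by simp [ha, hb])).symm

theorem fill_card (hC : ∀ x, C x → x ∈ box L) {z : Site} (hz : Rch C v z) (r : ℕ)
    (hr : r < (z.1 - v.1).natAbs ∨ r < (z.2 - v.2).natAbs) : r ≤ (bd L (fill L C v)).card := by
  have hv : Rch C v v := ⟨hz.1, .refl⟩
  have h1 : ∀ c : ℤ, (v.1 ≤ c ∧ c ≤ z.1 ∨ z.1 ≤ c ∧ c ≤ v.1) → c ∈ (fill L C v).image Prod.fst := by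
    refine hz.ind (P := fun z => ∀ c : ℤ, (v.1 ≤ c ∧ c ≤ z.1 ∨ z.1 ≤ c ∧ c ≤ v.1) →
      c ∈ (SOSPaper.fill L C v).image Prod.fst) ?_ ?_
    · intro c hc
      exact Finset.mem_image.2 ⟨v, hv.fill hC, by omega⟩
    · intro a b ha hb hab ih c hc
      by_cases h : c = b.1
      · exact Finset.mem_image.2 ⟨b, hb.fill hC, h.symm⟩
      · apply ih
        unfold SiteAdj at hab
        omega
  have h2 : ∀ c : ℤ, (v.2 ≤ c ∧ c ≤ z.2 ∨ z.2 ≤ c ∧ c ≤ v.2) → c ∈ (fill L C v).image Prod.snd := by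
    refine hz.ind (P := fun z => ∀ c : ℤ, (v.2 ≤ c ∧ c ≤ z.2 ∨ z.2 ≤ c ∧ c ≤ v.2) →
      c ∈ (SOSPaper.fill L C v).image Prod.snd) ?_ ?_
    · intro c hc
      exact Finset.mem_image.2 ⟨v, hv.fill hC, by omega⟩
    · intro a b ha hb hab ih c hc
      by_cases h : c = b.2
      · exact Finset.mem_image.2 ⟨b, hb.fill hC, h.symm⟩
      · apply ih
        unfold SiteAdj at hab
        omega
  rcases hr with hr | hr
  · refine le_trans ?_ (cols_le fill_sub)
    have : Finset.Icc (min v.1 z.1) (max v.1 z.1) ⊆ (fill L C v).image Prod.fst := by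
      intro c hc
      rw [Finset.mem_Icc] at hc
      apply h1; omega
    refine le_trans ?_ (Finset.card_le_card this)
    rw [Int.card_Icc]; omega
  · refine le_trans ?_ (rows_le fill_sub)
    have : Finset.Icc (min v.2 z.2) (max v.2 z.2) ⊆ (fill L C v).image Prod.snd := by
      intro c hc
      rw [Finset.mem_Icc] at hc
      apply h2; omega
    refine le_trans ?_ (Finset.card_le_card this)
    rw [Int.card_Icc]; omega
end

theorem tau_small (ε : ℝ) (hε : 0 < ε) : ∃ r : ℕ, ∀ (L : ℕ) (v : Site) (𝓕 : Finset (Finset Site)),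
    (∀ F ∈ 𝓕, r ≤ (bd L F).card ∧ ∃ (i : ℕ) (T : List Turn), Val T ∧ (bd L F).card = T.length + 2 ∧
      i < (bd L F).card ∧ (F : Set Site) = dec v i T) →
    ∑ F ∈ 𝓕, Real.exp (-((bd L F).card : ℝ)) ≤ ε := by
  obtain ⟨C, hC, hW⟩ := saw_bound
  have he : (2.718 : ℝ) < Real.exp 1 := lt_trans (by norm_num) Real.exp_one_gt_d9
  set ρ : ℝ := 2.718 / Real.exp 1 with hρ
  have hρ0 : 0 ≤ ρ := by positivity
  have hρ1 : ρ < 1 := by rw [hρ, div_lt_one (Real.exp_pos 1)]; exact he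
  have hsum : Summable (fun n : ℕ => ((n : ℝ) + 2) * (C * ρ ^ n)) := by
    have h1 := summable_pow_mul_geometric_of_norm_lt_one 1 (r := ρ)
      (by rw [Real.norm_of_nonneg hρ0]; exact hρ1)
    have h2 := summable_geometric_of_lt_one hρ0 hρ1
    refine ((h1.mul_left C).add (h2.mul_left (2 * C))).congr ?_
    intro n
    simp; ring
  rw [summable_iff_vanishing_norm] at hsum
  obtain ⟨s, hs⟩ := hsum ε hε
  refine ⟨s.sup id + 3, ?_⟩
  intro L v 𝓕 h𝓕
  have h𝓕' : ∀ F : Finset Site, ∃ iT : ℕ × List Turn, F ∈ 𝓕 → Val iT.2 ∧ (bd L F).card = iT.2.length + 2 ∧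
      iT.1 < (bd L F).card ∧ (F : Set Site) = dec v iT.1 iT.2 := by
    intro F
    by_cases hF : F ∈ 𝓕
    · obtain ⟨_, i, T, h⟩ := h𝓕 F hF
      exact ⟨(i, T), fun _ => h⟩
    · exact ⟨(0, []), fun h => absurd h hF⟩
  choose φ hφ using h𝓕'
  set N := 𝓕.sup (fun F => (φ F).2.length) + 1 with hN
  set S : Finset (Σ _ : ℕ, ℕ × List Turn) :=
    (Finset.Ico (s.sup id + 1) N).sigma (fun n => Finset.range (n + 2) ×ˢ Wd n) with hS
  have step1 : ∑ F ∈ 𝓕, Real.exp (-((bd L F).card : ℝ)) ≤ ∑ y ∈ S, Real.exp (-((y.1 : ℝ) + 2)) := by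
    have e1 : ∑ F ∈ 𝓕, Real.exp (-((bd L F).card : ℝ)) =
        ∑ y ∈ 𝓕.image (fun F => (⟨(φ F).2.length, φ F⟩ : Σ _ : ℕ, ℕ × List Turn)),
          Real.exp (-((y.1 : ℝ) + 2)) := by
      rw [Finset.sum_image]
      · apply Finset.sum_congr rfl
        intro F hF
        rw [(hφ F hF).2.1]; push_cast; rfl
      · intro F hF F' hF' h
        have h2 : φ F = φ F' := by simp at h; exact h.2
        have h3 := (hφ F hF).2.2.2
        rw [h2, ← (hφ F' hF').2.2.2] at h3
        exact_mod_cast h3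
    rw [e1]
    apply Finset.sum_le_sum_of_subset_of_nonneg
    · intro y hy
      rw [Finset.mem_image] at hy
      obtain ⟨F, hF, rfl⟩ := hy
      obtain ⟨h1, h2, h3, h4⟩ := hφ F hF
      rw [hS, Finset.mem_sigma, Finset.mem_Ico, Finset.mem_product, Finset.mem_range]
      have h5 := (h𝓕 F hF).1
      have h6 : (φ F).2.length ≤ 𝓕.sup (fun F => (φ F).2.length) :=
        Finset.le_sup (f := fun F => (φ F).2.length) hF
      refine ⟨⟨?_, ?_⟩, ?_, mem_Wd _ h1⟩
      · simp only; omega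
      · simp only; omega
      · simp only; omega
    · intro _ _ _; positivity
  refine step1.trans ?_
  rw [hS, Finset.sum_sigma]
  have step2 : ∀ n ∈ Finset.Ico (s.sup id + 1) N,
      ∑ y ∈ Finset.range (n + 2) ×ˢ Wd n, Real.exp (-((n : ℝ) + 2)) ≤ ((n : ℝ) + 2) * (C * ρ ^ n) := by
    intro n _
    rw [Finset.sum_const, Finset.card_product, Finset.card_range, nsmul_eq_mul]
    push_cast
    rw [mul_assoc]
    apply mul_le_mul_of_nonneg_left _ (by positivity)
    have h1 : Real.exp (-((n : ℝ) + 2)) ≤ (Real.exp 1 ^ n)⁻¹ := by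
      rw [← Real.exp_nat_mul, ← Real.exp_neg]
      apply Real.exp_le_exp.2; linarith
    calc ((Wd n).card : ℝ) * Real.exp (-((n : ℝ) + 2)) ≤ (C * 2.718 ^ n) * (Real.exp 1 ^ n)⁻¹ := by
          apply mul_le_mul (hW n) h1 (Real.exp_pos _).le (by positivity)
      _ = C * ρ ^ n := by rw [hρ, div_pow]; ring
  refine (Finset.sum_le_sum step2).trans ?_
  have := hs (Finset.Ico (s.sup id + 1) N) (by
    rw [Finset.disjoint_left]
    intro n hn hns
    have := Finset.le_sup (f := id) hns
    simp at hn this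
    omega)
  exact (le_trans (le_abs_self _) this.le)

def EN (L : ℕ) (η : Config) : ℤ := ∑ e ∈ EB L, |η e.1 - η (e.1 + dl e.2)|

def Om (L : ℕ) (lo hi : Config) : Finset Config :=
  (Fintype.piFinset (fun x : {x // x ∈ box L} => Finset.Icc (lo x) (hi x))).image
    (extendC (box L) 0)

theorem mem_Om {L : ℕ} {lo hi η : Config} : η ∈ Om L lo hi ↔
    (∀ x ∈ box L, lo x ≤ η x ∧ η x ≤ hi x) ∧ ∀ x, x ∉ box L → η x = 0 := by
  unfold Om
  rw [Finset.mem_image]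
  constructor
  · rintro ⟨g, hg, rfl⟩
    rw [Fintype.mem_piFinset] at hg
    constructor
    · intro x hx
      have := hg ⟨x, hx⟩
      rw [Finset.mem_Icc] at this
      simpa [extendC, hx] using this
    · intro x hx
      simp [extendC, hx]
  · rintro ⟨h1, h2⟩
    refine ⟨fun x => η x, ?_, ?_⟩
    · rw [Fintype.mem_piFinset]
      intro x
      rw [Finset.mem_Icc]
      exact h1 x x.2
    · funext x
      by_cases hx : x ∈ box L
      · simp [extendC, hx]
      · simp [extendC, hx, h2 x hx]

def wt (β : ℝ) (L : ℕ) (η : Config) : ℝ := Real.exp (-(β * (EN L η : ℝ)))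

theorem wt_pos (β : ℝ) (L : ℕ) (η : Config) : 0 < wt β L η := Real.exp_pos _

def OC (L : ℕ) (a b : ℤ) : Finset Config := Om L (fun _ => a) (fun _ => b)

theorem mem_OC {L : ℕ} {a b : ℤ} {η : Config} : η ∈ OC L a b ↔
    (∀ x ∈ box L, a ≤ η x ∧ η x ≤ b) ∧ ∀ x, x ∉ box L → η x = 0 := mem_Om

def ZZ (β : ℝ) (L : ℕ) (a b : ℤ) : ℝ := ∑ η ∈ OC L a b, wt β L η

theorem OC_mono {L : ℕ} {a b a' b' : ℤ} (ha : a' ≤ a) (hb : b ≤ b') : OC L a b ⊆ OC L a' b' := by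
  intro η h
  rw [mem_OC] at h ⊢
  exact ⟨fun x hx => ⟨ha.trans (h.1 x hx).1, (h.1 x hx).2.trans hb⟩, h.2⟩

theorem ZZ_mono (β : ℝ) {L : ℕ} {a b a' b' : ℤ} (ha : a' ≤ a) (hb : b ≤ b') :
    ZZ β L a b ≤ ZZ β L a' b' :=
  Finset.sum_le_sum_of_subset_of_nonneg (OC_mono ha hb) (fun _ _ _ => (wt_pos _ _ _).le)

theorem EN_nonneg (L : ℕ) (η : Config) : 0 ≤ EN L η := Finset.sum_nonneg (fun _ _ => abs_nonneg _)

theorem ZZ_ge_one (β : ℝ) (L : ℕ) {a b : ℤ} (ha : a ≤ 0) (hb : 0 ≤ b) : 1 ≤ ZZ β L a b := by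
  have : (0 : Config) ∈ OC L a b := by
    rw [mem_OC]; exact ⟨fun x _ => ⟨ha, hb⟩, fun _ _ => rfl⟩
  have h := Finset.single_le_sum (f := wt β L) (fun x _ => (wt_pos β L x).le) this
  have h0 : wt β L 0 = 1 := by simp [wt, EN]
  rw [h0] at h; exact h

theorem ZZ_le (β : ℝ) (hβ : 0 ≤ β) (L : ℕ) (n : ℕ) (a : ℤ) :
    ZZ β L a (a + n) ≤ ((n : ℝ) + 1) ^ (box L).card := by
  have h1 : ZZ β L a (a + n) ≤ ((OC L a (a + n)).card : ℝ) := by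
    have := Finset.sum_le_card_nsmul (OC L a (a + n)) (wt β L) 1 (fun x _ => by
      unfold wt
      rw [Real.exp_le_one_iff]
      have : (0 : ℝ) ≤ EN L x := by exact_mod_cast EN_nonneg L x
      nlinarith [mul_nonneg hβ this])
    simpa [ZZ] using this
  refine h1.trans ?_
  have h2 : (OC L a (a + n)).card ≤ (n + 1) ^ (box L).card := by
    unfold OC Om
    refine Finset.card_image_le.trans ?_
    rw [Fintype.card_piFinset]
    simp only [Int.card_Icc]
    rw [Finset.prod_const]
    have : (a + n + 1 - a).toNat = n + 1 := by omega
    rw [this]; simp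
  exact_mod_cast h2

theorem line1 (g : ℕ → ℤ) (x : ℕ) : ∀ n, x ≤ n →
    |g 0 - g x| + |g x - g n| ≤ ∑ i ∈ Finset.range n, |g i - g (i + 1)| := by
  have h0 : ∀ x, |g 0 - g x| ≤ ∑ i ∈ Finset.range x, |g i - g (i + 1)| := by
    intro x
    induction x with
    | zero => simp
    | succ k ih =>
      rw [Finset.sum_range_succ]
      have := abs_sub_le (g 0) (g k) (g (k+1))
      linarith
  intro n hn
  induction n, hn using Nat.le_induction with
  | base => simpa using h0 x
  | succ k hk ih =>
    rw [Finset.sum_range_succ]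
    have := abs_sub_le (g x) (g k) (g (k+1))
    linarith

theorem line2 (f : ℤ → ℤ) (L : ℕ) (x : ℤ) (h1 : 0 ≤ x) (h2 : x ≤ L) (h0 : f 0 = 0) (hL : f (L + 1) = 0) :
    2 * |f x| ≤ ∑ i ∈ Finset.Icc (0 : ℤ) L, |f i - f (i + 1)| := by
  have h := line1 (fun n => f n) x.toNat (L + 1) (by omega)
  have e : ∑ i ∈ Finset.range (L + 1), |f (i : ℕ) - f ((i + 1 : ℕ) : ℤ)| =
      ∑ i ∈ Finset.Icc (0 : ℤ) L, |f i - f (i + 1)| := by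
    apply Finset.sum_bij (fun (i : ℕ) _ => (i : ℤ))
    · intro i hi; rw [Finset.mem_range] at hi; rw [Finset.mem_Icc]; omega
    · intro i _ j _ h; exact_mod_cast h
    · intro j hj; rw [Finset.mem_Icc] at hj
      exact ⟨j.toNat, by rw [Finset.mem_range]; omega, by omega⟩
    · intro i _; push_cast; rfl
  rw [← e]
  refine le_trans ?_ h
  have hx : ((x.toNat : ℕ) : ℤ) = x := by omega
  simp only [hx]
  push_cast
  rw [h0, hL]; simp; linarith

theorem EN_two (L : ℕ) (η : Config) : EN L η =
    (∑ j ∈ Finset.Icc (0 : ℤ) L, ∑ i ∈ Finset.Icc (0 : ℤ) L, |η (i, j) - η (i + 1, j)|) +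
    ∑ i ∈ Finset.Icc (0 : ℤ) L, ∑ j ∈ Finset.Icc (0 : ℤ) L, |η (i, j) - η (i, j + 1)| := by
  unfold EN EB
  rw [Finset.sum_product_right]
  rw [Fintype.sum_bool, ← Finset.Icc_product_Icc, Finset.sum_product_right, Finset.sum_product]
  simp [dl]

theorem EN_ge {L : ℕ} {u : Config} (hu : ∀ x, x ∉ box L → u x = 0) (x : Site) : 4 * |u x| ≤ EN L u := by
  by_cases hx : x ∈ box L
  · rw [mem_box] at hx
    rw [EN_two]
    have a1 := line2 (fun i => u (i, x.2)) L x.1 (by omega) (by omega)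
      (hu _ (by rw [mem_box]; simp)) (hu _ (by rw [mem_box]; simp))
    have a2 := line2 (fun i => u (x.1, i)) L x.2 (by omega) (by omega)
      (hu _ (by rw [mem_box]; simp)) (hu _ (by rw [mem_box]; simp))
    have b1 := Finset.single_le_sum (s := Finset.Icc (0 : ℤ) L)
      (f := fun j => ∑ i ∈ Finset.Icc (0 : ℤ) L, |u (i, j) - u (i + 1, j)|) (a := x.2)
      (fun i _ => Finset.sum_nonneg (fun _ _ => abs_nonneg _)) (by rw [Finset.mem_Icc]; omega)
    have b2 := Finset.single_le_sum (s := Finset.Icc (0 : ℤ) L)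
      (f := fun i => ∑ j ∈ Finset.Icc (0 : ℤ) L, |u (i, j) - u (i, j + 1)|) (a := x.1)
      (fun i _ => Finset.sum_nonneg (fun _ _ => abs_nonneg _)) (by rw [Finset.mem_Icc]; omega)
    simp only [Prod.mk.eta] at a1 a2 b1 b2
    linarith
  · rw [hu x hx]; simpa using EN_nonneg L u

theorem EN_add {L : ℕ} {η ξ u : Config} (h : ∀ e ∈ EB L, |η e.1 - η (e.1 + dl e.2)| =
    |ξ e.1 - ξ (e.1 + dl e.2)| + |u e.1 - u (e.1 + dl e.2)|) : EN L η = EN L ξ + EN L u := by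
  unfold EN
  rw [← Finset.sum_add_distrib]
  exact Finset.sum_congr rfl h

def ind (F : Finset Site) : Config := fun x => if x ∈ F then 1 else 0

theorem EN_ind (L : ℕ) (F : Finset Site) : EN L (ind F) = (bd L F).card := by
  unfold EN bd
  rw [Finset.card_filter]
  push_cast
  apply Finset.sum_congr rfl
  intro e _
  unfold ind BdE
  by_cases h1 : e.1 ∈ F <;> by_cases h2 : e.1 + dl e.2 ∈ F <;> simp [h1, h2]

theorem nbrs_sum (x : Site) (p : Site → Prop) [DecidablePred p] (f : Site → ℝ) :
    ∑ y ∈ (nbrs x).filter p, f y = ∑ b : Bool, ((if p (x + dl b) then f (x + dl b) else 0) +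
      (if p (x - dl b) then f (x - dl b) else 0)) := by
  rw [Finset.sum_filter]
  unfold nbrs
  have e1 : x + dl true = (x.1 + 1, x.2) := by ext <;> simp [dl]
  have e2 : x + dl false = (x.1, x.2 + 1) := by ext <;> simp [dl]
  have e3 : x - dl true = (x.1 - 1, x.2) := by ext <;> simp [dl]
  have e4 : x - dl false = (x.1, x.2 - 1) := by ext <;> simp [dl]
  rw [Fintype.sum_bool, e1, e2, e3, e4]
  rw [Finset.sum_insert, Finset.sum_insert, Finset.sum_insert, Finset.sum_singleton]
  · ring
  · simp only [Finset.mem_singleton, Prod.mk.injEq, not_and]; intros; omega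
  · simp only [Finset.mem_insert, Finset.mem_singleton, Prod.mk.injEq]; omega
  · simp only [Finset.mem_insert, Finset.mem_singleton, Prod.mk.injEq]; omega

theorem sosH_eq {L : ℕ} {η : Config} (hη : ∀ x, x ∉ box L → η x = 0) :
    sosH (box L) 0 η = EN L η := by
  have hB : (EN L η : ℝ) = ∑ b : Bool, ∑ x ∈ Finset.Icc ((0 : ℤ), (0 : ℤ)) ((L : ℤ), (L : ℤ)),
      ((|η x - η (x + dl b)| : ℤ) : ℝ) := by
    unfold EN EB
    rw [Finset.sum_product_right]
    push_cast; rfl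
  have hsub : ∀ x ∈ box L, x ∈ Finset.Icc ((0 : ℤ), (0 : ℤ)) ((L : ℤ), (L : ℤ)) := by
    intro x hx
    rw [mem_box] at hx
    rw [Finset.mem_Icc]
    exact ⟨⟨by simp; omega, by simp; omega⟩, ⟨by simp; omega, by simp; omega⟩⟩
  have hshift : ∀ (b : Bool) (x : Site), x ∈ box L →
      x - dl b ∈ Finset.Icc ((0 : ℤ), (0 : ℤ)) ((L : ℤ), (L : ℤ)) := by
    intro b x hx
    rw [mem_box] at hx
    rw [Finset.mem_Icc]
    cases b <;> exact ⟨⟨by simp [dl]; omega, by simp [dl]; omega⟩, ⟨by simp [dl]; omega, by simp [dl]; omega⟩⟩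
  have key : ∀ b : Bool, ∑ x ∈ Finset.Icc ((0 : ℤ), (0 : ℤ)) ((L : ℤ), (L : ℤ)),
      ((|η x - η (x + dl b)| : ℤ) : ℝ) =
      (∑ x ∈ box L, ((|η x - η (x + dl b)| : ℤ) : ℝ)) +
       ∑ x ∈ box L, (if x - dl b ∉ box L then ((|η x - η (x - dl b)| : ℤ) : ℝ) else 0) := by
    intro b
    rw [← Finset.sum_filter]
    have e1 : ∑ x ∈ (box L).filter (fun x => x - dl b ∉ box L), ((|η x - η (x - dl b)| : ℤ) : ℝ) =
        ∑ y ∈ (Finset.Icc ((0 : ℤ), (0 : ℤ)) ((L : ℤ), (L : ℤ))).filter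
          (fun y => y ∉ box L ∧ y + dl b ∈ box L), ((|η y - η (y + dl b)| : ℤ) : ℝ) := by
      apply Finset.sum_bij (fun x _ => x - dl b)
      · intro x hx
        rw [Finset.mem_filter] at hx ⊢
        exact ⟨hshift b x hx.1, hx.2, by simpa using hx.1⟩
      · intro x _ y _ h; simpa using h
      · intro y hy
        rw [Finset.mem_filter] at hy
        exact ⟨y + dl b, by rw [Finset.mem_filter]; simpa using hy.2.symm, by simp⟩
      · intro x _
        rw [sub_add_cancel, abs_sub_comm]
    rw [e1, Finset.sum_filter]
    have e2 : ∑ x ∈ box L, ((|η x - η (x + dl b)| : ℤ) : ℝ) =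
        ∑ x ∈ Finset.Icc ((0 : ℤ), (0 : ℤ)) ((L : ℤ), (L : ℤ)),
         if x ∈ box L then ((|η x - η (x + dl b)| : ℤ) : ℝ) else 0 := by
      rw [← Finset.sum_filter]
      apply Finset.sum_congr _ (fun _ _ => rfl)
      ext x; rw [Finset.mem_filter]; exact ⟨fun h => ⟨hsub x h, h⟩, fun h => h.2⟩
    rw [e2, ← Finset.sum_add_distrib]
    apply Finset.sum_congr rfl
    intro x _
    by_cases h1 : x ∈ box L
    · simp [h1]
    · by_cases h2 : x + dl b ∈ box L
      · simp [h1, h2]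
      · simp [h1, h2, hη x h1, hη _ h2]
  have sym : ∀ b : Bool, ∑ x ∈ box L, (if x - dl b ∈ box L then ((|η x - η (x - dl b)| : ℤ) : ℝ) else 0) =
      ∑ x ∈ box L, (if x + dl b ∈ box L then ((|η x - η (x + dl b)| : ℤ) : ℝ) else 0) := by
    intro b
    rw [← Finset.sum_filter, ← Finset.sum_filter]
    apply Finset.sum_bij (fun x _ => x - dl b)
    · intro x hx
      rw [Finset.mem_filter] at hx ⊢
      exact ⟨hx.2, by simpa using hx.1⟩
    · intro x _ y _ h; simpa using h
    · intro y hy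
      rw [Finset.mem_filter] at hy
      exact ⟨y + dl b, by rw [Finset.mem_filter]; simpa using hy.symm, by simp⟩
    · intro x _
      rw [sub_add_cancel, abs_sub_comm]
  have split : ∀ b : Bool, ∑ x ∈ box L, ((|η x - η (x + dl b)| : ℤ) : ℝ) =
      (∑ x ∈ box L, (if x + dl b ∈ box L then ((|η x - η (x + dl b)| : ℤ) : ℝ) else 0)) +
      ∑ x ∈ box L, (if x + dl b ∉ box L then ((|η x - η (x + dl b)| : ℤ) : ℝ) else 0) := by
    intro b
    rw [← Finset.sum_add_distrib]
    apply Finset.sum_congr rfl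
    intro x _
    by_cases h : x + dl b ∈ box L <;> simp [h]
  have ext0 : ∀ x ∈ box L, ∑ y ∈ (nbrs x).filter (fun y => y ∉ box L),
      ((|η x - (0 : Config) y| : ℤ) : ℝ) = ∑ y ∈ (nbrs x).filter (fun y => y ∉ box L),
      ((|η x - η y| : ℤ) : ℝ) := by
    intro x _
    apply Finset.sum_congr rfl
    intro y hy
    rw [hη y (Finset.mem_filter.1 hy).2]; rfl
  unfold sosH
  rw [Finset.sum_congr rfl ext0, hB]
  simp only [nbrs_sum, key]
  simp only [Fintype.sum_bool, Finset.sum_add_distrib, sym, split]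
  ring

def Far (r : ℕ) (v z : Site) : Prop := r < (z.1 - v.1).natAbs ∨ r < (z.2 - v.2).natAbs

def lev (η : Config) (m : ℕ) : Site → Prop := fun x => (m : ℤ) ≤ η x

def Big (r : ℕ) (v : Site) (m : ℕ) (η : Config) : Prop := ∃ z, Rch (lev η m) v z ∧ Far r v z

def QQ (β : ℝ) (L r : ℕ) (v : Site) (a b : ℤ) (m : ℕ) : ℝ :=
  ∑ η ∈ (OC L a b).filter (Big r v m), wt β L η

theorem QQ_le (β : ℝ) (L r : ℕ) (v : Site) (a b : ℤ) (m : ℕ) : QQ β L r v a b m ≤ ZZ β L a b :=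
  Finset.sum_le_sum_of_subset_of_nonneg (Finset.filter_subset _ _) (fun _ _ _ => (wt_pos _ _ _).le)

theorem lev_box {L : ℕ} {a b : ℤ} {η : Config} (h : η ∈ OC L a b) {m : ℕ} (hm : 1 ≤ m) :
    ∀ x, lev η m x → x ∈ box L := by
  intro x hx
  by_contra hn
  have := (mem_OC.1 h).2 x hn
  unfold lev at hx
  omega

/-- A sum over pairs bounds a sum over an injective image. -/
theorem sum_pair {α γ δ : Type*} (s : Finset α) (f : α → γ) (g : α → δ) (t : Finset γ) (u : Finset δ)
    (w : α → ℝ) (p : γ → ℝ) (q : δ → ℝ) (hp : ∀ x ∈ t, 0 ≤ p x) (hq : ∀ x ∈ u, 0 ≤ q x)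
    (hf : ∀ x ∈ s, f x ∈ t) (hg : ∀ x ∈ s, g x ∈ u)
    (hinj : ∀ x ∈ s, ∀ y ∈ s, f x = f y → g x = g y → x = y) (hw : ∀ x ∈ s, w x ≤ p (f x) * q (g x)) :
    ∑ x ∈ s, w x ≤ (∑ x ∈ t, p x) * ∑ y ∈ u, q y := by
  calc ∑ x ∈ s, w x ≤ ∑ x ∈ s, p (f x) * q (g x) := Finset.sum_le_sum hw
    _ = ∑ z ∈ s.image (fun x => (f x, g x)), p z.1 * q z.2 := by
        rw [Finset.sum_image]
        intro x hx y hy h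
        rw [Prod.mk.injEq] at h
        exact hinj x hx y hy h.1 h.2
    _ ≤ ∑ z ∈ t ×ˢ u, p z.1 * q z.2 := by
        apply Finset.sum_le_sum_of_subset_of_nonneg
        · intro z hz
          rw [Finset.mem_image] at hz
          obtain ⟨x, hx, rfl⟩ := hz
          rw [Finset.mem_product]; exact ⟨hf x hx, hg x hx⟩
        · intro z hz _
          rw [Finset.mem_product] at hz
          exact mul_nonneg (hp _ hz.1) (hq _ hz.2)
    _ = _ := by rw [Finset.sum_product, Finset.sum_mul_sum]

theorem wt_add {β : ℝ} {L : ℕ} {η ξ u : Config} (h : EN L η = EN L ξ + EN L u) :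
    wt β L η = wt β L ξ * wt β L u := by
  unfold wt
  rw [← Real.exp_add, h]; push_cast; ring_nf

theorem wt_le {β : ℝ} (hβ : 1 ≤ β) (L : ℕ) (u : Config) : wt β L u ≤ Real.exp (-(EN L u : ℝ)) := by
  unfold wt
  rw [Real.exp_le_exp]
  have : (0 : ℝ) ≤ EN L u := by exact_mod_cast EN_nonneg L u
  nlinarith

theorem QQ_step {ε : ℝ} {r : ℕ} (hr : ∀ (L : ℕ) (v : Site) (𝓕 : Finset (Finset Site)),
    (∀ F ∈ 𝓕, r ≤ (bd L F).card ∧ ∃ (i : ℕ) (T : List Turn), Val T ∧ (bd L F).card = T.length + 2 ∧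
      i < (bd L F).card ∧ (F : Set Site) = dec v i T) →
    ∑ F ∈ 𝓕, Real.exp (-((bd L F).card : ℝ)) ≤ ε) {β : ℝ} (hβ : 1 ≤ β) (L : ℕ) (v : Site)
    (a b : ℤ) (m : ℕ) :
    QQ β L r v a b (m + 1) ≤ ε * QQ β L r v (a - 1) b m := by
  unfold QQ
  set S := (OC L a b).filter (Big r v (m + 1)) with hS
  set fl : Config → Finset Site := fun η => fill L (lev η (m + 1)) v with hfl
  have h0 := sum_pair S (fun η => η - ind (fl η)) fl ((OC L (a - 1) b).filter (Big r v m))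
    (S.image fl) (wt β L) (wt β L) (fun F => Real.exp (-((bd L F).card : ℝ)))
    (fun _ _ => (wt_pos _ _ _).le) (fun _ _ => (Real.exp_pos _).le) ?_ ?_ ?_ ?_
  · refine h0.trans ?_
    rw [mul_comm]
    apply mul_le_mul_of_nonneg_right _ (Finset.sum_nonneg (fun _ _ => (wt_pos _ _ _).le))
    apply hr L v
    intro F hF
    rw [Finset.mem_image] at hF
    obtain ⟨η, hη, rfl⟩ := hF
    rw [hS, Finset.mem_filter] at hη
    obtain ⟨h1, z, hz, hzf⟩ := hη
    have hb := lev_box h1 (m := m + 1) (by omega)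
    refine ⟨fill_card hb hz r hzf, ?_⟩
    exact contour fill_sub (Rch.fill hb ⟨hz.1, .refl⟩) (fill_cF hb) (fill_cE hb)
  · intro η hη
    rw [hS, Finset.mem_filter] at hη
    obtain ⟨h1, z, hz, hzf⟩ := hη
    rw [Finset.mem_filter]
    have h2 := mem_OC.1 h1
    refine ⟨?_, z, ?_, hzf⟩
    · rw [mem_OC]
      constructor
      · intro x hx
        have := h2.1 x hx
        by_cases h : x ∈ fl η <;> simp [ind, h] <;> omega
      · intro x hx
        have : x ∉ fl η := fun h => hx (fill_sub h)
        simp [ind, this, h2.2 x hx]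
    · apply hz.mono
      intro y hy
      have := hy.mem
      unfold lev at this ⊢
      by_cases h : y ∈ fl η <;> simp [ind, h] <;> push_cast at this <;> omega
  · intro η hη
    exact Finset.mem_image_of_mem _ hη
  · intro x _ y _ h1 h2
    rw [h2] at h1
    simpa using h1
  · intro η hη
    rw [hS, Finset.mem_filter] at hη
    obtain ⟨h1, z, hz, hzf⟩ := hη
    have hb := lev_box h1 (m := m + 1) (by omega)
    have hE : EN L η = EN L (η - ind (fl η)) + EN L (ind (fl η)) := by
      apply EN_add
      intro e _
      have had : SiteAdj e.1 (e.1 + dl e.2) := (adj_iff _ _).2 ⟨e.2, .inl rfl⟩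
      by_cases h3 : e.1 ∈ fl η <;> by_cases h4 : e.1 + dl e.2 ∈ fl η
      · simp [ind, h3, h4]
      · have := fill_bdry hb had h3 h4
        unfold lev at this
        obtain ⟨t1, t2⟩ := this
        simp only [ind, Pi.sub_apply, h3, h4, if_true, if_false]
        rw [abs_of_nonneg (by omega), abs_of_nonneg (by omega)]; simp; ring
      · have := fill_bdry hb (adj_symm had) h4 h3
        unfold lev at this
        obtain ⟨t1, t2⟩ := this
        simp only [ind, Pi.sub_apply, h3, h4, if_true, if_false]
        rw [abs_of_nonpos (by omega), abs_of_nonpos (by omega)]; simp; ring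
      · simp [ind, h3, h4]
    rw [wt_add hE]
    apply mul_le_mul_of_nonneg_left _ (wt_pos _ _ _).le
    have := wt_le hβ L (ind (fl η))
    rw [EN_ind] at this
    exact_mod_cast this

theorem QQ_iter {ε : ℝ} (hε : 0 ≤ ε) {r : ℕ} (hr : ∀ (L : ℕ) (v : Site) (𝓕 : Finset (Finset Site)),
    (∀ F ∈ 𝓕, r ≤ (bd L F).card ∧ ∃ (i : ℕ) (T : List Turn), Val T ∧ (bd L F).card = T.length + 2 ∧
      i < (bd L F).card ∧ (F : Set Site) = dec v i T) →
    ∑ F ∈ 𝓕, Real.exp (-((bd L F).card : ℝ)) ≤ ε) {β : ℝ} (hβ : 1 ≤ β) (L : ℕ) (v : Site)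
    (b : ℤ) (m : ℕ) : ∀ a : ℤ, QQ β L r v a b m ≤ ε ^ m * ZZ β L (a - m) b := by
  induction m with
  | zero => intro a; simpa using QQ_le β L r v a b 0
  | succ k ih =>
    intro a
    refine (QQ_step hr hβ L v a b k).trans ?_
    have := mul_le_mul_of_nonneg_left (ih (a - 1)) hε
    refine this.trans (le_of_eq ?_)
    have e : a - 1 - (k : ℤ) = a - ((k + 1 : ℕ) : ℤ) := by push_cast; ring
    rw [e]; ring

def Dn (r : ℕ) (v : Site) : Finset Site :=
  Finset.Icc (v.1 - r) (v.1 + r) ×ˢ Finset.Icc (v.2 - r) (v.2 + r)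

theorem mem_Dn {r : ℕ} {v z : Site} : z ∈ Dn r v ↔ ¬ Far r v z := by
  unfold Dn Far
  rw [Finset.mem_product, Finset.mem_Icc, Finset.mem_Icc]; omega

theorem Dn_card (r : ℕ) (v : Site) : (Dn r v).card = (2 * r + 1) ^ 2 := by
  unfold Dn
  rw [Finset.card_product, Int.card_Icc, Int.card_Icc, sq]
  congr 1 <;> omega

theorem Usum (r : ℕ) : ∃ C : ℝ, 0 < C ∧ ∀ (L : ℕ) (v : Site) (s : ℕ) (U : Finset Config),
    (∀ u ∈ U, (∀ x, x ∉ box L → u x = 0) ∧ (∀ x, x ∉ Dn r v → u x = 0) ∧ (∀ x, 0 ≤ u x) ∧ (s : ℤ) ≤ u v) →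
    ∑ u ∈ U, Real.exp (-(EN L u : ℝ)) ≤ C * Real.exp (-(3 * s)) := by
  set n : ℕ := (2 * r + 1) ^ 2 with hn
  have hn0 : (0 : ℝ) < n := by rw [hn]; positivity
  set ρ : ℝ := Real.exp (-(1 / n)) with hρ
  have hρ0 : 0 ≤ ρ := (Real.exp_pos _).le
  have hρ1 : ρ < 1 := by rw [hρ, Real.exp_lt_one_iff]; simp; exact_mod_cast hn0
  refine ⟨((1 - ρ)⁻¹) ^ n, by have : 0 < 1 - ρ := by linarith
                              positivity, ?_⟩
  intro L v s U hU
  have pt : ∀ u ∈ U, Real.exp (-(EN L u : ℝ)) ≤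
      Real.exp (-(3 * s)) * ∏ x : {x // x ∈ Dn r v}, ρ ^ (u x).toNat := by
    intro u hu
    obtain ⟨h1, h2, h3, h4⟩ := hU u hu
    have hprod : ∏ x : {x // x ∈ Dn r v}, ρ ^ (u x).toNat =
        Real.exp (-(1 / n) * ∑ x ∈ Dn r v, (u x : ℝ)) := by
      rw [Finset.mul_sum, Real.exp_sum, ← Finset.prod_coe_sort (Dn r v)]
      apply Finset.prod_congr rfl
      intro x _
      rw [hρ, ← Real.exp_nat_mul]
      congr 1
      have : (((u x).toNat : ℤ) : ℝ) = (u x : ℝ) := by rw [Int.toNat_of_nonneg (h3 x)]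
      have e : (((u x).toNat : ℕ) : ℝ) = (u x : ℝ) := by exact_mod_cast this
      rw [e]; ring
    rw [hprod, ← Real.exp_add, Real.exp_le_exp]
    have hE : ∀ x, 4 * (u x : ℝ) ≤ EN L u := by
      intro x
      have := EN_ge h1 x
      rw [abs_of_nonneg (h3 x)] at this
      exact_mod_cast this
    have hs : ∑ x ∈ Dn r v, (u x : ℝ) ≤ n * ((EN L u : ℝ) / 4) := by
      have := Finset.sum_le_card_nsmul (Dn r v) (fun x => (u x : ℝ)) ((EN L u : ℝ) / 4)
        (fun x _ => by have := hE x; linarith)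
      rw [Dn_card, nsmul_eq_mul] at this
      exact this
    have hv := hE v
    have h4' : (s : ℝ) ≤ u v := by exact_mod_cast h4
    have : (1 / (n : ℝ)) * ∑ x ∈ Dn r v, (u x : ℝ) ≤ (EN L u : ℝ) / 4 := by
      rw [one_div, inv_mul_le_iff₀ hn0]; exact hs
    linarith
  refine (Finset.sum_le_sum pt).trans ?_
  rw [← Finset.mul_sum, mul_comm]
  apply mul_le_mul_of_nonneg_right _ (Real.exp_pos _).le
  -- bound of the product sums
  obtain ⟨B, hB⟩ : ∃ B : ℕ, ∀ u ∈ U, ∀ x ∈ Dn r v, (u x).toNat < B := by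
    refine ⟨(U.sup fun u => (Dn r v).sup fun x => (u x).toNat) + 1, ?_⟩
    intro u hu x hx
    have a1 := Finset.le_sup (f := fun x => (u x).toNat) hx
    have a2 := Finset.le_sup (f := fun u : Config => (Dn r v).sup fun x => (u x).toNat) hu
    omega
  calc ∑ u ∈ U, ∏ x : {x // x ∈ Dn r v}, ρ ^ (u x).toNat
      = ∑ g ∈ U.image (fun u => fun x : {x // x ∈ Dn r v} => (u x).toNat), ∏ x, ρ ^ (g x) := by
        rw [Finset.sum_image]
        intro u hu u' hu' h
        funext x
        by_cases hx : x ∈ Dn r v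
        · have := congrFun h ⟨x, hx⟩
          simp only at this
          have a1 := (hU u hu).2.2.1 x
          have a2 := (hU u' hu').2.2.1 x
          omega
        · rw [(hU u hu).2.1 x hx, (hU u' hu').2.1 x hx]
    _ ≤ ∑ g ∈ Fintype.piFinset (fun _ : {x // x ∈ Dn r v} => Finset.range B), ∏ x, ρ ^ (g x) := by
        apply Finset.sum_le_sum_of_subset_of_nonneg
        · intro g hg
          rw [Finset.mem_image] at hg
          obtain ⟨u, hu, rfl⟩ := hg
          rw [Fintype.mem_piFinset]
          intro x
          rw [Finset.mem_range]
          exact hB u hu x x.2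
        · intro g _ _
          exact Finset.prod_nonneg (fun _ _ => pow_nonneg hρ0 _)
    _ = ∏ x : {x // x ∈ Dn r v}, ∑ i ∈ Finset.range B, ρ ^ i := by
        rw [Finset.prod_univ_sum]
    _ ≤ ((1 - ρ)⁻¹) ^ n := by
        rw [Finset.prod_const, Finset.card_univ, Fintype.card_coe, Dn_card]
        apply pow_le_pow_left₀ (Finset.sum_nonneg (fun _ _ => pow_nonneg hρ0 _))
        rw [← tsum_geometric_of_lt_one hρ0 hρ1]
        exact (summable_geometric_of_lt_one hρ0 hρ1).sum_le_tsum _ (fun _ _ => pow_nonneg hρ0 _)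

theorem short_step {r : ℕ} {C0 : ℝ} (hU : ∀ (L : ℕ) (v : Site) (s : ℕ) (U : Finset Config),
    (∀ u ∈ U, (∀ x, x ∉ box L → u x = 0) ∧ (∀ x, x ∉ Dn r v → u x = 0) ∧ (∀ x, 0 ≤ u x) ∧ (s : ℤ) ≤ u v) →
    ∑ u ∈ U, Real.exp (-(EN L u : ℝ)) ≤ C0 * Real.exp (-(3 * s)))
    {β : ℝ} (hβ : 1 ≤ β) (L : ℕ) (v : Site) (a b : ℤ) (ha : a ≤ 0) (M i : ℕ) (hi : i < M) :
    ∑ η ∈ (OC L a b).filter (fun η => (M : ℤ) ≤ η v ∧ ¬ Big r v (i + 1) η ∧ (i = 0 ∨ Big r v i η)), wt β L η ≤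
    (∑ ξ ∈ (OC L a b).filter (fun η => i = 0 ∨ Big r v i η), wt β L ξ) *
      (C0 * Real.exp (-(3 * ((M - i : ℕ) : ℝ)))) := by
  set S := (OC L a b).filter (fun η => (M : ℤ) ≤ η v ∧ ¬ Big r v (i + 1) η ∧ (i = 0 ∨ Big r v i η)) with hS
  set tr : Config → Config := fun η x => if Rch (lev η (i + 1)) v x then (i : ℤ) else η x with htr
  have hlow : ∀ η x, Rch (lev η (i + 1)) v x → (i : ℤ) + 1 ≤ η x := by
    intro η x h
    have := h.mem
    unfold lev at this; push_cast at this; exact this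
  have h0 := sum_pair S tr (fun η => η - tr η) ((OC L a b).filter (fun η => i = 0 ∨ Big r v i η))
    (S.image (fun η => η - tr η)) (wt β L) (wt β L) (fun u => Real.exp (-(EN L u : ℝ)))
    (fun _ _ => (wt_pos _ _ _).le) (fun _ _ => (Real.exp_pos _).le) ?_ ?_ ?_ ?_
  · refine h0.trans ?_
    apply mul_le_mul_of_nonneg_left _ (Finset.sum_nonneg (fun _ _ => (wt_pos _ _ _).le))
    apply hU L v
    intro u hu
    rw [Finset.mem_image] at hu
    obtain ⟨η, hη, rfl⟩ := hu
    rw [hS, Finset.mem_filter] at hη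
    obtain ⟨h1, h2, h3, h4⟩ := hη
    have hb := lev_box h1 (m := i + 1) (by omega)
    refine ⟨?_, ?_, ?_, ?_⟩
    · intro x hx
      have : ¬ Rch (lev η (i + 1)) v x := fun h => hx (hb x h.mem)
      simp [htr, this]
    · intro x hx
      rw [mem_Dn, not_not] at hx
      have : ¬ Rch (lev η (i + 1)) v x := fun h => h3 ⟨x, h, hx⟩
      simp [htr, this]
    · intro x
      by_cases h : Rch (lev η (i + 1)) v x
      · have := hlow η x h
        simp [htr, h]; omega
      · simp [htr, h]
    · have : Rch (lev η (i + 1)) v v := by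
        refine ⟨?_, .refl⟩
        unfold lev; push_cast; omega
      simp [htr, this]; omega
  · intro η hη
    rw [hS, Finset.mem_filter] at hη
    obtain ⟨h1, h2, h3, h4⟩ := hη
    have hb := lev_box h1 (m := i + 1) (by omega)
    rw [Finset.mem_filter]
    have h5 := mem_OC.1 h1
    constructor
    · rw [mem_OC]
      constructor
      · intro x hx
        have a1 := h5.1 x hx
        by_cases h : Rch (lev η (i + 1)) v x
        · have := hlow η x h
          simp [htr, h]; omega
        · simp [htr, h]; omega
      · intro x hx
        have : ¬ Rch (lev η (i + 1)) v x := fun h => hx (hb x h.mem)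
        simp [htr, this, h5.2 x hx]
    · rcases h4 with h4 | ⟨z, hz, hzf⟩
      · exact .inl h4
      · right
        refine ⟨z, hz.mono ?_, hzf⟩
        intro y hy
        have := hy.mem
        unfold lev at this ⊢
        by_cases h : Rch (lev η (i + 1)) v y
        · simp [htr, h]
        · simpa [htr, h] using this
  · intro η hη
    exact Finset.mem_image_of_mem _ hη
  · intro x _ y _ h1 h2
    rw [h1] at h2
    simpa using h2
  · intro η hη
    have hE : EN L η = EN L (tr η) + EN L (η - tr η) := by
      apply EN_add
      intro e _
      have had : SiteAdj e.1 (e.1 + dl e.2) := (adj_iff _ _).2 ⟨e.2, .inl rfl⟩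
      by_cases h3 : Rch (lev η (i + 1)) v e.1 <;> by_cases h4 : Rch (lev η (i + 1)) v (e.1 + dl e.2)
      · simp [htr, h3, h4]
      · have t1 := hlow η _ h3
        have t2 : η (e.1 + dl e.2) ≤ i := by
          by_contra hh
          apply h4
          apply h3.step had
          unfold lev; push_cast; omega
        simp only [htr, Pi.sub_apply, h3, h4, if_true, if_false]
        rw [abs_of_nonneg (by omega), abs_of_nonneg (by omega), abs_of_nonneg (by omega)]; ring
      · have t1 := hlow η _ h4
        have t2 : η e.1 ≤ i := by
          by_contra hh
          apply h3
          apply h4.step (adj_symm had)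
          unfold lev; push_cast; omega
        simp only [htr, Pi.sub_apply, h3, h4, if_true, if_false]
        rw [abs_of_nonpos (by omega), abs_of_nonpos (by omega), abs_of_nonpos (by omega)]; ring
      · simp [htr, h3, h4]
    rw [wt_add hE]
    exact mul_le_mul_of_nonneg_left (wt_le hβ L _) (wt_pos _ _ _).le

theorem sum_biU {ι α : Type*} (s : Finset ι) (t : ι → Finset α) (f : α → ℝ) (hf : ∀ x, 0 ≤ f x) :
    ∑ x ∈ s.biUnion t, f x ≤ ∑ i ∈ s, ∑ x ∈ t i, f x := by
  induction s using Finset.induction_on with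
  | empty => simp
  | insert i s hi ih =>
    rw [Finset.biUnion_insert, Finset.sum_insert hi]
    have h1 := Finset.sum_union_inter (s₁ := t i) (s₂ := s.biUnion t) (f := f)
    have h2 : 0 ≤ ∑ x ∈ t i ∩ s.biUnion t, f x := Finset.sum_nonneg (fun x _ => hf x)
    linarith

theorem up_tail : ∃ C : ℝ, 0 < C ∧ ∀ (β : ℝ), 1 ≤ β → ∀ (L : ℕ) (v : Site) (a b : ℤ), a ≤ 0 → ∀ M : ℕ, 1 ≤ M →
    ∑ η ∈ (OC L a b).filter (fun η => (M : ℤ) ≤ η v), wt β L η ≤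
      C * (M + 1) * Real.exp (-(3 * M)) * ZZ β L (a - M) b := by
  obtain ⟨r, hr⟩ := tau_small (Real.exp (-3)) (Real.exp_pos _)
  obtain ⟨C0, hC0, hU⟩ := Usum r
  refine ⟨1 + C0, by linarith, ?_⟩
  intro β hβ L v a b ha M hM1
  set ε := Real.exp (-3) with hε
  have hpow : ∀ m : ℕ, ε ^ m = Real.exp (-(3 * m)) := by
    intro m; rw [hε, ← Real.exp_nat_mul]; ring_nf
  have hQ := fun m => QQ_iter (Real.exp_pos _).le hr hβ L v b m a
  have cover : (OC L a b).filter (fun η => (M : ℤ) ≤ η v) ⊆ ((OC L a b).filter (Big r v M)) ∪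
      (Finset.range M).biUnion (fun i => (OC L a b).filter
        (fun η => (M : ℤ) ≤ η v ∧ ¬ Big r v (i + 1) η ∧ (i = 0 ∨ Big r v i η))) := by
    intro η hη
    rw [Finset.mem_filter] at hη
    rw [Finset.mem_union, Finset.mem_filter, Finset.mem_biUnion]
    by_cases hB : Big r v M η
    · exact .inl ⟨hη.1, hB⟩
    · right
      have hex : ∃ i, ¬ Big r v (i + 1) η := ⟨M - 1, by rwa [Nat.sub_add_cancel (by omega)]⟩
      refine ⟨Nat.find hex, ?_, ?_⟩
      · rw [Finset.mem_range]
        have := Nat.find_min' hex (m := M - 1) (by rwa [Nat.sub_add_cancel (by omega)])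
        omega
      · rw [Finset.mem_filter]
        refine ⟨hη.1, hη.2, Nat.find_spec hex, ?_⟩
        by_cases h0 : Nat.find hex = 0
        · exact .inl h0
        · right
          have := Nat.find_min hex (m := Nat.find hex - 1) (by omega)
          rwa [not_not, Nat.sub_add_cancel (by omega)] at this
  have hZ : 0 ≤ ZZ β L (a - M) b := Finset.sum_nonneg (fun _ _ => (wt_pos _ _ _).le)
  have hW : ∀ i ∈ Finset.range M, ∑ η ∈ (OC L a b).filter
        (fun η => (M : ℤ) ≤ η v ∧ ¬ Big r v (i + 1) η ∧ (i = 0 ∨ Big r v i η)), wt β L η ≤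
        C0 * Real.exp (-(3 * M)) * ZZ β L (a - M) b := by
    intro i hi
    rw [Finset.mem_range] at hi
    refine (short_step hU hβ L v a b ha M i hi).trans ?_
    have h1 : ∑ ξ ∈ (OC L a b).filter (fun η => i = 0 ∨ Big r v i η), wt β L ξ ≤
        ε ^ i * ZZ β L (a - M) b := by
      have hm : ZZ β L (a - i) b ≤ ZZ β L (a - M) b := ZZ_mono β (by omega) le_rfl
      by_cases h0 : i = 0
      · subst h0
        simp only [true_or, Finset.filter_true, pow_zero, one_mul]
        simpa [ZZ] using hm
      · simp only [h0, false_or]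
        exact (hQ i).trans (mul_le_mul_of_nonneg_left hm (pow_nonneg (Real.exp_pos _).le _))
    have h2 : ε ^ i * Real.exp (-(3 * ((M - i : ℕ) : ℝ))) = Real.exp (-(3 * M)) := by
      rw [hpow, ← Real.exp_add, Nat.cast_sub hi.le]; ring_nf
    calc _ ≤ (ε ^ i * ZZ β L (a - M) b) * (C0 * Real.exp (-(3 * ((M - i : ℕ) : ℝ)))) :=
          mul_le_mul_of_nonneg_right h1 (by positivity)
      _ = C0 * (ε ^ i * Real.exp (-(3 * ((M - i : ℕ) : ℝ)))) * ZZ β L (a - M) b := by ring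
      _ = _ := by rw [h2]
  calc _ ≤ ∑ η ∈ ((OC L a b).filter (Big r v M)) ∪
      (Finset.range M).biUnion (fun i => (OC L a b).filter
        (fun η => (M : ℤ) ≤ η v ∧ ¬ Big r v (i + 1) η ∧ (i = 0 ∨ Big r v i η))), wt β L η :=
        Finset.sum_le_sum_of_subset_of_nonneg cover (fun _ _ _ => (wt_pos _ _ _).le)
    _ ≤ ∑ η ∈ ((OC L a b).filter (Big r v M)), wt β L η + ∑ η ∈
      (Finset.range M).biUnion (fun i => (OC L a b).filter
        (fun η => (M : ℤ) ≤ η v ∧ ¬ Big r v (i + 1) η ∧ (i = 0 ∨ Big r v i η))), wt β L η := by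
        rw [← Finset.sum_union_inter]
        have : 0 ≤ ∑ η ∈ ((OC L a b).filter (Big r v M)) ∩
      (Finset.range M).biUnion (fun i => (OC L a b).filter
        (fun η => (M : ℤ) ≤ η v ∧ ¬ Big r v (i + 1) η ∧ (i = 0 ∨ Big r v i η))), wt β L η :=
          Finset.sum_nonneg (fun _ _ => (wt_pos _ _ _).le)
        linarith
    _ ≤ ε ^ M * ZZ β L (a - M) b + ∑ i ∈ Finset.range M, C0 * Real.exp (-(3 * M)) * ZZ β L (a - M) b := by
        apply add_le_add (hQ M)
        refine le_trans ?_ (Finset.sum_le_sum hW)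
        refine sum_biU _ _ _ (fun η => (wt_pos _ _ η).le)
    _ ≤ _ := by
        rw [Finset.sum_const, Finset.card_range, nsmul_eq_mul, hpow]
        have hp : 0 ≤ Real.exp (-(3 * M)) * ZZ β L (a - M) b := mul_nonneg (Real.exp_pos _).le hZ
        have hM : (0 : ℝ) ≤ M := Nat.cast_nonneg _
        nlinarith [mul_nonneg hM hp, mul_nonneg hC0.le hp]

theorem EN_neg (L : ℕ) (η : Config) : EN L (-η) = EN L η := by
  unfold EN
  apply Finset.sum_congr rfl
  intro e _
  rw [Pi.neg_apply, Pi.neg_apply, ← abs_neg]; congr 1; ring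

theorem neg_OC {L : ℕ} {a b : ℤ} {η : Config} (h : η ∈ OC L a b) : -η ∈ OC L (-b) (-a) := by
  rw [mem_OC] at h ⊢
  refine ⟨fun x hx => ?_, fun x hx => ?_⟩
  · have := h.1 x hx; rw [Pi.neg_apply]; omega
  · rw [Pi.neg_apply, h.2 x hx]; rfl

theorem neg_sum (β : ℝ) (L : ℕ) (a b : ℤ) (p : Config → Prop) :
    ∑ η ∈ (OC L a b).filter p, wt β L η = ∑ η ∈ (OC L (-b) (-a)).filter (fun η => p (-η)), wt β L η := by
  apply Finset.sum_bij (fun η _ => -η)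
  · intro η hη
    rw [Finset.mem_filter] at hη ⊢
    exact ⟨neg_OC hη.1, by rw [neg_neg]; exact hη.2⟩
  · intro x _ y _ h; exact neg_injective h
  · intro η hη
    rw [Finset.mem_filter] at hη
    refine ⟨-η, ?_, neg_neg _⟩
    rw [Finset.mem_filter]
    refine ⟨?_, hη.2⟩
    have := neg_OC hη.1
    simpa using this
  · intro η _
    unfold wt; rw [EN_neg]

theorem ZZ_neg (β : ℝ) (L : ℕ) (a b : ℤ) : ZZ β L a b = ZZ β L (-b) (-a) := by
  have := neg_sum β L a b (fun _ => True)
  simpa [ZZ] using this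

theorem pig (β : ℝ) (hβ : 0 ≤ β) (L M N : ℕ) : ∃ R : ℕ, N ≤ R ∧
    ZZ β L (-(R : ℤ) - 1 - M) (R + M) ≤ 2 * ZZ β L (-(R : ℤ) - 1) R := by
  by_contra! hcon
  have h1 : ∀ t : ℕ, (2 : ℝ) ^ t ≤ ZZ β L (-((N + t * M : ℕ) : ℤ) - 1) ((N + t * M : ℕ) : ℤ) := by
    intro t
    induction t with
    | zero => simpa using ZZ_ge_one β L (a := -(N : ℤ) - 1) (b := N) (by omega) (by omega)
    | succ k ih =>
      have := hcon (N + k * M) (by omega)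
      have e1 : -((N + k * M : ℕ) : ℤ) - 1 - M = -((N + (k + 1) * M : ℕ) : ℤ) - 1 := by push_cast; ring
      have e2 : ((N + k * M : ℕ) : ℤ) + M = ((N + (k + 1) * M : ℕ) : ℤ) := by push_cast; ring
      rw [e1, e2] at this
      rw [pow_succ]; linarith
  set n := (box L).card with hn
  have h2 : ∀ t : ℕ, 1 ≤ t → (2 : ℝ) ^ t ≤ ((2 * N + 2 * M + 2 : ℝ)) ^ n * (t : ℝ) ^ n := by
    intro t ht
    refine (h1 t).trans ?_
    have h := ZZ_le β hβ L (2 * (N + t * M) + 1) (-((N + t * M : ℕ) : ℤ) - 1)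
    have e : -((N + t * M : ℕ) : ℤ) - 1 + ((2 * (N + t * M) + 1 : ℕ) : ℤ) = ((N + t * M : ℕ) : ℤ) := by
      push_cast; ring
    rw [e] at h
    refine h.trans ?_
    rw [← mul_pow]
    apply pow_le_pow_left₀ (by positivity)
    push_cast
    have h1t : (1 : ℝ) ≤ t := by exact_mod_cast ht
    have hN : (0 : ℝ) ≤ N := Nat.cast_nonneg _
    nlinarith [mul_nonneg hN (sub_nonneg.2 h1t)]
  have lim := tendsto_pow_const_div_const_pow_of_one_lt n (r := (2 : ℝ)) (by norm_num)
  have hc : (0 : ℝ) < (2 * N + 2 * M + 2 : ℝ) ^ n := by positivity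
  have ev := (lim.eventually (gt_mem_nhds (inv_pos.2 hc))).and (eventually_ge_atTop 1)
  obtain ⟨t, ht1, ht2⟩ := ev.exists
  have h3 := h2 t ht2
  rw [div_lt_iff₀ (by positivity), inv_mul_eq_div, lt_div_iff₀ hc] at ht1
  linarith

theorem tails : ∃ C : ℝ, 0 < C ∧ ∀ (β : ℝ), 1 ≤ β → ∀ (L M N : ℕ), 1 ≤ M → ∃ R : ℕ, N ≤ R ∧
    ∀ v : Site, ∑ η ∈ (OC L (-(R : ℤ) - 1) R).filter (fun η => ¬ (-(M : ℤ) - 1 ≤ η v ∧ η v ≤ (M : ℤ))), wt β L η ≤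
      C * (M + 1) * Real.exp (-(3 * M)) * ZZ β L (-(R : ℤ) - 1) R := by
  obtain ⟨C, hC, hup⟩ := up_tail
  refine ⟨4 * C, by linarith, ?_⟩
  intro β hβ L M N hM
  obtain ⟨R, hR, hZ⟩ := pig β (by linarith) L M N
  refine ⟨R, hR, ?_⟩
  intro v
  have u1 := hup β hβ L v (-(R : ℤ) - 1) R (by omega) M hM
  have u2 := hup β hβ L v (-(R : ℤ)) (-(-(R : ℤ) - 1)) (by omega) M hM
  have e := neg_sum β L (-(R : ℤ) - 1) R (fun η => η v ≤ -M)
  have e2 : ∀ η : Config, (-η) v ≤ -(M : ℤ) ↔ (M : ℤ) ≤ η v := by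
    intro η; rw [Pi.neg_apply]; omega
  simp only [e2] at e
  have u2 : ∑ η ∈ (OC L (-(R : ℤ) - 1) R).filter (fun η => η v ≤ -(M : ℤ)), wt β L η ≤
      C * (M + 1) * Real.exp (-(3 * M)) * ZZ β L (-(R : ℤ) - M) (-(-(R : ℤ) - 1)) := by
    refine le_trans (le_of_eq ?_) u2
    convert e
  have z1 : ZZ β L (-(R : ℤ) - 1 - M) R ≤ 2 * ZZ β L (-(R : ℤ) - 1) R :=
    (ZZ_mono β le_rfl (by omega)).trans hZ
  have z2 : ZZ β L (-(R : ℤ) - M) (-(-(R : ℤ) - 1)) ≤ 2 * ZZ β L (-(R : ℤ) - 1) R := by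
    rw [ZZ_neg, neg_neg]
    refine (ZZ_mono β ?_ ?_).trans hZ <;> omega
  set c := C * (M + 1) * Real.exp (-(3 * M)) with hc
  have hc0 : 0 ≤ c := by positivity
  have hsub : (OC L (-(R : ℤ) - 1) R).filter (fun η => ¬ (-(M : ℤ) - 1 ≤ η v ∧ η v ≤ (M : ℤ))) ⊆
      (OC L (-(R : ℤ) - 1) R).filter (fun η => (M : ℤ) ≤ η v) ∪
      (OC L (-(R : ℤ) - 1) R).filter (fun η => η v ≤ -M) := by
    intro η
    simp only [Finset.mem_union, Finset.mem_filter]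
    rintro ⟨h1, h2⟩
    by_cases h : (M : ℤ) ≤ η v
    · exact .inl ⟨h1, h⟩
    · exact .inr ⟨h1, by omega⟩
  have h1 := Finset.sum_le_sum_of_subset_of_nonneg (f := wt β L) hsub (fun _ _ _ => (wt_pos _ _ _).le)
  have h2 := Finset.sum_union_inter (s₁ := (OC L (-(R : ℤ) - 1) R).filter (fun η => (M : ℤ) ≤ η v))
    (s₂ := (OC L (-(R : ℤ) - 1) R).filter (fun η => η v ≤ -M)) (f := wt β L)
  have h3 : 0 ≤ ∑ η ∈ (OC L (-(R : ℤ) - 1) R).filter (fun η => (M : ℤ) ≤ η v) ∩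
    (OC L (-(R : ℤ) - 1) R).filter (fun η => η v ≤ -M), wt β L η :=
    Finset.sum_nonneg (fun _ _ => (wt_pos _ _ _).le)
  have m1 := mul_le_mul_of_nonneg_left z1 hc0
  have m2 := mul_le_mul_of_nonneg_left z2 hc0
  have : 4 * C * (M + 1) * Real.exp (-(3 * M)) = 4 * c := by rw [hc]; ring
  rw [this]
  linarith

section
variable {Γ ι : Type} [CommGroup Γ] [Fintype Γ] (E : Finset ι) (χ : ι → Γ →* ℝ)

theorem char_nonneg (f : Γ →* ℝ) : 0 ≤ ∑ g, f g := by
  rw [sum_hom_units]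
  split_ifs <;> positivity

def Zis (J : ι → ℝ) : ℝ := ∑ g : Γ, Real.exp (∑ e ∈ E, J e * χ e g)

theorem Zis_nonneg (J : ι → ℝ) : 0 ≤ Zis E χ J := Finset.sum_nonneg (fun _ _ => (Real.exp_pos _).le)

theorem Zis_expand (hχ : ∀ e g, χ e g = 1 ∨ χ e g = -1) (J : ι → ℝ) :
    Zis E χ J = ∑ T ∈ E.powerset, (∏ e ∈ T, Real.sinh (J e)) * (∏ e ∈ E \ T, Real.cosh (J e)) *
      ∑ g, (∏ e ∈ T, χ e) g := by
  unfold Zis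
  have h1 : ∀ g, Real.exp (∑ e ∈ E, J e * χ e g) =
      ∑ T ∈ E.powerset, (∏ e ∈ T, Real.sinh (J e)) * (∏ e ∈ E \ T, Real.cosh (J e)) * (∏ e ∈ T, χ e) g := by
    intro g
    rw [Real.exp_sum]
    have h2 : ∀ e ∈ E, Real.exp (J e * χ e g) = Real.sinh (J e) * χ e g + Real.cosh (J e) := by
      intro e _
      rcases hχ e g with h | h
      · rw [h, mul_one, mul_one, Real.sinh_add_cosh]
      · rw [h]
        have := Real.cosh_sub_sinh (J e)
        rw [mul_neg_one, ← this]; ring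
    rw [Finset.prod_congr rfl h2, Finset.prod_add]
    apply Finset.sum_congr rfl
    intro T _
    rw [Finset.prod_mul_distrib, MonoidHom.finsetProd_apply]; ring
  simp only [h1]
  rw [Finset.sum_comm]
  apply Finset.sum_congr rfl
  intro T _
  rw [Finset.mul_sum]

theorem Zis_mono (hχ : ∀ e g, χ e g = 1 ∨ χ e g = -1) {K J : ι → ℝ} (h : ∀ e ∈ E, |K e| ≤ J e) :
    Zis E χ K ≤ Zis E χ J := by
  rw [Zis_expand E χ hχ, Zis_expand E χ hχ]
  apply Finset.sum_le_sum
  intro T hT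
  rw [Finset.mem_powerset] at hT
  apply mul_le_mul_of_nonneg_right _ (char_nonneg _)
  have s1 : ∏ e ∈ T, Real.sinh (K e) ≤ ∏ e ∈ T, Real.sinh (J e) := by
    refine (le_abs_self _).trans ?_
    rw [Finset.abs_prod]
    apply Finset.prod_le_prod (fun _ _ => abs_nonneg _)
    intro e he
    rw [Real.abs_sinh]
    exact Real.sinh_le_sinh.2 (h e (hT he))
  have s2 : ∏ e ∈ E \ T, Real.cosh (K e) ≤ ∏ e ∈ E \ T, Real.cosh (J e) := by
    apply Finset.prod_le_prod (fun _ _ => (Real.cosh_pos _).le)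
    intro e he
    rw [Real.cosh_le_cosh]
    exact (h e (Finset.mem_sdiff.1 he).1).trans (le_abs_self _)
  apply mul_le_mul s1 s2 (Finset.prod_nonneg (fun _ _ => (Real.cosh_pos _).le))
  apply Finset.prod_nonneg
  intro e he
  rw [← Real.sinh_zero]
  exact Real.sinh_le_sinh.2 ((abs_nonneg _).trans (h e (hT he)))

theorem Zis_mul (J₁ J₂ : ι → ℝ) : Zis E χ J₁ * Zis E χ J₂ =
    ∑ h : Γ, Zis E χ (fun e => J₁ e + χ e h * J₂ e) := by
  unfold Zis
  rw [Finset.sum_mul_sum]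
  rw [Finset.sum_comm (s := (Finset.univ : Finset Γ)) (t := (Finset.univ : Finset Γ))
    (f := fun h g => Real.exp (∑ e ∈ E, (J₁ e + χ e h * J₂ e) * χ e g))]
  apply Finset.sum_congr rfl
  intro g _
  symm
  apply Fintype.sum_equiv (Equiv.mulLeft g)
  intro h
  rw [← Real.exp_add, ← Finset.sum_add_distrib]
  congr 1
  apply Finset.sum_congr rfl
  intro e _
  rw [Equiv.coe_mulLeft, map_mul]; ring

theorem Zis_pair (hχ : ∀ e g, χ e g = 1 ∨ χ e g = -1) {J₁ J₂ A B : ι → ℝ}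
    (h1 : ∀ e ∈ E, |J₁ e + J₂ e| ≤ A e + B e) (h2 : ∀ e ∈ E, |J₁ e - J₂ e| ≤ A e - B e) :
    Zis E χ J₁ * Zis E χ J₂ ≤ Zis E χ A * Zis E χ B := by
  rw [Zis_mul, Zis_mul]
  apply Finset.sum_le_sum
  intro g _
  apply Zis_mono E χ hχ
  intro e he
  rcases hχ e g with h | h
  · rw [h, one_mul, one_mul]; exact h1 e he
  · rw [h, neg_one_mul, neg_one_mul, ← sub_eq_add_neg, ← sub_eq_add_neg]; exact h2 e he
end

section sec12x
open scoped FinsetFamily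

abbrev Spin (L : ℕ) : Type := {x // x ∈ box L} → ℤˣ

def sg {L : ℕ} (x : Site) : Spin L →* ℤˣ where
  toFun g := if h : x ∈ box L then g ⟨x, h⟩ else 1
  map_one' := by split_ifs <;> rfl
  map_mul' := by intro a b; split_ifs <;> simp

def uR : ℤˣ →* ℝ := (Int.castRingHom ℝ).toMonoidHom.comp (Units.coeHom ℤ)

def chi {L : ℕ} (e : Site × Bool) : Spin L →* ℝ := uR.comp (sg e.1 * sg (e.1 + dl e.2))

theorem chi_pm {L : ℕ} (e : Site × Bool) (g : Spin L) : chi e g = 1 ∨ chi e g = -1 := by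
  unfold chi uR
  rcases Int.units_eq_one_or (sg e.1 g) with h | h <;>
  rcases Int.units_eq_one_or (sg (e.1 + dl e.2) g) with h' | h' <;> simp [h, h']

def rcn {L : ℕ} (φ : Config) (g : Spin L) : Config := fun x => if sg x g = 1 then φ x else -1 - φ x

theorem rcn_abs {L : ℕ} {φ : Config} (hφ : ∀ x, 0 ≤ φ x) (g : Spin L) (e : Site × Bool) :
    ((|rcn φ g e.1 - rcn φ g (e.1 + dl e.2)| : ℤ) : ℝ) =
     ((max (φ e.1) (φ (e.1 + dl e.2)) : ℤ) + 1 / 2) -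
      chi e g * ((min (φ e.1) (φ (e.1 + dl e.2)) : ℤ) + 1 / 2) := by
  have h1 := hφ e.1
  have h2 := hφ (e.1 + dl e.2)
  have hmm := max_sub_min_eq_abs (φ e.1) (φ (e.1 + dl e.2))
  have hma := max_add_min (φ e.1) (φ (e.1 + dl e.2))
  unfold rcn
  rcases Int.units_eq_one_or (sg e.1 g) with ha | ha <;>
  rcases Int.units_eq_one_or (sg (e.1 + dl e.2) g) with hb | hb
  · have hc : chi e g = 1 := by simp [chi, uR, ha, hb]
    rw [hc, ha, hb, if_pos rfl, if_pos rfl]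
    have : |φ e.1 - φ (e.1 + dl e.2)| = max (φ e.1) (φ (e.1 + dl e.2)) - min (φ e.1) (φ (e.1 + dl e.2)) := by
      rw [max_sub_min_eq_abs, abs_sub_comm]
    rw [this]; push_cast; ring
  · have hc : chi e g = -1 := by simp [chi, uR, ha, hb]
    rw [hc, ha, hb, if_pos rfl, if_neg (by decide)]
    have : |φ e.1 - (-1 - φ (e.1 + dl e.2))| =
        max (φ e.1) (φ (e.1 + dl e.2)) + min (φ e.1) (φ (e.1 + dl e.2)) + 1 := by
      rw [hma, abs_of_nonneg (by omega)]; ring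
    rw [this]; push_cast; ring
  · have hc : chi e g = -1 := by simp [chi, uR, ha, hb]
    rw [hc, ha, hb, if_pos rfl, if_neg (by decide)]
    have : |-1 - φ e.1 - φ (e.1 + dl e.2)| =
        max (φ e.1) (φ (e.1 + dl e.2)) + min (φ e.1) (φ (e.1 + dl e.2)) + 1 := by
      rw [hma, abs_of_nonpos (by omega)]; ring
    rw [this]; push_cast; ring
  · have hc : chi e g = 1 := by simp [chi, uR, ha, hb]
    rw [hc, ha, hb, if_neg (by decide)]
    rw [if_neg (by decide)]
    have : |-1 - φ e.1 - (-1 - φ (e.1 + dl e.2))| = max (φ e.1) (φ (e.1 + dl e.2)) - min (φ e.1) (φ (e.1 + dl e.2)) := by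
      rw [max_sub_min_eq_abs]; congr 1; ring
    rw [this]; push_cast; ring

def GG (β : ℝ) (L : ℕ) (φ : Config) : ℝ := ∑ g : Spin L, wt β L (rcn φ g)

def mxE (L : ℕ) (φ : Config) : ℝ := ∑ e ∈ EB L, (((max (φ e.1) (φ (e.1 + dl e.2)) : ℤ) : ℝ) + 1 / 2)

def JJ (β : ℝ) (φ : Config) (e : Site × Bool) : ℝ := β * (((min (φ e.1) (φ (e.1 + dl e.2)) : ℤ) : ℝ) + 1 / 2)

theorem GG_eq (β : ℝ) (L : ℕ) {φ : Config} (hφ : ∀ x, 0 ≤ φ x) :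
    GG β L φ = Real.exp (-(β * mxE L φ)) * Zis (Γ := Spin L) (EB L) chi (JJ β φ) := by
  unfold GG Zis
  rw [Finset.mul_sum]
  apply Finset.sum_congr rfl
  intro g _
  rw [← Real.exp_add]
  unfold wt EN mxE JJ
  congr 1
  push_cast
  rw [Finset.mul_sum, Finset.mul_sum, ← Finset.sum_neg_distrib, ← Finset.sum_neg_distrib, ← Finset.sum_add_distrib]
  apply Finset.sum_congr rfl
  intro e _
  have := rcn_abs hφ g e
  push_cast at this
  rw [this]; ring

theorem GG_lat0 (β : ℝ) (hβ : 0 ≤ β) (L : ℕ) {φ ψ : Config} (hφ : ∀ x, 0 ≤ φ x) (hψ : ∀ x, 0 ≤ ψ x) :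
    GG β L φ * GG β L ψ ≤ GG β L (φ ⊓ ψ) * GG β L (φ ⊔ ψ) := by
  rw [GG_eq β L hφ, GG_eq β L hψ, GG_eq β L (φ := φ ⊓ ψ) (fun x => le_inf (hφ x) (hψ x)),
    GG_eq β L (φ := φ ⊔ ψ) (fun x => (hφ x).trans le_sup_left)]
  have h1 : mxE L (φ ⊓ ψ) + mxE L (φ ⊔ ψ) ≤ mxE L φ + mxE L ψ := by
    unfold mxE
    rw [← Finset.sum_add_distrib, ← Finset.sum_add_distrib]
    apply Finset.sum_le_sum
    intro e _
    have : max ((φ ⊓ ψ) e.1) ((φ ⊓ ψ) (e.1 + dl e.2)) + max ((φ ⊔ ψ) e.1) ((φ ⊔ ψ) (e.1 + dl e.2)) ≤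
      max (φ e.1) (φ (e.1 + dl e.2)) + max (ψ e.1) (ψ (e.1 + dl e.2)) := by
      simp only [Pi.inf_apply, Pi.sup_apply]
      omega
    have h2 : (((max ((φ ⊓ ψ) e.1) ((φ ⊓ ψ) (e.1 + dl e.2)) : ℤ) : ℝ)) +
      ((max ((φ ⊔ ψ) e.1) ((φ ⊔ ψ) (e.1 + dl e.2)) : ℤ) : ℝ) ≤
      ((max (φ e.1) (φ (e.1 + dl e.2)) : ℤ) : ℝ) + ((max (ψ e.1) (ψ (e.1 + dl e.2)) : ℤ) : ℝ) := by
      exact_mod_cast this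
    linarith
  have h2 : Zis (Γ := Spin L) (EB L) chi (JJ β φ) * Zis (Γ := Spin L) (EB L) chi (JJ β ψ) ≤
      Zis (Γ := Spin L) (EB L) chi (JJ β (φ ⊔ ψ)) * Zis (Γ := Spin L) (EB L) chi (JJ β (φ ⊓ ψ)) := by
    apply Zis_pair _ _ chi_pm
    · intro e _
      have a1 := hφ e.1
      have a2 := hφ (e.1 + dl e.2)
      have a3 := hψ e.1
      have a4 := hψ (e.1 + dl e.2)
      have b1 : 0 ≤ min (φ e.1) (φ (e.1 + dl e.2)) := by omega
      have b2 : 0 ≤ min (ψ e.1) (ψ (e.1 + dl e.2)) := by omega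
      have b1' : (0 : ℝ) ≤ ((min (φ e.1) (φ (e.1 + dl e.2)) : ℤ) : ℝ) := by exact_mod_cast b1
      have b2' : (0 : ℝ) ≤ ((min (ψ e.1) (ψ (e.1 + dl e.2)) : ℤ) : ℝ) := by exact_mod_cast b2
      have c : min (φ e.1) (φ (e.1 + dl e.2)) + min (ψ e.1) (ψ (e.1 + dl e.2)) ≤
         min ((φ ⊔ ψ) e.1) ((φ ⊔ ψ) (e.1 + dl e.2)) + min ((φ ⊓ ψ) e.1) ((φ ⊓ ψ) (e.1 + dl e.2)) := by
        simp only [Pi.inf_apply, Pi.sup_apply]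
        omega
      have c' : ((min (φ e.1) (φ (e.1 + dl e.2)) : ℤ) : ℝ) + ((min (ψ e.1) (ψ (e.1 + dl e.2)) : ℤ) : ℝ) ≤
         ((min ((φ ⊔ ψ) e.1) ((φ ⊔ ψ) (e.1 + dl e.2)) : ℤ) : ℝ) +
         ((min ((φ ⊓ ψ) e.1) ((φ ⊓ ψ) (e.1 + dl e.2)) : ℤ) : ℝ) := by exact_mod_cast c
      unfold JJ
      rw [abs_of_nonneg (by positivity), ← mul_add, ← mul_add]
      apply mul_le_mul_of_nonneg_left _ hβ
      linarith
    · intro e _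
      have c : |min (φ e.1) (φ (e.1 + dl e.2)) - min (ψ e.1) (ψ (e.1 + dl e.2))| ≤
         min ((φ ⊔ ψ) e.1) ((φ ⊔ ψ) (e.1 + dl e.2)) - min ((φ ⊓ ψ) e.1) ((φ ⊓ ψ) (e.1 + dl e.2)) := by
        simp only [Pi.inf_apply, Pi.sup_apply]
        rw [abs_le]
        omega
      have c' : |((min (φ e.1) (φ (e.1 + dl e.2)) : ℤ) : ℝ) - ((min (ψ e.1) (ψ (e.1 + dl e.2)) : ℤ) : ℝ)| ≤
         ((min ((φ ⊔ ψ) e.1) ((φ ⊔ ψ) (e.1 + dl e.2)) : ℤ) : ℝ) -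
         ((min ((φ ⊓ ψ) e.1) ((φ ⊓ ψ) (e.1 + dl e.2)) : ℤ) : ℝ) := by exact_mod_cast c
      unfold JJ
      rw [← mul_sub, ← mul_sub, abs_mul, abs_of_nonneg hβ]
      apply mul_le_mul_of_nonneg_left _ hβ
      rw [add_sub_add_right_eq_sub, add_sub_add_right_eq_sub]
      exact c'
  have h3 : Real.exp (-(β * mxE L φ)) * Real.exp (-(β * mxE L ψ)) ≤
      Real.exp (-(β * mxE L (φ ⊓ ψ))) * Real.exp (-(β * mxE L (φ ⊔ ψ))) := by
    rw [← Real.exp_add, ← Real.exp_add, Real.exp_le_exp]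
    nlinarith
  have h4 := mul_le_mul h3 h2 (mul_nonneg (Zis_nonneg _ _ _) (Zis_nonneg _ _ _))
    (mul_nonneg (Real.exp_pos _).le (Real.exp_pos _).le)
  nlinarith [h4]

theorem GG_nonneg (β : ℝ) (L : ℕ) (φ : Config) : 0 ≤ GG β L φ :=
  Finset.sum_nonneg (fun _ _ => (wt_pos _ _ _).le)

theorem GG_lat (β : ℝ) (hβ : 0 ≤ β) (L : ℕ) (φ ψ : Config) :
    GG β L (φ ⊔ 0) * GG β L (ψ ⊔ 0) ≤ GG β L ((φ ⊓ ψ) ⊔ 0) * GG β L ((φ ⊔ ψ) ⊔ 0) := by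
  rw [sup_inf_right, sup_sup_distrib_right]
  exact GG_lat0 β hβ L (fun x => le_sup_right) (fun x => le_sup_right)

def YY (β : ℝ) (L : ℕ) (hi : Config) : ℝ := ∑ η ∈ Om L (fun x => -1 - hi x) hi, wt β L η

theorem YY_eq (β : ℝ) (L : ℕ) (hi : Config) : YY β L hi = ∑ φ ∈ Om L 0 hi, GG β L (φ ⊔ 0) := by
  unfold YY GG
  rw [← Finset.sum_product']
  symm
  have pos : ∀ φ ∈ Om L 0 hi, φ ⊔ 0 = φ := by
    intro φ h
    rw [sup_eq_left]
    intro x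
    rw [mem_Om] at h
    by_cases hx : x ∈ box L
    · exact (h.1 x hx).1
    · rw [h.2 x hx]; rfl
  refine Finset.sum_bij' (fun p _ => rcn p.1 p.2)
    (fun η _ => ((fun x => if x ∈ box L then max (η x) (-1 - η x) else 0),
      (fun x => if 0 ≤ η x then 1 else -1))) ?_ ?_ ?_ ?_ ?_
  · rintro ⟨φ, g⟩ hp
    rw [Finset.mem_product] at hp
    have h := mem_Om.1 (show φ ∈ _ from hp.1)
    rw [mem_Om]
    constructor
    · intro x hx
      have := h.1 x hx
      simp only [Pi.zero_apply] at this
      unfold rcn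
      simp only
      split_ifs <;> omega
    · intro x hx
      unfold rcn sg
      simp [hx, h.2 x hx]
  · intro η hη
    rw [mem_Om] at hη
    rw [Finset.mem_product]
    refine ⟨?_, Finset.mem_univ _⟩
    rw [mem_Om]
    constructor
    · intro x hx
      have := hη.1 x hx
      simp only [hx, if_true, Pi.zero_apply]
      omega
    · intro x hx
      simp [hx]
  · rintro ⟨φ, g⟩ hp
    rw [Finset.mem_product] at hp
    have h := mem_Om.1 (show φ ∈ _ from hp.1)
    ext x
    · by_cases hx : x ∈ box L
      · have := (h.1 x hx).1
        simp only [Pi.zero_apply] at this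
        simp only [hx, if_true]
        unfold rcn
        split_ifs <;> omega
      · simp [hx, h.2 x hx]
    · have := (h.1 x x.2).1
      simp only [Pi.zero_apply] at this
      have hs : sg (x : Site) g = g x := by simp [sg]
      unfold rcn
      simp only [hs]
      rcases Int.units_eq_one_or (g x) with h1 | h1
      · simp [h1, this]
      · have h2 : ¬ (φ x ≤ -1) := by omega
        simp [h1, h2]
  · intro η hη
    rw [mem_Om] at hη
    funext x
    by_cases hx : x ∈ box L
    · by_cases h0 : 0 ≤ η x
      · simp [rcn, sg, hx, h0]; omega
      · simp [rcn, sg, hx, h0]; omega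
    · simp [rcn, sg, hx, hη.2 x hx]
  · rintro ⟨φ, g⟩ hp
    rw [Finset.mem_product] at hp
    simp only
    rw [pos φ hp.1]

theorem YY_lat (β : ℝ) (hβ : 0 ≤ β) (L : ℕ) (h₁ h₂ h₃ h₄ : Config) (ha : ∀ x ∈ box L, min (h₁ x) (h₂ x) ≤ h₃ x)
    (hb : ∀ x ∈ box L, max (h₁ x) (h₂ x) ≤ h₄ x) :
    YY β L h₁ * YY β L h₂ ≤ YY β L h₃ * YY β L h₄ := by
  simp only [YY_eq]
  have h := four_functions_theorem (fun φ => GG β L (φ ⊔ 0)) (fun φ => GG β L (φ ⊔ 0))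
    (fun φ => GG β L (φ ⊔ 0)) (fun φ => GG β L (φ ⊔ 0)) (fun _ => GG_nonneg _ _ _) (fun _ => GG_nonneg _ _ _)
    (fun _ => GG_nonneg _ _ _) (fun _ => GG_nonneg _ _ _) (GG_lat β hβ L) (Om L 0 h₁) (Om L 0 h₂)
  refine h.trans ?_
  apply mul_le_mul
  · apply Finset.sum_le_sum_of_subset_of_nonneg _ (fun _ _ _ => GG_nonneg _ _ _)
    intro φ hφ
    rw [Finset.mem_infs] at hφ
    obtain ⟨a, h1, b, h2, rfl⟩ := hφ
    rw [mem_Om] at h1 h2 ⊢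
    refine ⟨fun x hx => ?_, fun x hx => by rw [Pi.inf_apply, h1.2 x hx, h2.2 x hx]; rfl⟩
    have a1 := h1.1 x hx
    have a2 := h2.1 x hx
    have a3 := ha x hx
    rw [Pi.inf_apply]
    simp only [Pi.zero_apply] at *
    omega
  · apply Finset.sum_le_sum_of_subset_of_nonneg _ (fun _ _ _ => GG_nonneg _ _ _)
    intro φ hφ
    rw [Finset.mem_sups] at hφ
    obtain ⟨a, h1, b, h2, rfl⟩ := hφ
    rw [mem_Om] at h1 h2 ⊢
    refine ⟨fun x hx => ?_, fun x hx => by rw [Pi.sup_apply, h1.2 x hx, h2.2 x hx]; rfl⟩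
    have a1 := h1.1 x hx
    have a2 := h2.1 x hx
    have a3 := hb x hx
    rw [Pi.sup_apply]
    simp only [Pi.zero_apply] at *
    omega
  · exact Finset.sum_nonneg (fun _ _ => GG_nonneg _ _ _)
  · exact Finset.sum_nonneg (fun _ _ => GG_nonneg _ _ _)

end sec12x

section sec13x
open scoped FinsetFamily

def hiS (M R : ℕ) (S : Finset Site) : Config := fun x => if x ∈ S then (M : ℤ) else R

theorem YY_const (β : ℝ) (L R : ℕ) : YY β L (fun _ => (R : ℤ)) = ZZ β L (-(R : ℤ) - 1) R := by
  unfold YY ZZ OC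
  have : (-1 - (R : ℤ)) = -(R : ℤ) - 1 := by ring
  simp only [this]

theorem squeeze {β : ℝ} (hβ : 0 ≤ β) {L M R : ℕ} (hMR : M ≤ R) {p : ℝ} (hp : p ≤ 1)
    (h : ∀ v : Site, ∑ η ∈ (OC L (-(R : ℤ) - 1) R).filter
      (fun η => ¬ (-(M : ℤ) - 1 ≤ η v ∧ η v ≤ (M : ℤ))), wt β L η ≤ p * ZZ β L (-(R : ℤ) - 1) R) :
    (1 - p) ^ (box L).card * ZZ β L (-(R : ℤ) - 1) R ≤ ZZ β L (-(M : ℤ) - 1) M := by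
  have hZ : 0 < ZZ β L (-(R : ℤ) - 1) R :=
    lt_of_lt_of_le one_pos (ZZ_ge_one β L (by omega) (by omega))
  have h0 : YY β L (hiS M R ∅) = ZZ β L (-(R : ℤ) - 1) R := by
    rw [← YY_const]; congr 1
  have h1 : ∀ v ∈ box L, (1 - p) * ZZ β L (-(R : ℤ) - 1) R ≤ YY β L (hiS M R {v}) := by
    intro v hv
    have e := Finset.sum_filter_add_sum_filter_not (OC L (-(R : ℤ) - 1) R)
      (fun η => (-(M : ℤ) - 1 ≤ η v ∧ η v ≤ (M : ℤ))) (wt β L)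
    have e2 : ∑ η ∈ (OC L (-(R : ℤ) - 1) R).filter
      (fun η => (-(M : ℤ) - 1 ≤ η v ∧ η v ≤ (M : ℤ))), wt β L η ≤ YY β L (hiS M R {v}) := by
      unfold YY
      apply Finset.sum_le_sum_of_subset_of_nonneg _ (fun _ _ _ => (wt_pos _ _ _).le)
      intro η hη
      rw [Finset.mem_filter, mem_OC] at hη
      rw [mem_Om]
      refine ⟨fun x hx => ?_, hη.1.2⟩
      have := hη.1.1 x hx
      unfold hiS
      by_cases hxv : x = v
      · subst hxv; simp only [Finset.mem_singleton, if_true]; omega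
      · simp only [Finset.mem_singleton, hxv, if_false]; omega
    have e3 := h v
    have e4 : ZZ β L (-(R : ℤ) - 1) R = ∑ η ∈ OC L (-(R : ℤ) - 1) R, wt β L η := rfl
    rw [← e4] at e
    linarith
  have key : ∀ S ⊆ box L, (1 - p) ^ S.card * ZZ β L (-(R : ℤ) - 1) R ≤ YY β L (hiS M R S) := by
    intro S
    induction S using Finset.induction_on with
    | empty => intro _; rw [h0]; simp
    | insert v S hv ih =>
      intro hS
      rw [Finset.insert_subset_iff] at hS
      have l := YY_lat β hβ L (hiS M R S) (hiS M R {v}) (hiS M R (insert v S)) (hiS M R ∅) ?_ ?_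
      · rw [h0] at l
        have i1 := ih hS.2
        have i2 := h1 v hS.1
        rw [Finset.card_insert_of_notMem hv, pow_succ]
        have hpp : 0 ≤ (1 - p) ^ S.card := pow_nonneg (by linarith) _
        have : ((1 - p) ^ S.card * ZZ β L (-(R : ℤ) - 1) R) * ((1 - p) * ZZ β L (-(R : ℤ) - 1) R) ≤
            YY β L (hiS M R S) * YY β L (hiS M R {v}) :=
          mul_le_mul i1 i2 (mul_nonneg (by linarith) hZ.le) (le_trans (mul_nonneg hpp hZ.le) i1)
        have := this.trans l
        rw [← mul_assoc] at this
        have := le_of_mul_le_mul_right this hZ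
        linarith
      · intro x _
        unfold hiS
        by_cases a : x = v <;> by_cases b : x ∈ S <;> simp [a, b]
      · intro x _
        unfold hiS
        have : (M : ℤ) ≤ R := by exact_mod_cast hMR
        simp only [Finset.notMem_empty, if_false]
        split_ifs <;> simp [this]
  have := key (box L) (Finset.Subset.refl _)
  refine this.trans ?_
  rw [← YY_const]
  unfold YY
  apply Finset.sum_le_sum_of_subset_of_nonneg _ (fun _ _ _ => (wt_pos _ _ _).le)
  intro η hη
  rw [mem_Om] at hη ⊢
  refine ⟨fun x hx => ?_, hη.2⟩
  have := hη.1 x hx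
  simpa [hiS, hx] using this

/-! Log-concavity -/

def tz (L : ℕ) (φ : Config) : Config := fun x => if x ∈ box L then φ x else 0

theorem wt_lat (β : ℝ) (hβ : 0 ≤ β) (L : ℕ) (φ ψ : Config) :
    wt β L (tz L φ) * wt β L (tz L ψ - ind (box L)) ≤
      wt β L (tz L (φ ⊓ ψ)) * wt β L (tz L (φ ⊔ ψ) - ind (box L)) := by
  unfold wt
  rw [← Real.exp_add, ← Real.exp_add, Real.exp_le_exp]
  have h : EN L (tz L (φ ⊓ ψ)) + EN L (tz L (φ ⊔ ψ) - ind (box L)) ≤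
      EN L (tz L φ) + EN L (tz L ψ - ind (box L)) := by
    unfold EN
    rw [← Finset.sum_add_distrib, ← Finset.sum_add_distrib]
    apply Finset.sum_le_sum
    intro e _
    by_cases h1 : e.1 ∈ box L <;> by_cases h2 : e.1 + dl e.2 ∈ box L <;>
      simp only [tz, ind, Pi.sub_apply, Pi.inf_apply, Pi.sup_apply, h1, h2, if_true, if_false]
    · generalize φ e.1 = a
      generalize φ (e.1 + dl e.2) = b
      generalize ψ e.1 = c
      generalize ψ (e.1 + dl e.2) = d
      rw [sub_sub_sub_cancel_right, sub_sub_sub_cancel_right]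
      simp only [abs_eq_max_neg]; omega
    · simp only [abs_eq_max_neg]; omega
    · simp only [abs_eq_max_neg]; omega
    · simp
  have h' : (EN L (tz L (φ ⊓ ψ)) : ℝ) + EN L (tz L (φ ⊔ ψ) - ind (box L)) ≤
      EN L (tz L φ) + EN L (tz L ψ - ind (box L)) := by exact_mod_cast h
  nlinarith

theorem tz_id {L : ℕ} {a b : ℤ} {η : Config} (h : η ∈ OC L a b) : tz L η = η := by
  funext x
  rw [mem_OC] at h
  unfold tz
  split_ifs with hx
  · rfl
  · exact (h.2 x hx).symm

theorem shift_sum (β : ℝ) (L : ℕ) (a b : ℤ) :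
    ∑ ψ ∈ OC L (a + 1) (b + 1), wt β L (tz L ψ - ind (box L)) = ZZ β L a b := by
  unfold ZZ
  refine Finset.sum_bij' (fun ψ _ => ψ - ind (box L)) (fun η _ => η + ind (box L)) ?_ ?_ ?_ ?_ ?_
  · intro ψ h
    rw [mem_OC] at h ⊢
    refine ⟨fun x hx => ?_, fun x hx => ?_⟩
    · have := h.1 x hx
      simp [ind, hx]; omega
    · simp [ind, hx, h.2 x hx]
  · intro ψ h
    rw [mem_OC] at h ⊢
    refine ⟨fun x hx => ?_, fun x hx => ?_⟩
    · have := h.1 x hx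
      simp [ind, hx]; omega
    · simp [ind, hx, h.2 x hx]
  · intro ψ _; simp
  · intro ψ _; simp
  · intro ψ h
    rw [tz_id h]

theorem logconc (β : ℝ) (hβ : 0 ≤ β) (L : ℕ) (j : ℤ) :
    ZZ β L 0 (j + 2) * ZZ β L 0 j ≤ ZZ β L 0 (j + 1) * ZZ β L 0 (j + 1) := by
  have h := four_functions_theorem (fun φ => wt β L (tz L φ)) (fun φ => wt β L (tz L φ - ind (box L)))
    (fun φ => wt β L (tz L φ)) (fun φ => wt β L (tz L φ - ind (box L)))
    (fun _ => (wt_pos _ _ _).le) (fun _ => (wt_pos _ _ _).le)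
    (fun _ => (wt_pos _ _ _).le) (fun _ => (wt_pos _ _ _).le) (wt_lat β hβ L) (OC L 0 (j + 2)) (OC L (0 + 1) (j + 1))
  rw [shift_sum] at h
  have e : ∀ b, ∑ φ ∈ OC L 0 b, wt β L (tz L φ) = ZZ β L 0 b := by
    intro b
    unfold ZZ
    exact Finset.sum_congr rfl (fun η hη => by rw [tz_id hη])
  rw [e] at h
  refine h.trans ?_
  apply mul_le_mul
  · rw [← e]
    apply Finset.sum_le_sum_of_subset_of_nonneg _ (fun _ _ _ => (wt_pos _ _ _).le)
    intro φ hφ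
    rw [Finset.mem_infs] at hφ
    obtain ⟨a, h1, b, h2, rfl⟩ := hφ
    rw [mem_OC] at h1 h2 ⊢
    refine ⟨fun x hx => ?_, fun x hx => by rw [Pi.inf_apply, h1.2 x hx, h2.2 x hx]; rfl⟩
    have a1 := h1.1 x hx
    have a2 := h2.1 x hx
    rw [Pi.inf_apply]
    omega
  · rw [← shift_sum]
    apply Finset.sum_le_sum_of_subset_of_nonneg _ (fun _ _ _ => (wt_pos _ _ _).le)
    intro φ hφ
    rw [Finset.mem_sups] at hφ
    obtain ⟨a, h1, b, h2, rfl⟩ := hφ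
    rw [mem_OC] at h1 h2 ⊢
    refine ⟨fun x hx => ?_, fun x hx => by rw [Pi.sup_apply, h1.2 x hx, h2.2 x hx]; rfl⟩
    have a1 := h1.1 x hx
    have a2 := h2.1 x hx
    rw [Pi.sup_apply]
    omega
  · exact Finset.sum_nonneg (fun _ _ => (wt_pos _ _ _).le)
  · exact Finset.sum_nonneg (fun _ _ => (wt_pos _ _ _).le)

theorem bd_box (L : ℕ) : (bd L (box L)).card ≤ 4 * L := by
  have hs : bd L (box L) ⊆ ((({0, (L : ℤ)} : Finset ℤ) ×ˢ Finset.Icc 1 (L : ℤ)) ×ˢ {true}) ∪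
      ((Finset.Icc 1 (L : ℤ) ×ˢ ({0, (L : ℤ)} : Finset ℤ)) ×ˢ {false}) := by
    rintro ⟨⟨x, y⟩, b⟩ h
    rw [mem_bd (Finset.Subset.refl _)] at h
    unfold BdE at h
    rw [mem_box, mem_box] at h
    rw [Finset.mem_union]
    cases b
    · right
      simp [dl] at h
      simp
      omega
    · left
      simp [dl] at h
      simp
      omega
  refine (Finset.card_le_card hs).trans ((Finset.card_union_le _ _).trans ?_)
  rw [Finset.card_product, Finset.card_product, Finset.card_product, Finset.card_product,
    Finset.card_singleton, Finset.card_singleton, Int.card_Icc]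
  have := Finset.card_le_two (a := (0 : ℤ)) (b := (L : ℤ))
  have e : ((L : ℤ) + 1 - 1).toNat = L := by omega
  rw [e]
  nlinarith

theorem EN_tri (L : ℕ) (η ξ : Config) : EN L (η + ξ) ≤ EN L η + EN L ξ := by
  unfold EN
  rw [← Finset.sum_add_distrib]
  apply Finset.sum_le_sum
  intro e _
  have : (η + ξ) e.1 - (η + ξ) (e.1 + dl e.2) = (η e.1 - η (e.1 + dl e.2)) + (ξ e.1 - ξ (e.1 + dl e.2)) := by
    simp only [Pi.add_apply]; ring
  rw [this]; exact abs_add_le _ _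

theorem EN_lift (L : ℕ) (η : Config) : EN L (η + ind (box L)) ≤ EN L η + 4 * L := by
  have h1 := EN_tri L η (ind (box L))
  rw [EN_ind] at h1
  have := bd_box L
  omega

theorem shift_one (β : ℝ) (hβ : 0 ≤ β) (L : ℕ) (a b : ℤ) :
    ZZ β L a b ≤ Real.exp (4 * β * L) * ZZ β L (a + 1) (b + 1) := by
  rw [← shift_sum]
  conv_rhs => rw [ZZ, Finset.mul_sum]
  apply Finset.sum_le_sum
  intro ψ h
  rw [tz_id h]
  unfold wt
  rw [← Real.exp_add, Real.exp_le_exp]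
  have := EN_lift L (ψ - ind (box L))
  rw [sub_add_cancel] at this
  have h' : (EN L ψ : ℝ) ≤ EN L (ψ - ind (box L)) + 4 * L := by exact_mod_cast this
  nlinarith

theorem shift_many (β : ℝ) (hβ : 0 ≤ β) (L : ℕ) (a b : ℤ) (n : ℕ) :
    ZZ β L a b ≤ Real.exp (4 * β * L * n) * ZZ β L (a + n) (b + n) := by
  induction n with
  | zero => simp
  | succ k ih =>
    refine ih.trans ?_
    have := shift_one β hβ L (a + k) (b + k)
    have h2 := mul_le_mul_of_nonneg_left this (Real.exp_pos (4 * β * L * k)).le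
    refine h2.trans (le_of_eq ?_)
    rw [← mul_assoc, ← Real.exp_add]
    push_cast
    congr 2 <;> ring

end sec13x

theorem box_card (L : ℕ) : (box L).card = L ^ 2 := by
  unfold box
  rw [Finset.Icc_prod_def, Finset.card_product]
  simp [pow_two]

theorem ratio_pow (a : ℕ → ℝ) (ha : ∀ j, 0 < a j)
    (hl : ∀ j, a (j + 2) * a j ≤ a (j + 1) * a (j + 1)) (m d : ℕ) :
    a (m + d + 1) ^ d * a m ≤ a (m + d) ^ d * a (m + d) := by
  have hr : ∀ j, a (j + 2) / a (j + 1) ≤ a (j + 1) / a j := by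
    intro j
    rw [div_le_div_iff₀ (ha _) (ha _)]; exact hl j
  have hanti : Antitone (fun j => a (j + 1) / a j) := antitone_nat_of_succ_le hr
  have key : ∀ e, e ≤ d → (a (m + d + 1) / a (m + d)) ^ e * a m ≤ a (m + e) := by
    intro e
    induction e with
    | zero => intro _; simp
    | succ e ih =>
      intro he
      have i := ih (by omega)
      have h1 : a (m + d + 1) / a (m + d) ≤ a (m + e + 1) / a (m + e) := hanti (by omega : m + e ≤ m + d)
      have hp : 0 ≤ a (m + d + 1) / a (m + d) := (div_pos (ha _) (ha _)).le
      calc _ = (a (m + d + 1) / a (m + d)) * ((a (m + d + 1) / a (m + d)) ^ e * a m) := by ring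
        _ ≤ (a (m + e + 1) / a (m + e)) * a (m + e) :=
          mul_le_mul h1 i (mul_nonneg (pow_nonneg hp _) (ha _).le) (hp.trans h1)
        _ = _ := by rw [div_mul_cancel₀ _ (ha _).ne']; rfl
  have := key d le_rfl
  rw [div_pow, div_mul_eq_mul_div, div_le_iff₀ (pow_pos (ha _) _)] at this
  linarith

theorem M_facts {l : ℝ} (hl : 10 ≤ l) : ∃ M : ℕ, 1 ≤ M ∧ (M : ℝ) ≤ 2 / 5 * l ∧ 2 / 5 * l ≤ M + 1 := by
  refine ⟨⌊2 / 5 * l⌋₊, ?_, Nat.floor_le (by linarith), (Nat.lt_floor_add_one _).le⟩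
  rw [Nat.one_le_floor_iff]; linarith

theorem p_bound {l : ℝ} {M : ℕ} (h : 2 / 5 * l ≤ M + 1) :
    ((M : ℝ) + 1) * Real.exp (-(3 * M)) ≤ 2 * Real.exp (5 / 2) * Real.exp (-l) := by
  have h1 : (M : ℝ) / 2 + 1 ≤ Real.exp (M / 2) := Real.add_one_le_exp _
  have h2 : (M : ℝ) + 1 ≤ 2 * Real.exp (M / 2) := by
    have : (0 : ℝ) ≤ M := Nat.cast_nonneg _
    linarith
  calc ((M : ℝ) + 1) * Real.exp (-(3 * M)) ≤ 2 * Real.exp (M / 2) * Real.exp (-(3 * M)) := by gcongr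
    _ = 2 * Real.exp (M / 2 + -(3 * M)) := by rw [Real.exp_add]; ring
    _ ≤ 2 * Real.exp (5 / 2 + -l) :=
        mul_le_mul_of_nonneg_left (Real.exp_le_exp.2 (by linarith)) (by norm_num)
    _ = _ := by rw [Real.exp_add]; ring

theorem one_sub_ge {p : ℝ} (h0 : 0 ≤ p) (h1 : p ≤ 1 / 2) : Real.exp (-(2 * p)) ≤ 1 - p := by
  have := Real.one_sub_le_exp_neg (2 * p)
  rw [Real.exp_neg, inv_le_comm₀ (Real.exp_pos _) (by linarith)]
  refine le_trans ?_ (Real.add_one_le_exp (2 * p))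
  rw [inv_le_iff_one_le_mul₀ (by linarith)]
  nlinarith

theorem expo {C2 β L l d M : ℝ} (hC : 0 ≤ C2) (hβ : 1 ≤ β) (hL : 0 ≤ L) (hl : 10 ≤ l) (hd : l / 10 ≤ d)
    (hM : M ≤ 2 / 5 * l) :
    2 * C2 * L + 4 * β * L * (M + 1) ≤ d * ((20 * C2 + 40) * β * L) := by
  have h1 : 1 ≤ β * d := by nlinarith
  have h2 : C2 * L * 1 ≤ C2 * L * (β * d) := mul_le_mul_of_nonneg_left h1 (mul_nonneg hC hL)
  have h3 : β * L * (M + 1) ≤ β * L * (10 * d) :=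
    mul_le_mul_of_nonneg_left (by linarith) (mul_nonneg (by linarith) hL)
  have h4 : 0 ≤ C2 * L * (β * d) := by nlinarith [mul_nonneg hC hL]
  nlinarith

theorem growth : ∃ C1 : ℝ, 0 < C1 ∧ ∃ L0 : ℕ, ∀ β : ℝ, 1 ≤ β → ∀ L : ℕ, L0 ≤ L → ∀ N : ℕ,
    Real.log L ≤ N → ZZ β L 0 ((N : ℤ) + 1) ≤ Real.exp (C1 * β * L) * ZZ β L 0 N := by
  obtain ⟨C, hC, ht⟩ := tails
  set C2 := 2 * C * Real.exp (5 / 2) with hC2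
  have hC2p : 0 < C2 := by positivity
  refine ⟨20 * C2 + 40, by positivity, ⌈Real.exp 10⌉₊ + ⌈2 * C2⌉₊, ?_⟩
  intro β hβ L hL N hN
  have hL1 : Real.exp 10 ≤ L := (Nat.le_ceil _).trans (by exact_mod_cast (by omega))
  have hL2 : 2 * C2 ≤ L := (Nat.le_ceil _).trans (by exact_mod_cast (by omega))
  have hLp : (0 : ℝ) < L := (Real.exp_pos _).trans_le hL1
  have hl : 10 ≤ Real.log L := (Real.le_log_iff_exp_le hLp).2 hL1
  set l := Real.log L with hldef
  have hel : Real.exp (-l) = 1 / L := by rw [Real.exp_neg, Real.exp_log hLp, one_div]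
  obtain ⟨M, hM1, hM2, hM3⟩ := M_facts hl
  obtain ⟨R, hNR, hR⟩ := ht β hβ L M N hM1
  have hMN : 2 * M + 1 ≤ N := by
    have : ((2 * M + 1 : ℕ) : ℝ) ≤ N := by push_cast; linarith
    exact_mod_cast this
  set p := C * (M + 1) * Real.exp (-(3 * M)) with hp
  have hp0 : 0 ≤ p := by positivity
  have hpL : p ≤ C2 / L := by
    have := p_bound hM3
    rw [hel] at this
    calc p = C * ((M + 1) * Real.exp (-(3 * M))) := by rw [hp]; ring
      _ ≤ C * (2 * Real.exp (5 / 2) * (1 / L)) := by gcongr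
      _ = _ := by rw [hC2]; ring
  have hp1 : p ≤ 1 / 2 := by
    refine hpL.trans ?_
    rw [div_le_iff₀ hLp]; linarith
  have sq := squeeze (β := β) (by linarith) (L := L) (M := M) (R := R) (by omega) (p := p) (by linarith) hR
  rw [box_card] at sq
  have hZR : 0 < ZZ β L (-(R : ℤ) - 1) R :=
    lt_of_lt_of_le one_pos (ZZ_ge_one β L (by omega) (by omega))
  have e1 : Real.exp (-(2 * C2 * L)) ≤ (1 - p) ^ (L ^ 2) := by
    calc Real.exp (-(2 * C2 * L)) ≤ Real.exp (((L ^ 2 : ℕ) : ℝ) * (-(2 * p))) := by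
          gcongr
          rw [le_div_iff₀ hLp] at hpL
          push_cast
          nlinarith
      _ = Real.exp (-(2 * p)) ^ (L ^ 2) := by rw [Real.exp_nat_mul]
      _ ≤ _ := by gcongr; exact one_sub_ge hp0 hp1
  set a : ℕ → ℝ := fun j => ZZ β L 0 j with hadef
  have ha : ∀ j, 0 < a j := fun j => lt_of_lt_of_le one_pos (ZZ_ge_one β L le_rfl (by omega))
  have sh := shift_many β (by linarith) L (-(M : ℤ) - 1) M (M + 1)
  have sh2 : ZZ β L (-(M : ℤ) - 1) M ≤ Real.exp (4 * β * L * (M + 1)) * a (2 * M + 1) := by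
    have e : (-(M : ℤ) - 1 + ((M + 1 : ℕ) : ℤ)) = 0 := by push_cast; ring
    have e' : ((M : ℤ) + ((M + 1 : ℕ) : ℤ)) = ((2 * M + 1 : ℕ) : ℤ) := by push_cast; ring
    rw [e, e'] at sh
    push_cast at sh
    simpa [hadef] using sh
  have hN1 : a N ≤ ZZ β L (-(R : ℤ) - 1) R := ZZ_mono β (by omega) (by omega)
  have main : a N ≤ Real.exp (2 * C2 * L + 4 * β * L * (M + 1)) * a (2 * M + 1) := by
    have h3 : Real.exp (-(2 * C2 * L)) * a N ≤ Real.exp (4 * β * L * (M + 1)) * a (2 * M + 1) :=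
      (mul_le_mul e1 hN1 (ha _).le (pow_nonneg (by linarith) _)).trans (sq.trans sh2)
    rw [Real.exp_neg, inv_mul_le_iff₀ (Real.exp_pos _)] at h3
    rw [Real.exp_add, mul_assoc]; exact h3
  obtain ⟨d, hd⟩ := Nat.exists_eq_add_of_le hMN
  have rp := ratio_pow a ha (fun j => by
    have := logconc β (by linarith) L j
    simpa [hadef] using this) (2 * M + 1) d
  rw [← hd] at rp
  have hdl : l / 10 ≤ d := by
    have : (N : ℝ) = 2 * M + 1 + d := by exact_mod_cast hd
    linarith
  have hd0 : d ≠ 0 := by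
    rintro rfl
    simp at hdl; linarith
  have fin : a (N + 1) ^ d ≤ (Real.exp ((20 * C2 + 40) * β * L) * a N) ^ d := by
    have h4 : a (N + 1) ^ d * a (2 * M + 1) ≤
        (a N ^ d * Real.exp (2 * C2 * L + 4 * β * L * (M + 1))) * a (2 * M + 1) := by
      refine rp.trans ?_
      rw [mul_assoc]
      exact mul_le_mul_of_nonneg_left main (pow_nonneg (ha _).le _)
    have h5 := le_of_mul_le_mul_right h4 (ha _)
    refine h5.trans ?_
    rw [mul_pow, mul_comm, ← Real.exp_nat_mul]
    apply mul_le_mul_of_nonneg_right _ (pow_nonneg (ha _).le _)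
    apply Real.exp_le_exp.2
    exact expo hC2p.le hβ hLp.le (by linarith) hdl hM2
  have := le_of_pow_le_pow_left₀ hd0 (mul_nonneg (Real.exp_pos _).le (ha _).le) fin
  simpa [hadef] using this

theorem bd_le (L : ℕ) (A : Finset Site) : (bd L A).card ≤ 4 * A.card := by
  have hs : bd L A ⊆ (A ×ˢ Finset.univ) ∪
      (A ×ˢ (Finset.univ : Finset Bool)).image (fun e => (e.1 - dl e.2, e.2)) := by
    rintro ⟨x, b⟩ h
    unfold bd at h
    rw [Finset.mem_filter] at h
    have h2 := h.2
    unfold BdE at h2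
    rw [Finset.mem_union, Finset.mem_product, Finset.mem_image]
    by_cases hx : x ∈ A
    · left; simp [hx]
    · right
      refine ⟨(x + dl b, b), ?_, by simp⟩
      rw [Finset.mem_product]
      simp only [Finset.mem_univ, and_true]
      by_contra hc
      simp [hx, hc] at h2
  have h1 := Finset.card_le_card hs
  have h2 := Finset.card_union_le (A ×ˢ (Finset.univ : Finset Bool))
    ((A ×ˢ (Finset.univ : Finset Bool)).image (fun e => (e.1 - dl e.2, e.2)))
  have h3 := Finset.card_image_le (s := (A ×ˢ (Finset.univ : Finset Bool))) (f := (fun e => (e.1 - dl e.2, e.2)))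
  have h4 : (A ×ˢ (Finset.univ : Finset Bool)).card = A.card * 2 := by
    rw [Finset.card_product]; simp
  omega

theorem EN_smul (L : ℕ) (c : ℤ) (η : Config) : EN L (fun x => c * η x) = |c| * EN L η := by
  unfold EN
  rw [Finset.mul_sum]
  apply Finset.sum_congr rfl
  intro e _
  rw [← abs_mul]; congr 1; ring

def lv (L : ℕ) (h : ℤ) (η : Config) : Finset Site := (box L).filter (fun v => η v = h)

def spk (L : ℕ) (z : (_ : Config) × Finset Site) : Config :=
  fun x => if x ∈ z.2 then 0 else (z.1 + ind (box L)) x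

theorem spk_EN (L : ℕ) (h : ℕ) (η : Config) (A : Finset Site) (hA : A ⊆ lv L h η) :
    EN L (spk L ⟨η, A⟩) ≤ EN L η + 4 * L + 4 * (h + 1) * A.card := by
  have e : spk L ⟨η, A⟩ = (η + ind (box L)) + (fun x => (-((h : ℤ) + 1)) * ind A x) := by
    funext x
    unfold spk
    simp only [Pi.add_apply]
    by_cases hx : x ∈ A
    · have := hA hx
      unfold lv at this
      rw [Finset.mem_filter] at this
      simp [hx, ind, this.1, this.2]
    · simp [hx, ind]
  rw [e]
  have h1 := EN_tri L (η + ind (box L)) (fun x => (-((h : ℤ) + 1)) * ind A x)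
  have h2 := EN_lift L η
  rw [EN_smul, EN_ind, abs_neg, abs_of_nonneg (by positivity : (0 : ℤ) ≤ h + 1)] at h1
  have h3 : ((bd L A).card : ℤ) ≤ 4 * A.card := by exact_mod_cast bd_le L A
  have h4 : ((h : ℤ) + 1) * (bd L A).card ≤ (h + 1) * (4 * A.card) :=
    mul_le_mul_of_nonneg_left h3 (by positivity)
  linarith

theorem spike (β : ℝ) (hβ : 0 ≤ β) (L N h : ℕ) :
    ∑ η ∈ OC L 0 N, wt β L η * (1 + Real.exp (-(4 * β * (h + 1)))) ^ (lv L h η).card ≤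
      Real.exp (4 * β * L) * ZZ β L 0 ((N : ℤ) + 1) := by
  set q := Real.exp (-(4 * β * (h + 1))) with hq
  have e1 : ∀ η ∈ OC L 0 N, wt β L η * (1 + q) ^ (lv L h η).card =
      ∑ A ∈ (lv L h η).powerset, wt β L η * q ^ A.card := by
    intro η _
    rw [← Finset.mul_sum, add_comm, ← Finset.sum_pow_mul_eq_add_pow]
    simp
  rw [Finset.sum_congr rfl e1, Finset.sum_sigma']
  have hmem : ∀ z ∈ (OC L 0 N).sigma (fun η => (lv L h η).powerset),
      (z.1 ∈ OC L 0 N ∧ z.2 ⊆ lv L h z.1) := by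
    intro z hz
    rw [Finset.mem_sigma, Finset.mem_powerset] at hz
    exact hz
  have e2 : ∀ z ∈ (OC L 0 N).sigma (fun η => (lv L h η).powerset),
      wt β L z.1 * q ^ z.2.card ≤ Real.exp (4 * β * L) * wt β L (spk L z) := by
    intro z hz
    have := spk_EN L h z.1 z.2 (hmem z hz).2
    have this' : (EN L (spk L z) : ℝ) ≤ EN L z.1 + 4 * L + 4 * (h + 1) * z.2.card := by exact_mod_cast this
    unfold wt
    rw [hq, ← Real.exp_nat_mul, ← Real.exp_add, ← Real.exp_add]
    apply Real.exp_le_exp.2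
    have := mul_le_mul_of_nonneg_left this' hβ
    linarith
  refine (Finset.sum_le_sum e2).trans ?_
  rw [← Finset.mul_sum]
  apply mul_le_mul_of_nonneg_left _ (Real.exp_pos _).le
  have inj : Set.InjOn (spk L) ((OC L 0 N).sigma (fun η => (lv L h η).powerset) : Finset _) := by
    have hA : ∀ z ∈ (OC L 0 N).sigma (fun η => (lv L h η).powerset),
        z.2 = (box L).filter (fun x => spk L z x = 0) := by
      intro z hz
      have hz' := hmem z hz
      rw [mem_OC] at hz'
      ext x
      rw [Finset.mem_filter]
      constructor
      · intro hx
        have := hz'.2 hx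
        unfold lv at this
        rw [Finset.mem_filter] at this
        exact ⟨this.1, by simp [spk, hx]⟩
      · rintro ⟨hx, h0⟩
        by_contra hc
        have := hz'.1.1 x hx
        simp [spk, hc, ind, hx] at h0
        omega
    intro z hz w hw hzw
    have hz' := hmem z hz
    have hw' := hmem w hw
    have a1 := hA z hz
    have a2 := hA w hw
    rw [hzw, ← a2] at a1
    obtain ⟨η, A⟩ := z
    obtain ⟨ξ, B⟩ := w
    simp only at a1 hz' hw'
    subst a1
    have : η = ξ := by
      funext x
      by_cases hx : x ∈ A
      · have u1 := hz'.2 hx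
        have u2 := hw'.2 hx
        unfold lv at u1 u2
        rw [Finset.mem_filter] at u1 u2
        rw [u1.2, u2.2]
      · have := congrFun hzw x
        simpa [spk, hx] using this
    rw [this]
  rw [← Finset.sum_image (f := wt β L) inj]
  unfold ZZ
  apply Finset.sum_le_sum_of_subset_of_nonneg _ (fun _ _ _ => (wt_pos _ _ _).le)
  intro ξ hξ
  rw [Finset.mem_image] at hξ
  obtain ⟨z, hz, rfl⟩ := hξ
  have hz' := hmem z hz
  rw [mem_OC] at hz' ⊢
  refine ⟨fun x hx => ?_, fun x hx => ?_⟩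
  · have := hz'.1.1 x hx
    unfold spk
    split_ifs
    · omega
    · simp [ind, hx]; omega
  · have := hz'.1.2 x hx
    simp [spk, ind, hx, this]

theorem ext_inj (L : ℕ) : Function.Injective (extendC (box L) 0) := by
  intro f g h
  funext x
  have := congrFun h x.1
  simpa [extendC] using this

theorem tsum_OC (L N : ℕ) (F : Config → ℝ)
    (hF : ∀ η : Config, ¬ (∀ x ∈ box L, η x ∈ Set.Icc (0 : ℤ) N) → F η = 0) :
    ∑' g : {x // x ∈ box L} → ℤ, F (extendC (box L) 0 g) = ∑ η ∈ OC L 0 N, F η := by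
  rw [tsum_eq_sum (s := Fintype.piFinset (fun _ : {x // x ∈ box L} => Finset.Icc (0 : ℤ) N))]
  · unfold OC Om
    rw [Finset.sum_image (fun _ _ _ _ h => ext_inj L h)]
  · intro g hg
    apply hF
    intro hc
    apply hg
    rw [Fintype.mem_piFinset]
    intro x
    have := hc x.1 x.2
    rw [Finset.mem_Icc]
    simpa [extendC] using this

theorem gW_eq (β : ℝ) (L N : ℕ) {η : Config} (h : η ∈ OC L 0 N) :
    gWeight β (box L) 0 (Set.Icc 0 (N : ℤ)) (fun _ => 0) η = wt β L η := by
  rw [mem_OC] at h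
  unfold gWeight
  rw [if_pos (fun x hx => ⟨(h.1 x hx).1, (h.1 x hx).2⟩), sosH_eq h.2]
  unfold wt
  congr 1; ring

theorem gProb_eq (β : ℝ) (L N : ℕ) (A : Set Config) :
    gProb β (box L) 0 (Set.Icc 0 (N : ℤ)) (fun _ => 0) A =
      (∑ η ∈ (OC L 0 N).filter (fun η => η ∈ A), wt β L η) / ZZ β L 0 N := by
  unfold gProb
  have hz : ∀ η : Config, ¬ (∀ x ∈ box L, η x ∈ Set.Icc (0 : ℤ) N) →
      gWeight β (box L) 0 (Set.Icc 0 (N : ℤ)) (fun _ => 0) η = 0 := by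
    intro η h
    unfold gWeight
    rw [if_neg h]
  have hz2 : ∀ η : Config, ¬ (∀ x ∈ box L, η x ∈ Set.Icc (0 : ℤ) N) →
      Set.indicator A (gWeight β (box L) 0 (Set.Icc 0 (N : ℤ)) (fun _ => 0)) η = 0 := by
    intro η h
    by_cases hA : η ∈ A
    · rw [Set.indicator_of_mem hA]; exact hz η h
    · rw [Set.indicator_of_notMem hA]
  have n1 : ∑ η ∈ OC L 0 N, Set.indicator A (gWeight β (box L) 0 (Set.Icc 0 (N : ℤ)) (fun _ => 0)) η =
      ∑ η ∈ (OC L 0 N).filter (fun η => η ∈ A), wt β L η := by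
    rw [Finset.sum_filter]
    apply Finset.sum_congr rfl
    intro η h
    by_cases hA : η ∈ A
    · rw [Set.indicator_of_mem hA, if_pos hA]; exact gW_eq β L N h
    · rw [Set.indicator_of_notMem hA, if_neg hA]
  have n2 : ∑ η ∈ OC L 0 N, gWeight β (box L) 0 (Set.Icc 0 (N : ℤ)) (fun _ => 0) η = ZZ β L 0 N :=
    Finset.sum_congr rfl (fun η h => gW_eq β L N h)
  rw [tsum_OC L N _ hz, tsum_OC L N _ hz2, n1, n2]

theorem exp_half {q : ℝ} (h0 : 0 ≤ q) (h1 : q ≤ 1) : Real.exp (q / 2) ≤ 1 + q := by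
  have h := Real.one_sub_le_exp_neg (q / 2)
  have h2 : Real.exp (q / 2) * Real.exp (-(q / 2)) = 1 := by rw [← Real.exp_add]; simp
  have h3 : Real.exp (q / 2) * (1 - q / 2) ≤ 1 := by
    have := mul_le_mul_of_nonneg_left h (Real.exp_pos (q / 2)).le
    linarith
  have h4 : 1 ≤ (1 + q) * (1 - q / 2) := by nlinarith
  exact le_of_mul_le_mul_right (h3.trans h4) (by linarith)

theorem cheb (β : ℝ) (hβ : 0 ≤ β) (L N h : ℕ) (t : ℝ) :
    ∑ η ∈ (OC L 0 N).filter (fun η => t ≤ ((lv L h η).card : ℝ)), wt β L η ≤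
      Real.exp (4 * β * L - Real.exp (-(4 * β * (h + 1))) / 2 * t) * ZZ β L 0 ((N : ℤ) + 1) := by
  set q := Real.exp (-(4 * β * (h + 1))) with hq
  have q0 : 0 < q := Real.exp_pos _
  have q1 : q ≤ 1 := by
    rw [hq]; apply Real.exp_le_one_iff.2
    have : 0 ≤ 4 * β * ((h : ℝ) + 1) := by positivity
    linarith
  have h1 : Real.exp (q / 2 * t) * ∑ η ∈ (OC L 0 N).filter (fun η => t ≤ ((lv L h η).card : ℝ)), wt β L η ≤
      Real.exp (4 * β * L) * ZZ β L 0 ((N : ℤ) + 1) := by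
    refine le_trans ?_ (spike β hβ L N h)
    rw [Finset.mul_sum]
    refine le_trans (Finset.sum_le_sum (g := fun η => wt β L η * (1 + q) ^ (lv L h η).card) ?_)
      (Finset.sum_le_sum_of_subset_of_nonneg (Finset.filter_subset _ _) ?_)
    · intro η hη
      rw [Finset.mem_filter] at hη
      rw [mul_comm]
      apply mul_le_mul_of_nonneg_left _ (wt_pos _ _ _).le
      calc Real.exp (q / 2 * t) ≤ Real.exp ((lv L h η).card * (q / 2)) := by
            apply Real.exp_le_exp.2
            have := mul_le_mul_of_nonneg_left hη.2 (by positivity : 0 ≤ q / 2)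
            linarith
        _ = Real.exp (q / 2) ^ (lv L h η).card := by rw [Real.exp_nat_mul]
        _ ≤ _ := pow_le_pow_left₀ (Real.exp_pos _).le (exp_half q0.le q1) _
    · intro η _ _
      exact mul_nonneg (wt_pos _ _ _).le (pow_nonneg (by linarith) _)
  rw [Real.exp_sub, div_mul_eq_mul_div, le_div_iff₀ (Real.exp_pos _)]
  linarith

theorem pigeon (L N m : ℕ) (T : ℝ) (hT : 0 ≤ T) (η : Config) (hη : η ∈ OC L 0 N)
    (h : T < (((box L).filter (fun v => η v ≤ (m : ℤ))).card : ℝ)) :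
    ∃ i ∈ Finset.range (m + 1), T * (1 / 2) ^ (i + 1) ≤ ((lv L ((m - i : ℕ) : ℤ) η).card : ℝ) := by
  by_contra hc
  push Not at hc
  have h1 : (box L).filter (fun v => η v ≤ (m : ℤ)) ⊆
      (Finset.range (m + 1)).biUnion (fun i => lv L ((m - i : ℕ) : ℤ) η) := by
    intro v hv
    rw [Finset.mem_filter] at hv
    rw [Finset.mem_biUnion]
    rw [mem_OC] at hη
    have h0 := (hη.1 v hv.1).1
    refine ⟨m - (η v).toNat, by rw [Finset.mem_range]; omega, ?_⟩
    unfold lv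
    rw [Finset.mem_filter]
    exact ⟨hv.1, by omega⟩
  have h2 := (Finset.card_le_card h1).trans Finset.card_biUnion_le
  have h3 : (((box L).filter (fun v => η v ≤ (m : ℤ))).card : ℝ) ≤
      ∑ i ∈ Finset.range (m + 1), ((lv L ((m - i : ℕ) : ℤ) η).card : ℝ) := by exact_mod_cast h2
  have h4 : ∑ i ∈ Finset.range (m + 1), ((lv L ((m - i : ℕ) : ℤ) η).card : ℝ) ≤
      ∑ i ∈ Finset.range (m + 1), T * (1 / 2) ^ (i + 1) := Finset.sum_le_sum (fun i hi => (hc i hi).le)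
  have h5 : ∀ n : ℕ, ∑ i ∈ Finset.range n, T * (1 / 2 : ℝ) ^ (i + 1) = T * (1 - (1 / 2) ^ n) := by
    intro n
    induction n with
    | zero => simp
    | succ n ih => rw [Finset.sum_range_succ, ih]; ring
  rw [h5] at h4
  have : 0 ≤ T * (1 / 2 : ℝ) ^ (m + 1) := by positivity
  linarith

theorem rate {β : ℝ} (hβ : 1 ≤ β) {L m k i : ℕ} (hL : 0 < L) (hi : i ≤ m)
    (hH : 4 * β * (m + k) ≤ Real.log L) :
    L * (Real.exp (2 * β * k - 4 * β) / 4) ≤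
      Real.exp (-(4 * β * (((m - i : ℕ) : ℝ) + 1))) / 2 *
        ((Real.exp (-(2 * β * k)) * (L : ℝ) ^ 2) * (1 / 2) ^ (i + 1)) := by
  have hLp : (0 : ℝ) < L := by exact_mod_cast hL
  have h2 : (2 : ℝ) ^ i ≤ Real.exp (4 * β * i) := by
    have : (2 : ℝ) ≤ Real.exp (4 * β) := by
      have := Real.add_one_le_exp (4 * β)
      linarith
    calc (2 : ℝ) ^ i ≤ Real.exp (4 * β) ^ i := pow_le_pow_left₀ (by norm_num) this _
      _ = _ := by rw [← Real.exp_nat_mul]; congr 1; ring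
  have h3 : 1 ≤ Real.exp (4 * β * i) * (1 / 2) ^ i := by
    rw [one_div, inv_pow, ← div_eq_mul_inv, le_div_iff₀ (by positivity)]; linarith
  have h4 : Real.exp (4 * β * (m + k)) ≤ L := by
    rw [← Real.le_log_iff_exp_le hLp]; exact hH
  rw [Nat.cast_sub hi]
  have e : Real.exp (-(4 * β * (((m : ℝ) - i) + 1))) * Real.exp (-(2 * β * k)) * Real.exp (4 * β * (m + k)) =
      Real.exp (2 * β * k - 4 * β) * Real.exp (4 * β * i) := by
    rw [← Real.exp_add, ← Real.exp_add, ← Real.exp_add]; congr 1; ring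
  set a := Real.exp (-(4 * β * (((m : ℝ) - i) + 1))) with ha
  set b := Real.exp (-(2 * β * k)) with hb
  set c := Real.exp (2 * β * k - 4 * β) with hc
  set d := Real.exp (4 * β * i) with hd
  have hab : 0 < a * b := mul_pos (Real.exp_pos _) (Real.exp_pos _)
  have hcp : 0 < c := Real.exp_pos _
  have h5 : c * d ≤ a * b * L := by rw [← e]; exact mul_le_mul_of_nonneg_left h4 hab.le
  have hp : (0 : ℝ) < (1 / 2) ^ i := by positivity
  have h6 : c ≤ a * b * L * (1 / 2) ^ i := by
    calc c = c * 1 := by ring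
      _ ≤ c * (d * (1 / 2) ^ i) := mul_le_mul_of_nonneg_left h3 hcp.le
      _ = c * d * (1 / 2) ^ i := by ring
      _ ≤ _ := mul_le_mul_of_nonneg_right h5 hp.le
  have h7 := mul_le_mul_of_nonneg_left h6 hLp.le
  rw [pow_succ (1 / 2 : ℝ) i]
  linarith

theorem kbound {C1 β : ℝ} {k : ℕ} (hC : 0 < C1) (hβ : 1 ≤ β) (hk : 4 * (6 + C1) + 4 ≤ k) :
    Real.exp (β * k) + (1 + (4 + C1) * β) ≤ Real.exp (2 * β * k - 4 * β) / 4 := by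
  have e : Real.exp (2 * β * k - 4 * β) = Real.exp (β * k) * Real.exp (β * (k - 4)) := by
    rw [← Real.exp_add]; congr 1; ring
  have hk4 : (k : ℝ) - 4 ≤ β * (k - 4) := by nlinarith
  have h1 : 4 * (6 + C1) ≤ Real.exp (β * (k - 4)) := by
    have := Real.add_one_le_exp (β * ((k : ℝ) - 4))
    linarith
  have hb : β ≤ Real.exp (β * k) := by
    have := Real.add_one_le_exp (β * (k : ℝ))
    nlinarith
  have h2 := mul_le_mul_of_nonneg_left h1 (Real.exp_pos (β * k)).le
  rw [e]
  nlinarith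

theorem main_bound {C1 : ℝ} (hC : 0 < C1) {L0 : ℕ} (hg : ∀ β : ℝ, 1 ≤ β → ∀ L : ℕ, L0 ≤ L → ∀ N : ℕ,
    Real.log L ≤ N → ZZ β L 0 ((N : ℤ) + 1) ≤ Real.exp (C1 * β * L) * ZZ β L 0 N)
    {β : ℝ} (hβ : 1 ≤ β) {L N : ℕ} (hN : Real.log L ≤ N) {m k : ℕ} (hL : 0 < L) (hk1 : L0 ≤ k) (hk0 : 1 ≤ k)
    (hk : 4 * (6 + C1) + 4 ≤ k) (hH : 4 * β * (m + k) ≤ Real.log L) :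
    ∑ η ∈ (OC L 0 N).filter (fun η => Real.exp (-(2 * β * k)) * (L : ℝ) ^ 2 <
      (((box L).filter (fun v => η v ≤ (m : ℤ))).card : ℝ)), wt β L η ≤
      Real.exp (-(Real.exp (β * k) * L)) * ZZ β L 0 N := by
  have hLp : (0 : ℝ) < L := by exact_mod_cast hL
  have hm0 : (0 : ℝ) ≤ m := Nat.cast_nonneg _
  have hk0' : (1 : ℝ) ≤ k := by exact_mod_cast hk0
  have hlog := Real.log_le_sub_one_of_pos hLp
  have hmk : (m : ℝ) + k ≤ L := by nlinarith
  have hLL : L0 ≤ L := by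
    have : m + k ≤ L := by exact_mod_cast hmk
    omega
  have hZ : 0 < ZZ β L 0 N := lt_of_lt_of_le one_pos (ZZ_ge_one β L le_rfl (by omega))
  set T := Real.exp (-(2 * β * k)) * (L : ℝ) ^ 2 with hT
  set G := Real.exp (2 * β * k - 4 * β) / 4 with hG
  have each : ∀ i ∈ Finset.range (m + 1), ∑ η ∈ (OC L 0 N).filter (fun η => T * (1 / 2) ^ (i + 1) ≤
      ((lv L ((m - i : ℕ) : ℤ) η).card : ℝ)), wt β L η ≤
      Real.exp (4 * β * L - L * G + C1 * β * L) * ZZ β L 0 N := by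
    intro i hi
    rw [Finset.mem_range] at hi
    refine (cheb β (by linarith) L N (m - i) (T * (1 / 2) ^ (i + 1))).trans ?_
    have r := rate hβ (k := k) hL (by omega : i ≤ m) hH
    rw [← hT, ← hG] at r
    rw [Real.exp_add, mul_assoc (Real.exp _) (Real.exp _)]
    apply mul_le_mul _ (hg β hβ L hLL N hN)
      (le_trans zero_le_one (ZZ_ge_one β L le_rfl (by omega))) (Real.exp_pos _).le
    apply Real.exp_le_exp.2
    linarith
  have sub : (OC L 0 N).filter (fun η => T < (((box L).filter (fun v => η v ≤ (m : ℤ))).card : ℝ)) ⊆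
      (Finset.range (m + 1)).biUnion (fun i => (OC L 0 N).filter (fun η => T * (1 / 2) ^ (i + 1) ≤
      ((lv L ((m - i : ℕ) : ℤ) η).card : ℝ))) := by
    intro η hη
    rw [Finset.mem_filter] at hη
    obtain ⟨i, hi, h⟩ := pigeon L N m T (by positivity) η hη.1 hη.2
    rw [Finset.mem_biUnion]
    exact ⟨i, hi, Finset.mem_filter.2 ⟨hη.1, h⟩⟩
  have s1 := Finset.sum_le_sum_of_subset_of_nonneg sub (f := wt β L) (fun _ _ _ => (wt_pos _ _ _).le)
  have s2 := sum_biU (Finset.range (m + 1)) (fun i => (OC L 0 N).filter (fun η => T * (1 / 2) ^ (i + 1) ≤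
      ((lv L ((m - i : ℕ) : ℤ) η).card : ℝ))) (wt β L) (fun _ => (wt_pos _ _ _).le)
  have s3 := Finset.sum_le_sum each
  rw [Finset.sum_const, Finset.card_range, nsmul_eq_mul] at s3
  refine s1.trans (s2.trans (s3.trans ?_))
  rw [← mul_assoc]
  apply mul_le_mul_of_nonneg_right _ hZ.le
  have hm1 : ((m + 1 : ℕ) : ℝ) ≤ Real.exp L := by
    have := Real.add_one_le_exp (L : ℝ)
    push_cast; linarith
  calc _ ≤ Real.exp L * Real.exp (4 * β * L - L * G + C1 * β * L) :=
        mul_le_mul_of_nonneg_right hm1 (Real.exp_pos _).le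
    _ = Real.exp (L + (4 * β * L - L * G + C1 * β * L)) := by rw [← Real.exp_add]
    _ ≤ _ := by
      apply Real.exp_le_exp.2
      have := mul_le_mul_of_nonneg_left (kbound hC hβ hk) hLp.le
      rw [← hG] at this
      linarith

theorem low_empty {L N : ℕ} {z : ℤ} {η : Config} (hη : η ∈ OC L 0 N) (hc : ¬ (0 < L ∧ 0 ≤ z)) {T : ℝ}
    (hT : 0 ≤ T) (hA : T < (((box L).filter (fun v => η v ≤ z)).card : ℝ)) : False := by
  rw [mem_OC] at hη
  have : (box L).filter (fun v => η v ≤ z) = ∅ := by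
    apply Finset.filter_false_of_mem
    intro v hv h
    have h0 := (hη.1 v hv).1
    rw [mem_box] at hv
    apply hc
    constructor <;> omega
  rw [this, Finset.card_empty, Nat.cast_zero] at hA
  linarith

/-- Theorem 3.1, Eq. (3.1) of the paper. Let `Λ = {1,…,L}²`, `β ≥ 1`
and `H = ⌊log L/(4β)⌋`. There is an absolute integer constant `K` such that for every
integer `k ≥ K`,
`π_Λ^0(#{v : η_v ≤ H − k} > e^{−2βk} L²) ≤ exp(−e^{βk} L)`. -/
theorem sos_downward_deviations :
    ∃ K : ℕ, 0 < K ∧ ∀ β : ℝ, 1 ≤ β →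
      ∀ L np : ℕ, Real.log L ≤ (np : ℝ) → (np : ℝ) ≤ (L : ℝ) →
        ∀ k : ℕ, K ≤ k →
          gProb β (box L) 0 (Set.Icc 0 (np : ℤ)) (fun _ => 0)
              {η | Real.exp (-(2 * β * k)) * (L : ℝ) ^ 2 <
                    (((box L).filter (fun v => η v ≤ eqHt β L - (k : ℤ))).card : ℝ)} ≤
            Real.exp (-(Real.exp (β * k) * L)) := by
  obtain ⟨C1, hC, L0, hg⟩ := growth
  refine ⟨L0 + 1 + ⌈4 * (6 + C1) + 4⌉₊, by omega, ?_⟩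
  intro β hβ L np hnp _ k hk
  have hk' : 4 * (6 + C1) + 4 ≤ k := (Nat.le_ceil _).trans (by exact_mod_cast (by omega))
  rw [gProb_eq]
  have hZ : 0 < ZZ β L 0 np := lt_of_lt_of_le one_pos (ZZ_ge_one β L le_rfl (by omega))
  rw [div_le_iff₀ hZ]
  by_cases hc : 0 < L ∧ 0 ≤ eqHt β L - (k : ℤ)
  · obtain ⟨m, hm⟩ := Int.eq_ofNat_of_zero_le hc.2
    have hH : 4 * β * (m + k) ≤ Real.log L := by
      have h1 : ((eqHt β L : ℤ) : ℝ) ≤ Real.log L / (4 * β) := Int.floor_le _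
      have h2 : ((eqHt β L : ℤ) : ℝ) = m + k := by
        have : eqHt β L = (m : ℤ) + k := by omega
        rw [this]; push_cast; rfl
      rw [h2, le_div_iff₀ (by linarith)] at h1
      linarith
    have := main_bound hC hg hβ hnp (m := m) (k := k) hc.1 (by omega) (by omega) hk' hH
    rw [hm]
    simpa only [Set.mem_ofPred_eq] using this
  · rw [Finset.filter_false_of_mem]
    · rw [Finset.sum_empty]
      exact mul_nonneg (Real.exp_pos _).le hZ.le
    · intro η hη hA
      rw [Set.mem_ofPred_eq] at hA
      exact low_empty hη hc (mul_nonneg (Real.exp_pos _).le (sq_nonneg _)) hA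

end SOSPaper
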